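/- arXiv:math/0701351 — 2 statements merged into one kernel-verified Lean document; each statement's English description precedes it below -/
import Mathlib

section
/- Let K ⊆ ℂ be a number field, let a, b be nonzero elements of K, and let A = (a,b/K) be the quaternion algebra. Then the following two conditions hold simultaneously — (i) A is a Schur algebra, i.e., there is a finite subgroup of A* generating A as a K-algebra, and (ii) A ramifies at all but at most one infinite place of K, i.e., the number of field embeddings σ : K → ℝ with not(σ(a) < 0 and σ(b) < 0), plus the number of pairs of conjugate non-real embeddings K → ℂ, is at most 1 — if and only if A is isomorphic as a K-algebra to one of the following: (1) M₂(K), with K = ℚ or K an imaginary quadratic extension of ℚ; (2) (−1,−1/K), with K = ℚ(√d) for d a squarefree negative integer with d ≡ 1 (mod 8); (3) (−1,−3/K), with K = ℚ(√d) for d a squarefree negative integer with d ≡ 1 (mod 3); (4) (λ_n²,−1/K), where n ≥ 3, ζ_n = exp(2πi/n), λ_n = ζ_n − ζ_n⁻¹, the element η_n = ζ_n + ζ_n⁻¹ lies in K, and K has at least one embedding into ℝ and at most one pair of conjugate non-real embeddings into ℂ. -/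
open Quaternion

set_option linter.all false

set_option maxHeartbeats 800000 in
/-- Legendre type lemma: a pigeonhole proof. -/
theorem legendre_aux (A m : ℕ) (hA : 0 < A) (hm : 0 < m) (hAs : ¬ IsSquare A)
    (hco : Nat.Coprime A m) (c e : ℤ) (hc : (m : ℤ) ∣ c ^ 2 + A) (he : (A : ℤ) ∣ e ^ 2 - m) :
    ∃ x y : ℚ, (m : ℚ) = x ^ 2 + A * y ^ 2 := by
  have : NeZero A := ⟨hA.ne'⟩
  have : NeZero m := ⟨hm.ne'⟩
  set s1 := Nat.sqrt (A * m)
  set s2 := Nat.sqrt A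
  set s3 := Nat.sqrt m
  have h1 : A * m < (s1 + 1) * (s1 + 1) := Nat.lt_succ_sqrt _
  have h2 : A < (s2 + 1) * (s2 + 1) := Nat.lt_succ_sqrt _
  have h3 : m < (s3 + 1) * (s3 + 1) := Nat.lt_succ_sqrt _
  have k1 : s1 * s1 ≤ A * m := Nat.sqrt_le _
  have k2 : s2 * s2 ≤ A := Nat.sqrt_le _
  have k3 : s3 * s3 ≤ m := Nat.sqrt_le _
  have hcard : Fintype.card (ZMod m × ZMod A) <
      Fintype.card (Fin (s1 + 1) × Fin (s2 + 1) × Fin (s3 + 1)) := by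
    simp only [Fintype.card_prod, ZMod.card, Fintype.card_fin]
    by_contra hcon
    push Not at hcon
    have h4 : A * m < ((s2 + 1) * (s3 + 1)) * ((s2 + 1) * (s3 + 1)) := by
      calc A * m < ((s2 + 1) * (s2 + 1)) * ((s3 + 1) * (s3 + 1)) := Nat.mul_lt_mul'' h2 h3
        _ = _ := by ring
    have h5 := Nat.mul_lt_mul'' h1 h4
    have h6 := Nat.mul_le_mul hcon hcon
    nlinarith
  obtain ⟨⟨z, t, w⟩, ⟨z', t', w'⟩, hne, hf⟩ := Fintype.exists_ne_map_eq_of_card_lt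
    (fun v : Fin (s1 + 1) × Fin (s2 + 1) × Fin (s3 + 1) =>
      ((((v.1 : ℕ) : ZMod m) - (c : ZMod m) * ((v.2.2 : ℕ) : ZMod m),
       ((v.1 : ℕ) : ZMod A) - (e : ZMod A) * ((v.2.1 : ℕ) : ZMod A)) : ZMod m × ZMod A)) hcard
  simp only [Prod.mk.injEq] at hf
  obtain ⟨hf1, hf2⟩ := hf
  obtain ⟨Z, hZ⟩ : ∃ Z : ℤ, Z = (z : ℕ) - (z' : ℕ) := ⟨_, rfl⟩
  obtain ⟨T, hT⟩ : ∃ T : ℤ, T = (t : ℕ) - (t' : ℕ) := ⟨_, rfl⟩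
  obtain ⟨W, hW⟩ : ∃ W : ℤ, W = (w : ℕ) - (w' : ℕ) := ⟨_, rfl⟩
  have d1 : (m : ℤ) ∣ Z - c * W := by
    rw [← ZMod.intCast_zmod_eq_zero_iff_dvd, hZ, hW]
    push_cast
    linear_combination hf1
  have d2 : (A : ℤ) ∣ Z - e * T := by
    rw [← ZMod.intCast_zmod_eq_zero_iff_dvd, hZ, hT]
    push_cast
    linear_combination hf2
  have hnz : ¬ (Z = 0 ∧ T = 0 ∧ W = 0) := by
    rintro ⟨a1, a2, a3⟩
    apply hne
    ext <;> simp <;> omega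
  have bZ : Z ^ 2 ≤ (A * m : ℤ) := by
    have : |Z| ≤ s1 := by rw [abs_le]; constructor <;> omega
    have h := sq_le_sq' (abs_le.mp this).1 (abs_le.mp this).2
    have : (s1 : ℤ) * s1 ≤ A * m := by exact_mod_cast k1
    exact h.trans (by rw [sq]; exact this)
  have bT : T ^ 2 ≤ (A : ℤ) := by
    have : |T| ≤ s2 := by rw [abs_le]; constructor <;> omega
    have h := sq_le_sq' (abs_le.mp this).1 (abs_le.mp this).2
    have : (s2 : ℤ) * s2 ≤ A := by exact_mod_cast k2
    exact h.trans (by rw [sq]; exact this)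
  have bW : W ^ 2 ≤ (m : ℤ) := by
    have : |W| ≤ s3 := by rw [abs_le]; constructor <;> omega
    have h := sq_le_sq' (abs_le.mp this).1 (abs_le.mp this).2
    have : (s3 : ℤ) * s3 ≤ m := by exact_mod_cast k3
    exact h.trans (by rw [sq]; exact this)
  have bT' : T ^ 2 ≠ (A : ℤ) := by
    intro h
    apply hAs
    refine ⟨T.natAbs, ?_⟩
    zify
    rw [← h, ← sq, sq_abs]
  have hAZ : (0 : ℤ) < A := by exact_mod_cast hA
  have hmZ : (0 : ℤ) < m := by exact_mod_cast hm
  have e1 : (m : ℤ) ∣ Z ^ 2 + A * W ^ 2 - m * T ^ 2 := by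
    have : Z ^ 2 + A * W ^ 2 - m * T ^ 2 =
      (Z - c * W) * (Z + c * W) + (c ^ 2 + A) * W ^ 2 - m * T ^ 2 := by ring
    rw [this]
    exact dvd_sub (dvd_add (d1.mul_right _) (hc.mul_right _)) (dvd_mul_right _ _)
  have e2 : (A : ℤ) ∣ Z ^ 2 + A * W ^ 2 - m * T ^ 2 := by
    have : Z ^ 2 + A * W ^ 2 - m * T ^ 2 =
      (Z - e * T) * (Z + e * T) + (e ^ 2 - m) * T ^ 2 + A * W ^ 2 := by ring
    rw [this]
    exact dvd_add (dvd_add (d2.mul_right _) (he.mul_right _)) (dvd_mul_right _ _)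
  obtain ⟨k, hk⟩ : (A * m : ℤ) ∣ Z ^ 2 + A * W ^ 2 - m * T ^ 2 :=
    IsCoprime.mul_dvd (by exact_mod_cast Nat.isCoprime_iff_coprime.mpr hco) e2 e1
  have hAm : (0 : ℤ) < A * m := mul_pos hAZ hmZ
  have hk1 : -1 < k := by
    by_contra h
    have : (A * m : ℤ) * k ≤ A * m * (-1) := mul_le_mul_of_nonneg_left (by omega) hAm.le
    have h7 : T ^ 2 < A := lt_of_le_of_ne bT bT'
    have h8 := mul_lt_mul_of_pos_left h7 hmZ
    have h9 := mul_nonneg hAZ.le (sq_nonneg W)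
    have h10 := sq_nonneg Z
    have h11 : (A * m : ℤ) * (-1) = - (m * A) := by ring
    linarith
  have hk2 : k ≤ 2 := by
    by_contra h
    have : (A * m : ℤ) * 3 ≤ A * m * k := mul_le_mul_of_nonneg_left (by omega) hAm.le
    have h8 := mul_nonneg hmZ.le (sq_nonneg T)
    have h9 := mul_le_mul_of_nonneg_left bW hAZ.le
    linarith
  interval_cases k
  · -- zero
    have hT0 : T ≠ 0 := by
      intro h
      apply hnz
      have hk0 : Z ^ 2 + A * W ^ 2 = 0 := by rw [h] at hk; linear_combination hk
      have h9 := mul_nonneg hAZ.le (sq_nonneg W)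
      have h10 := sq_nonneg Z
      have hz : Z ^ 2 = 0 := by linarith
      have hw : (A : ℤ) * W ^ 2 = 0 := by linarith
      refine ⟨by simpa using hz, h, ?_⟩
      rcases mul_eq_zero.mp hw with h | h
      · omega
      · simpa using h
    have hTq : (T : ℚ) ≠ 0 := by exact_mod_cast hT0
    refine ⟨Z / T, W / T, ?_⟩
    have hk' : (Z : ℚ) ^ 2 + A * W ^ 2 - m * T ^ 2 = A * m * 0 := by exact_mod_cast hk
    field_simp
    linear_combination -hk'
  · have hk' : (Z : ℚ) ^ 2 + A * W ^ 2 - m * T ^ 2 = A * m * 1 := by exact_mod_cast hk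
    have hpos : (T : ℚ) ^ 2 + A ≠ 0 := by
      have : (0 : ℚ) < A := by exact_mod_cast hA
      positivity
    refine ⟨(Z * T + W * A) / (T ^ 2 + A), (W * T - Z) / (T ^ 2 + A), ?_⟩
    field_simp
    linear_combination (-(T : ℚ) ^ 2 - A) * hk'
  · have : W ^ 2 = (m : ℤ) := by
      have h8 := mul_nonneg hmZ.le (sq_nonneg T)
      have h9 := mul_le_mul_of_nonneg_left bW hAZ.le
      have h10 : (A : ℤ) * W ^ 2 = A * m := by linarith
      exact mul_left_cancel₀ hAZ.ne' h10
    refine ⟨W, 0, ?_⟩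
    have : (W : ℚ) ^ 2 = m := by exact_mod_cast this
    linear_combination -this

open scoped NumberTheorySymbols in
theorem exists_prime_aux (k M N s B : ℕ) (hM : 0 < M) (hN : 0 < N) (hk : Nat.Coprime k M)
    (hMN : Nat.Coprime M N) (hs : Nat.Coprime s N) :
    ∃ q : ℕ, B < q ∧ q.Prime ∧ M ∣ k * q + 1 ∧ q % N = s % N := by
  have : NeZero M := ⟨hM.ne'⟩
  obtain ⟨r, hr⟩ : ∃ r : ℕ, M ∣ k * r + 1 := by
    refine ⟨(-(k : ZMod M)⁻¹).val, ?_⟩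
    rw [← ZMod.natCast_eq_zero_iff]
    push_cast
    rw [ZMod.natCast_zmod_val, mul_neg, ZMod.coe_mul_inv_eq_one k hk]
    ring
  have hrM : Nat.Coprime r M := by
    have h1 : Nat.Coprime (k * r) M := by
      obtain ⟨c, hc⟩ := hr
      refine Nat.Coprime.coprime_dvd_right (Dvd.intro c rfl : M ∣ M * c) ?_
      rw [← hc]
      simp
    exact Nat.Coprime.coprime_mul_left h1
  obtain ⟨x, hx1, hx2⟩ := Nat.chineseRemainder hMN r s
  have hxu : Nat.Coprime x (M * N) := by
    apply Nat.Coprime.mul_right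
    · rw [Nat.Coprime, hx1.gcd_eq]; exact hrM
    · rw [Nat.Coprime, hx2.gcd_eq]; exact hs
  obtain ⟨q, hqB, hqp, hq⟩ := Nat.forall_exists_prime_gt_and_modEq B
    (Nat.mul_ne_zero hM.ne' hN.ne') hxu
  refine ⟨q, hqB, hqp, ?_, ?_⟩
  · have h1 : q ≡ r [MOD M] := (Nat.ModEq.of_mul_right N hq).trans hx1
    have h2 : k * q + 1 ≡ k * r + 1 [MOD M] := (h1.mul_left k).add_right 1
    exact (Nat.modEq_zero_iff_dvd).mp (h2.trans (Nat.modEq_zero_iff_dvd.mpr hr))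
  · exact (Nat.ModEq.of_mul_left M hq).trans hx2

open scoped NumberTheorySymbols in
theorem jacobi_of_dvd (k q M : ℕ) (h : M ∣ k * q + 1) : J(-(k : ℤ) | M) * J((q : ℤ) | M) = 1 := by
  rw [← jacobiSym.mul_left]
  have : J(-(k : ℤ) * q | M) = J(1 | M) := by
    apply jacobiSym.mod_left'
    rw [← Int.ModEq]
    apply Int.ModEq.symm
    rw [Int.modEq_iff_dvd]
    have h' : (M : ℤ) ∣ k * q + 1 := by exact_mod_cast h
    have e : -(k : ℤ) * q - 1 = -(k * q + 1) := by ring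
    rw [e]; exact (dvd_neg).mpr h'
  rw [this, jacobiSym.one_left]

open scoped NumberTheorySymbols in
theorem exists_root_aux (a : ℤ) (q : ℕ) (hq : q.Prime) (h : J(a | q) = 1) :
    ∃ e : ℤ, (q : ℤ) ∣ e ^ 2 - a := by
  have : Fact q.Prime := ⟨hq⟩
  obtain ⟨y, hy⟩ := ZMod.isSquare_of_jacobiSym_eq_one h
  obtain ⟨e, rfl⟩ := ZMod.intCast_surjective y
  refine ⟨e, ?_⟩
  rw [← ZMod.intCast_zmod_eq_zero_iff_dvd]
  push_cast
  rw [hy]; ring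

open scoped NumberTheorySymbols in
theorem jacobi_neg_three (M : ℕ) (hM : Odd M) : J(-3 | M) = J((M : ℤ) | 3) := by
  rw [jacobiSym.neg _ hM]
  have h2 := Nat.odd_iff.mp hM
  have h4 : M % 4 = 1 ∨ M % 4 = 3 := by omega
  rcases h4 with h4 | h4
  · rw [ZMod.χ₄_nat_one_mod_four h4, one_mul]
    exact_mod_cast jacobiSym.quadratic_reciprocity_one_mod_four' (a := 3) (by decide) h4
  · rw [ZMod.χ₄_nat_three_mod_four h4]
    have := jacobiSym.quadratic_reciprocity_three_mod_four (a := 3) (b := M) (by norm_num) h4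
    push_cast at this
    rw [this]; ring

open scoped NumberTheorySymbols in
theorem jacobi_mod_three (M : ℕ) : (M % 3 = 1 → J((M : ℤ) | 3) = 1) ∧
    (M % 3 = 2 → J((M : ℤ) | 3) = -1) := by
  constructor
  · intro h
    rw [jacobiSym.mod_left, show ((M : ℤ) % (3 : ℕ)) = 1 by omega]
    norm_num
  · intro h
    rw [jacobiSym.mod_left, show ((M : ℤ) % (3 : ℕ)) = 2 by omega]
    norm_num

theorem not_sq_mul_prime (k q : ℕ) (hq : q.Prime) (hk : Nat.Coprime k q) : ¬ IsSquare (k * q) := by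
  rintro ⟨r, hr⟩
  have h1 : q ∣ r := by
    have : q ∣ r * r := by rw [← hr]; exact dvd_mul_left _ _
    rcases hq.dvd_mul.mp this with h | h <;> exact h
  obtain ⟨s, rfl⟩ := h1
  have h2 : k = q * (s * s) := by
    apply Nat.eq_of_mul_eq_mul_right hq.pos
    rw [hr]; ring
  have : q ∣ k := ⟨_, h2⟩
  have h3 := Nat.eq_one_of_dvd_coprimes hk this dvd_rfl
  exact hq.one_lt.ne' h3

theorem coprime_of_dvd_add_one (A M : ℕ) (h : M ∣ A + 1) : Nat.Coprime A M := by
  obtain ⟨c, hc⟩ := h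
  refine Nat.Coprime.coprime_dvd_right (Dvd.intro c rfl : M ∣ M * c) ?_
  rw [← hc]; simp

theorem legendre_aux' (A m : ℕ) (hA : 0 < A) (hm : 0 < m) (hAs : ¬ IsSquare A)
    (h : m ∣ A + 1) (e : ℤ) (he : (A : ℤ) ∣ e ^ 2 - m) :
    ∃ x y : ℚ, (m : ℚ) = x ^ 2 + A * y ^ 2 := by
  refine legendre_aux A m hA hm hAs (coprime_of_dvd_add_one _ _ h) 1 e ?_ he
  have : (m : ℤ) ∣ A + 1 := by exact_mod_cast h
  simpa [add_comm] using this

open scoped NumberTheorySymbols in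
theorem three_squares_rat (m : ℕ) (hm : 0 < m) (hsq : Squarefree m) (h7 : m % 8 ≠ 7) :
    ∃ x y z : ℚ, (m : ℚ) = x ^ 2 + y ^ 2 + z ^ 2 := by
  have h4 : m % 4 ≠ 0 := by
    intro h
    have : 2 * 2 ∣ m := Nat.dvd_of_mod_eq_zero h
    have := hsq 2 this
    simp at this
  have fin1 : ∀ q : ℕ, q.Prime → q % 4 = 1 → m ∣ q + 1 → J((m : ℤ) | q) = 1 →
      ∃ x y z : ℚ, (m : ℚ) = x ^ 2 + y ^ 2 + z ^ 2 := by
    intro q hq h1 hd hJ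
    have : Fact q.Prime := ⟨hq⟩
    obtain ⟨e, he⟩ := exists_root_aux _ q hq hJ
    obtain ⟨x, y, h⟩ := legendre_aux' q m hq.pos hm
      (by simpa using not_sq_mul_prime 1 q hq (by simp)) hd e he
    obtain ⟨u, v, huv⟩ := Nat.Prime.sq_add_sq (p := q) (by omega)
    refine ⟨x, u * y, v * y, ?_⟩
    rw [h, ← huv]; push_cast; ring
  have hcases : m % 4 = 1 ∨ m % 8 = 3 ∨ m % 4 = 2 := by omega
  rcases hcases with h | h | h
  · have hodd : Odd m := Nat.odd_iff.mpr (by omega)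
    obtain ⟨q, -, hq, hd, hq4⟩ := exists_prime_aux 1 m 4 1 2 hm (by norm_num) (by simp)
      (by have := (Nat.coprime_two_right (n := m)).mpr hodd
          exact Nat.Coprime.pow_right 2 this) (by norm_num)
    rw [one_mul] at hd
    refine fin1 q hq (by omega) hd ?_
    rw [jacobiSym.quadratic_reciprocity_one_mod_four h (Nat.odd_iff.mpr (by omega))]
    have := jacobi_of_dvd 1 q m (by simpa using hd)
    rw [Nat.cast_one, jacobiSym.at_neg_one hodd, ZMod.χ₄_nat_one_mod_four h, one_mul] at this
    exact this
  · have hodd : Odd m := Nat.odd_iff.mpr (by omega)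
    have h2m := (Nat.coprime_two_right (n := m)).mpr hodd
    obtain ⟨q, -, hq, hd, hq4⟩ := exists_prime_aux 2 m 4 1 2 hm (by norm_num) h2m.symm
      (Nat.Coprime.pow_right 2 h2m) (by norm_num)
    have : Fact q.Prime := ⟨hq⟩
    have hJ : J((m : ℤ) | q) = 1 := by
      rw [jacobiSym.quadratic_reciprocity_one_mod_four' hodd (by omega)]
      have := jacobi_of_dvd 2 q m hd
      rw [Nat.cast_ofNat, jacobiSym.at_neg_two hodd, ZMod.χ₈'_nat_eq_if_mod_eight] at this
      simpa [h, Nat.odd_iff.mp hodd] using this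
    obtain ⟨e0, he0⟩ := exists_root_aux _ q hq hJ
    have hcop : IsCoprime (2 : ℤ) q := by
      have : Nat.Coprime 2 q := (Nat.coprime_two_left).mpr (Nat.odd_iff.mpr (by omega))
      exact_mod_cast Nat.isCoprime_iff_coprime.mpr this
    obtain ⟨e, he⟩ : ∃ e : ℤ, ((2 * q : ℕ) : ℤ) ∣ e ^ 2 - m := by
      push_cast
      rcases Int.even_or_odd e0 with h0 | h0
      · refine ⟨e0 + q, hcop.mul_dvd ?_ ?_⟩
        · rw [← even_iff_two_dvd]
          have hq' : Odd (q : ℤ) := by rw [Int.odd_iff]; omega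
          have hm' : Odd (m : ℤ) := by rw [Int.odd_iff]; omega
          exact ((h0.add_odd hq').pow).sub_odd hm'
        · have : (e0 + q) ^ 2 - (m : ℤ) = (e0 ^ 2 - m) + q * (2 * e0 + q) := by ring
          rw [this]; exact dvd_add he0 (dvd_mul_right _ _)
      · refine ⟨e0, hcop.mul_dvd ?_ he0⟩
        rw [← even_iff_two_dvd]
        have hm' : Odd (m : ℤ) := by rw [Int.odd_iff]; omega
        exact (h0.pow).sub_odd hm'
    obtain ⟨x, y, hxy⟩ := legendre_aux' (2 * q) m (by have := hq.pos; omega) hm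
      (not_sq_mul_prime 2 q hq (by exact_mod_cast Nat.isCoprime_iff_coprime.mp hcop)) hd e he
    obtain ⟨u, v, huv⟩ := Nat.Prime.sq_add_sq (p := q) (by omega)
    refine ⟨x, (u + v) * y, (u - v) * y, ?_⟩
    rw [hxy, ← huv]; push_cast; ring
  · obtain ⟨m', rfl⟩ : 2 ∣ m := by omega
    have hodd : Odd m' := Nat.odd_iff.mpr (by omega)
    have h2m := (Nat.coprime_two_right (n := m')).mpr hodd
    have hm' : m' % 4 = 1 ∨ m' % 4 = 3 := by omega
    have key : ∀ q : ℕ, q.Prime → q % 4 = 1 → m' ∣ 1 * q + 1 → J((2 : ℤ) | q) * ZMod.χ₄ m' = 1 →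
       ∃ x y z : ℚ, ((2 * m' : ℕ) : ℚ) = x ^ 2 + y ^ 2 + z ^ 2 := by
      intro q hq hq4 hd hJ
      have hqo : Odd q := Nat.odd_iff.mpr (by omega)
      refine fin1 q hq hq4 ?_ ?_
      · exact Nat.Coprime.mul_dvd_of_dvd_of_dvd h2m.symm (by omega) (by simpa using hd)
      · push_cast
        rw [jacobiSym.mul_left, jacobiSym.quadratic_reciprocity_one_mod_four' hodd hq4]
        have := jacobi_of_dvd 1 q m' hd
        rw [Nat.cast_one, jacobiSym.at_neg_one hodd] at this
        rcases hm' with h | h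
        · rw [ZMod.χ₄_nat_one_mod_four h] at this hJ
          rw [one_mul] at this
          rw [this]; exact hJ
        · rw [ZMod.χ₄_nat_three_mod_four h] at this hJ
          have t2 : J((q : ℤ) | m') = -1 := by linarith
          rw [t2]; exact hJ
    have h8 : Nat.Coprime m' 8 := Nat.Coprime.pow_right 3 h2m
    rcases hm' with h | h
    · obtain ⟨q, -, hq, hd, hq8⟩ := exists_prime_aux 1 m' 8 1 2 (by omega) (by norm_num) (by simp)
        h8 (by norm_num)
      refine key q hq (by omega) hd ?_
      rw [jacobiSym.at_two (Nat.odd_iff.mpr (by omega)), ZMod.χ₈_nat_eq_if_mod_eight,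
        ZMod.χ₄_nat_one_mod_four h]
      simp [hq8, show q % 2 = 1 by omega]
    · obtain ⟨q, -, hq, hd, hq8⟩ := exists_prime_aux 1 m' 8 5 2 (by omega) (by norm_num) (by simp)
        h8 (by norm_num)
      refine key q hq (by omega) hd ?_
      rw [jacobiSym.at_two (Nat.odd_iff.mpr (by omega)), ZMod.χ₈_nat_eq_if_mod_eight,
        ZMod.χ₄_nat_three_mod_four h]
      simp [hq8, show q % 2 = 1 by omega]

open scoped NumberTheorySymbols in
theorem one_three_three_rat (m : ℕ) (hm : 0 < m) (hsq : Squarefree m) (h3 : m % 3 ≠ 2) :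
    ∃ x y z : ℚ, (m : ℚ) = x ^ 2 + 3 * y ^ 2 + 3 * z ^ 2 := by
  have h4 : m % 4 ≠ 0 := by
    intro h
    have : 2 * 2 ∣ m := Nat.dvd_of_mod_eq_zero h
    have := hsq 2 this
    simp at this
  have h9 : m % 9 ≠ 0 := by
    intro h
    have : 3 * 3 ∣ m := Nat.dvd_of_mod_eq_zero h
    have := hsq 3 this
    simp at this
  have hcases : m % 3 = 1 ∨ m % 3 = 0 := by omega
  rcases hcases with h | h
  · have fin1 : ∀ q : ℕ, 3 < q → q.Prime → q % 4 = 1 → m ∣ 3 * q + 1 → J((m : ℤ) | q) = 1 →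
        ∃ x y z : ℚ, (m : ℚ) = x ^ 2 + 3 * y ^ 2 + 3 * z ^ 2 := by
      intro q hq3 hq h1 hd hJ
      have : Fact q.Prime := ⟨hq⟩
      obtain ⟨e0, he0⟩ := exists_root_aux _ q hq hJ
      have hcop' : Nat.Coprime 3 q := (Nat.coprime_primes Nat.prime_three hq).mpr (by omega)
      have hcop : IsCoprime (3 : ℤ) q := by
        exact_mod_cast Nat.isCoprime_iff_coprime.mpr hcop'
      obtain ⟨e, he⟩ : ∃ e : ℤ, ((3 * q : ℕ) : ℤ) ∣ e ^ 2 - m := by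
        push_cast
        obtain ⟨u, v, huv⟩ := hcop
        refine ⟨e0 * (u * 3) + v * q, IsCoprime.mul_dvd ⟨u, v, huv⟩ ?_ ?_⟩
        · have hm3 : (3 : ℤ) ∣ 1 - m := by omega
          have : (e0 * (u * 3) + v * q) ^ 2 - (m : ℤ) =
            3 * (u * (e0 - 1) * (e0 * (u * 3) + v * q + 1)) + (1 - m) := by
            have : (v : ℤ) * q = 1 - u * 3 := by linarith
            rw [this]; ring
          rw [this]; exact dvd_add (dvd_mul_right _ _) hm3
        · have : (e0 * (u * 3) + v * q) ^ 2 - (m : ℤ) =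
            (e0 ^ 2 - m) + q * (v * (1 - e0) * (e0 * (u * 3) + v * q + e0)) := by
            have : (u : ℤ) * 3 = 1 - v * q := by linarith
            rw [this]; ring
          rw [this]; exact dvd_add he0 (dvd_mul_right _ _)
      obtain ⟨x, y, hxy⟩ := legendre_aux' (3 * q) m (by omega) hm
        (not_sq_mul_prime 3 q hq hcop') hd e he
      obtain ⟨u, v, huv⟩ := Nat.Prime.sq_add_sq (p := q) (by omega)
      refine ⟨x, u * y, v * y, ?_⟩
      rw [hxy, ← huv]; push_cast; ring
    have c3 : ∀ k : ℕ, k % 3 ≠ 0 → Nat.Coprime 3 k := fun k hk =>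
      (Nat.Prime.coprime_iff_not_dvd Nat.prime_three).mpr (by omega)
    rcases Nat.even_or_odd m with hev | hodd
    · obtain ⟨m', rfl⟩ : 2 ∣ m := hev.two_dvd
      have hodd : Odd m' := Nat.odd_iff.mpr (by omega)
      have h2m := (Nat.coprime_two_right (n := m')).mpr hodd
      obtain ⟨q, hq3, hq, hd, hq8⟩ := exists_prime_aux 3 m' 8 5 3 (by omega) (by norm_num)
        (c3 m' (by omega)) (Nat.Coprime.pow_right 3 h2m) (by norm_num)
      refine fin1 q hq3 hq (by omega) ?_ ?_
      · exact Nat.Coprime.mul_dvd_of_dvd_of_dvd h2m.symm (by omega) hd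
      · push_cast
        rw [jacobiSym.mul_left, jacobiSym.quadratic_reciprocity_one_mod_four' hodd (by omega),
          jacobiSym.at_two (Nat.odd_iff.mpr (by omega)), ZMod.χ₈_nat_eq_if_mod_eight]
        have := jacobi_of_dvd 3 q m' hd
        rw [Nat.cast_ofNat, jacobi_neg_three m' hodd, (jacobi_mod_three m').2 (by omega)] at this
        have t2 : J((q : ℤ) | m') = -1 := by linarith
        rw [t2]
        simp [hq8, show q % 2 = 1 by omega]
    · have h2m := (Nat.coprime_two_right (n := m)).mpr hodd
      obtain ⟨q, hq3, hq, hd, hq4⟩ := exists_prime_aux 3 m 4 1 3 hm (by norm_num)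
        (c3 m (by omega)) (Nat.Coprime.pow_right 2 h2m) (by norm_num)
      refine fin1 q hq3 hq (by omega) hd ?_
      rw [jacobiSym.quadratic_reciprocity_one_mod_four' hodd (by omega)]
      have := jacobi_of_dvd 3 q m hd
      rwa [Nat.cast_ofNat, jacobi_neg_three m hodd, (jacobi_mod_three m).1 (by omega),
        one_mul] at this
  · obtain ⟨s, rfl⟩ : 3 ∣ m := by omega
    obtain ⟨s', hodd, hs'⟩ : ∃ s' : ℕ, Odd s' ∧ (s = s' ∨ s = 2 * s') := by
      rcases Nat.even_or_odd s with hev | hodd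
      · obtain ⟨m', rfl⟩ : 2 ∣ s := hev.two_dvd
        exact ⟨m', Nat.odd_iff.mpr (by omega), Or.inr rfl⟩
      · exact ⟨s, hodd, Or.inl rfl⟩
    have h2m := (Nat.coprime_two_right (n := s')).mpr hodd
    have c3 : Nat.Coprime s' 3 :=
      ((Nat.Prime.coprime_iff_not_dvd Nat.prime_three).mpr (by omega)).symm
    have c24 : Nat.Coprime s' 24 := Nat.Coprime.mul_right (Nat.Coprime.pow_right 3 h2m) c3
    obtain ⟨q, hq3, hq, hd, hq24⟩ := exists_prime_aux 1 s' 24 7 3 (by omega) (by norm_num)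
      (by simp) c24 (by norm_num)
    have hqo : Odd q := Nat.odd_iff.mpr (by omega)
    have hJ' : J((s' : ℤ) | q) = 1 := by
      have := jacobi_of_dvd 1 q s' hd
      rw [Nat.cast_one, jacobiSym.at_neg_one hodd] at this
      have h1 := Nat.odd_iff.mp hodd
      have hm' : s' % 4 = 1 ∨ s' % 4 = 3 := by omega
      rcases hm' with h | h
      · rw [jacobiSym.quadratic_reciprocity_one_mod_four h hqo]
        rwa [ZMod.χ₄_nat_one_mod_four h, one_mul] at this
      · rw [jacobiSym.quadratic_reciprocity_three_mod_four h (by omega)]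
        rw [ZMod.χ₄_nat_three_mod_four h] at this
        linarith
    have hJ : J((s : ℤ) | q) = 1 := by
      rcases hs' with rfl | rfl
      · exact hJ'
      · push_cast
        rw [jacobiSym.mul_left, hJ', jacobiSym.at_two hqo, ZMod.χ₈_nat_eq_if_mod_eight]
        simp [show q % 2 = 1 by omega, show q % 8 = 7 by omega]
    have hds : s ∣ q + 1 := by
      rw [one_mul] at hd
      rcases hs' with rfl | rfl
      · exact hd
      · exact Nat.Coprime.mul_dvd_of_dvd_of_dvd h2m.symm (by omega) hd
    obtain ⟨e, he⟩ := exists_root_aux _ q hq hJ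
    obtain ⟨x, y, hxy⟩ := legendre_aux' q s hq.pos (by omega)
      (by simpa using not_sq_mul_prime 1 q hq (by simp)) hds e he
    have hJ3 : J(-3 | q) = 1 := by
      rw [jacobi_neg_three q hqo, (jacobi_mod_three q).1 (by omega)]
    obtain ⟨c, hc⟩ := exists_root_aux _ q hq hJ3
    obtain ⟨u, v, huv⟩ := legendre_aux 3 q (by norm_num) hq.pos
      (by simpa using not_sq_mul_prime 1 3 Nat.prime_three (by simp))
      ((Nat.coprime_primes Nat.prime_three hq).mpr (by omega)) c 1 (by simpa using hc) (by omega)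
    refine ⟨3 * (v * y), x, u * y, ?_⟩
    push_cast
    rw [hxy, huv]; push_cast; ring

section QuatAlg

variable {F : Type*} [Field F] [CharZero F] {a b : F}

/-- The reduced norm. -/
def qnorm (x : ℍ[F,a,b]) : F := x.re ^ 2 - a * x.imI ^ 2 - b * x.imJ ^ 2 + a * b * x.imK ^ 2

theorem qnorm_mul (x y : ℍ[F,a,b]) : qnorm (x * y) = qnorm x * qnorm y := by
  simp only [qnorm, QuaternionAlgebra.re_mul, QuaternionAlgebra.imI_mul, QuaternionAlgebra.imJ_mul,
    QuaternionAlgebra.imK_mul]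
  ring

theorem qnorm_one : qnorm (1 : ℍ[F,a,b]) = 1 := by simp [qnorm]

/-- The reduced norm as a monoid homomorphism. -/
def qnormHom : ℍ[F,a,b] →* F where
  toFun := qnorm
  map_one' := qnorm_one
  map_mul' := qnorm_mul

theorem qmul_star (x : ℍ[F,a,b]) : x * star x = algebraMap F _ (qnorm x) := by
  rw [QuaternionAlgebra.algebraMap_eq]
  ext <;> simp [qnorm] <;> ring

theorem qstar_mul (x : ℍ[F,a,b]) : star x * x = algebraMap F _ (qnorm x) := by
  rw [QuaternionAlgebra.algebraMap_eq]
  ext <;> simp [qnorm] <;> ring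

theorem qadd_star (x : ℍ[F,a,b]) : x + star x = algebraMap F _ (2 * x.re) := by
  rw [QuaternionAlgebra.algebraMap_eq]
  ext <;> simp <;> ring

/-- Being a scalar. -/
def IsScal (x : ℍ[F,a,b]) : Prop := x.imI = 0 ∧ x.imJ = 0 ∧ x.imK = 0

theorem isScal_iff (x : ℍ[F,a,b]) : IsScal x ↔ ∃ r : F, x = algebraMap F _ r := by
  constructor
  · rintro ⟨h1, h2, h3⟩
    exact ⟨x.re, by rw [QuaternionAlgebra.algebraMap_eq]; ext <;> simp [*]⟩
  · rintro ⟨r, rfl⟩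
    simp [QuaternionAlgebra.algebraMap_eq, IsScal]

theorem IsScal.comm {x : ℍ[F,a,b]} (h : IsScal x) (y : ℍ[F,a,b]) : x * y = y * x := by
  obtain ⟨r, rfl⟩ := (isScal_iff x).mp h
  exact Algebra.commutes r y

theorem comm_minors (ha : a ≠ 0) (hb : b ≠ 0) {x y : ℍ[F,a,b]} (h : x * y = y * x) :
    x.imI * y.imJ = x.imJ * y.imI ∧ x.imI * y.imK = x.imK * y.imI ∧
      x.imJ * y.imK = x.imK * y.imJ := by
  have h1 := congrArg QuaternionAlgebra.imI h
  have h2 := congrArg QuaternionAlgebra.imJ h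
  have h3 := congrArg QuaternionAlgebra.imK h
  simp at h1 h2 h3
  have two : (2 : F) ≠ 0 := two_ne_zero
  refine ⟨?_, ?_, ?_⟩
  · apply mul_left_cancel₀ two; linear_combination h3
  · apply mul_left_cancel₀ (mul_ne_zero two ha); linear_combination h2
  · apply mul_left_cancel₀ (mul_ne_zero two hb); linear_combination -h1

theorem comm_of_minors {x y : ℍ[F,a,b]}
    (h1 : x.imI * y.imJ = x.imJ * y.imI) (h2 : x.imI * y.imK = x.imK * y.imI)
    (h3 : x.imJ * y.imK = x.imK * y.imJ) : x * y = y * x := by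
  ext
  · simp; ring
  · simp; linear_combination (-2 * b) * h3
  · simp; linear_combination (2 * a) * h2
  · simp; linear_combination 2 * h1

/-- The centralizer of a non scalar element is commutative. -/
theorem comm_of_comm (ha : a ≠ 0) (hb : b ≠ 0) {x y z : ℍ[F,a,b]} (hx : ¬ IsScal x)
    (hy : x * y = y * x) (hz : x * z = z * x) : y * z = z * y := by
  obtain ⟨p1, p2, p3⟩ := comm_minors ha hb hy
  obtain ⟨q1, q2, q3⟩ := comm_minors ha hb hz
  have hx' : x.imI ≠ 0 ∨ x.imJ ≠ 0 ∨ x.imK ≠ 0 := by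
    by_contra hcon
    push Not at hcon
    exact hx hcon
  apply comm_of_minors
  · rcases hx' with h | h | h
    · apply mul_left_cancel₀ h; linear_combination q1 * y.imI - p1 * z.imI
    · apply mul_left_cancel₀ h; linear_combination q1 * y.imJ - p1 * z.imJ
    · apply mul_left_cancel₀ h; linear_combination -p2 * z.imJ + q1 * y.imK + p3 * z.imI
  · rcases hx' with h | h | h
    · apply mul_left_cancel₀ h; linear_combination q2 * y.imI - p2 * z.imI
    · apply mul_left_cancel₀ h; linear_combination -p1 * z.imK + q2 * y.imJ - p3 * z.imI
    · apply mul_left_cancel₀ h; linear_combination q2 * y.imK - p2 * z.imK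
  · rcases hx' with h | h | h
    · apply mul_left_cancel₀ h; linear_combination p1 * z.imK + q3 * y.imI - p2 * z.imJ
    · apply mul_left_cancel₀ h; linear_combination q3 * y.imJ - p3 * z.imJ
    · apply mul_left_cancel₀ h; linear_combination q3 * y.imK - p3 * z.imK

/-- Pure elements: anticommuting with a nonscalar element forces zero trace. -/
theorem re_zero_of_anticomm {P Q : ℍ[F,a,b]} (hP : ¬ IsScal P) (h : Q * P = -(P * Q)) :
    Q.re = 0 ∨ P.re ≠ 0 := by
  by_contra hcon
  push Not at hcon
  obtain ⟨hq, hp⟩ := hcon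
  apply hP
  have h1 := congrArg QuaternionAlgebra.imI h
  have h2 := congrArg QuaternionAlgebra.imJ h
  have h3 := congrArg QuaternionAlgebra.imK h
  simp [hp] at h1 h2 h3
  have hne : 2 * Q.re ≠ 0 := mul_ne_zero two_ne_zero hq
  refine ⟨?_, ?_, ?_⟩ <;> apply mul_left_cancel₀ hne
  · linear_combination h1
  · linear_combination h2
  · linear_combination h3

theorem sq_of_re_zero {Q : ℍ[F,a,b]} (h : Q.re = 0) : Q * Q = algebraMap F _ (-qnorm Q) := by
  rw [QuaternionAlgebra.algebraMap_eq]
  ext <;> simp [qnorm, h] <;> ring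

/-- A hom from a nondegenerate quaternion algebra to a nontrivial ring is injective. -/
theorem quat_hom_injective (ha : a ≠ 0) (hb : b ≠ 0) {B : Type*} [Ring B] [Algebra F B]
    [Nontrivial B] (f : ℍ[F,a,b] →ₐ[F] B) : Function.Injective f := by
  rw [injective_iff_map_eq_zero]
  intro q hq
  have scal : ∀ r : F, f (algebraMap F _ r) = 0 → r = 0 := by
    intro r hr
    rw [AlgHom.commutes] at hr
    exact (map_eq_zero_iff _ (algebraMap F B).injective).mp hr
  have hI : ∀ q : ℍ[F,a,b], f q = 0 → q.re = 0 ∧ q.imI = 0 := by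
    intro q hq
    let i : ℍ[F,a,b] := ⟨0, 1, 0, 0⟩
    let j : ℍ[F,a,b] := ⟨0, 0, 1, 0⟩
    have h1 : f (i * q + q * i) = 0 := by simp [hq]
    have h2 : f (j * (i * q + q * i) + (i * q + q * i) * j) = 0 := by simp [hq]
    have h3 : f (i * (i * q + q * i) + (i * q + q * i) * i) = 0 := by simp [hq]
    have e2 : j * (i * q + q * i) + (i * q + q * i) * j = 
       algebraMap F _ (4 * a * q.imI) * j := by
      rw [QuaternionAlgebra.algebraMap_eq]
      ext <;> simp [i, j] <;> ring
    have e3 : i * (i * q + q * i) + (i * q + q * i) * i = 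
       algebraMap F _ (4 * a * q.re) + algebraMap F _ (4 * a * q.imI) * i := by
      rw [QuaternionAlgebra.algebraMap_eq, QuaternionAlgebra.algebraMap_eq]
      ext <;> simp [i] <;> ring
    have e4 : (algebraMap F _ (4 * a * q.imI) * j) * j = algebraMap F _ (4 * a * q.imI * b) := by
      rw [QuaternionAlgebra.algebraMap_eq, QuaternionAlgebra.algebraMap_eq]
      ext <;> simp [j] <;> ring
    have h4 : f ((algebraMap F _ (4 * a * q.imI) * j) * j) = 0 := by
      rw [← e2, map_mul, h2, zero_mul]
    rw [e4] at h4
    have h5 := scal _ h4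
    have h6 : q.imI = 0 := by
      have : (4 * a * b) ≠ 0 := mul_ne_zero (mul_ne_zero (by norm_num : (4 : F) ≠ 0) ha) hb
      apply mul_left_cancel₀ this
      linear_combination h5
    rw [e3, h6] at h3
    have h7 := scal (4 * a * q.re) (by simpa using h3)
    refine ⟨?_, h6⟩
    apply mul_left_cancel₀ (mul_ne_zero (by norm_num : (4 : F) ≠ 0) ha : 4 * a ≠ 0)
    linear_combination h7
  obtain ⟨r1, r2⟩ := hI q hq
  let j : ℍ[F,a,b] := ⟨0, 0, 1, 0⟩
  obtain ⟨r3, r4⟩ := hI (j * q) (by simp [hq])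
  simp [j] at r3 r4
  ext
  · exact r1
  · exact r2
  · simpa [hb] using r3
  · simpa [hb] using r4

/-- Recognition of quaternion algebras. -/
theorem quat_recog {B : Type*} [Ring B] [Algebra F B] [Nontrivial B]
    (hdim : Module.finrank F B = 4) {c e : F} (hc : c ≠ 0) (he : e ≠ 0) (P Q : B)
    (hP : P * P = algebraMap F _ c) (hQ : Q * Q = algebraMap F _ e) (hPQ : Q * P = -(P * Q)) :
    Nonempty (B ≃ₐ[F] ℍ[F,c,e]) := by
  let bas : QuaternionAlgebra.Basis B c 0 e :=
    { i := P, j := Q, k := P * Q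
      i_mul_i := by rw [hP, Algebra.algebraMap_eq_smul_one]; simp
      j_mul_j := by rw [hQ, Algebra.algebraMap_eq_smul_one]
      i_mul_j := rfl
      j_mul_i := by simp [hPQ] }
  have hinj := quat_hom_injective hc he bas.liftHom
  have : FiniteDimensional F B := Module.finite_of_finrank_pos (by omega)
  have hsurj : Function.Surjective bas.liftHom.toLinearMap :=
    (LinearMap.injective_iff_surjective_of_finrank_eq_finrank
      (by rw [hdim, QuaternionAlgebra.finrank_eq_four])).mp hinj
  exact ⟨(AlgEquiv.ofBijective bas.liftHom ⟨hinj, hsurj⟩).symm⟩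

/-- Split case. -/
theorem quat_split (ha : a ≠ 0) (hb : b ≠ 0) (x : ℍ[F,a,b]) (hx : x ≠ 0) (hn : qnorm x = 0) :
    Nonempty (ℍ[F,a,b] ≃ₐ[F] Matrix (Fin 2) (Fin 2) F) := by
  have huv : ∃ u v : F, b = u ^ 2 - a * v ^ 2 := by
    have hsq : ∀ s : F, a = s ^ 2 → ∃ u v : F, b = u ^ 2 - a * v ^ 2 := by
      intro s hs
      have hs0 : s ≠ 0 := by rintro rfl; apply ha; rw [hs]; ring
      refine ⟨(b + 1) / 2, (b - 1) / (2 * s), ?_⟩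
      rw [hs]; field_simp; ring
    simp only [qnorm] at hn
    by_cases h : x.imJ ^ 2 - a * x.imK ^ 2 = 0
    · by_cases hk : x.imK = 0
      · have hj : x.imJ = 0 := by simpa [hk] using h
        have hI : x.imI ≠ 0 := by
          intro hI
          apply hx
          have : x.re = 0 := by simpa [hI, hj, hk] using hn
          ext <;> simp [*]
        apply hsq (x.re / x.imI)
        field_simp
        rw [hj, hk] at hn
        linear_combination -hn
      · apply hsq (x.imJ / x.imK)
        field_simp
        linear_combination -h
    · refine ⟨(x.re * x.imJ - a * x.imI * x.imK) / (x.imJ ^ 2 - a * x.imK ^ 2),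
        (x.re * x.imK - x.imI * x.imJ) / (x.imJ ^ 2 - a * x.imK ^ 2), ?_⟩
      field_simp
      linear_combination (-(x.imJ ^ 2 - a * x.imK ^ 2)) * hn
  obtain ⟨u, v, huv⟩ := huv
  obtain ⟨e⟩ := quat_recog (F := F) (B := Matrix (Fin 2) (Fin 2) F) (by rw [Module.finrank_matrix]; simp) ha hb
    !![0, a; 1, 0] !![u, -a * v; v, -u]
    (by rw [Matrix.algebraMap_eq_diagonal]; ext i j; fin_cases i <;> fin_cases j <;> simp [Matrix.mul_fin_two])
    (by rw [Matrix.algebraMap_eq_diagonal, huv]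
        ext i j; fin_cases i <;> fin_cases j <;> simp [Matrix.mul_fin_two] <;> ring)
    (by ext i j; fin_cases i <;> fin_cases j <;> simp [Matrix.mul_fin_two] <;> ring)
  exact ⟨e.symm⟩

/-- A quaternion algebra is split or has no zero divisors. -/
theorem quat_dichotomy (ha : a ≠ 0) (hb : b ≠ 0) :
    Nonempty (ℍ[F,a,b] ≃ₐ[F] Matrix (Fin 2) (Fin 2) F) ∨ (∀ x : ℍ[F,a,b], qnorm x = 0 → x = 0) := by
  by_cases h : ∀ x : ℍ[F,a,b], qnorm x = 0 → x = 0
  · exact Or.inr h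
  · push Not at h
    obtain ⟨x, h1, h2⟩ := h
    exact Or.inl (quat_split ha hb x h2 h1)

theorem quat_nzd (h : ∀ x : ℍ[F,a,b], qnorm x = 0 → x = 0) : NoZeroDivisors ℍ[F,a,b] where
  eq_zero_or_eq_zero_of_mul_eq_zero {x y} hxy := by
    have h1 : qnorm x * qnorm y = 0 := by rw [← qnorm_mul, hxy]; simp [qnorm]
    rcases mul_eq_zero.mp h1 with h1 | h1
    · exact Or.inl (h _ h1)
    · exact Or.inr (h _ h1)

/-- Ramification transfers through elements. -/
theorem ram_of_sq {σ : F →+* ℝ} (h1 : σ a < 0) (h2 : σ b < 0) (x : ℍ[F,a,b]) (hx : ¬ IsScal x)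
    (r : F) (hr : x * x = algebraMap F _ r) : σ r < 0 := by
  rw [QuaternionAlgebra.algebraMap_eq] at hr
  have e0 := congrArg QuaternionAlgebra.re hr
  have e1 := congrArg QuaternionAlgebra.imI hr
  have e2 := congrArg QuaternionAlgebra.imJ hr
  have e3 := congrArg QuaternionAlgebra.imK hr
  simp at e0 e1 e2 e3
  have hre : x.re = 0 := by
    by_contra hre
    apply hx
    have hne : 2 * x.re ≠ 0 := mul_ne_zero two_ne_zero hre
    refine ⟨?_, ?_, ?_⟩ <;> apply mul_left_cancel₀ hne
    · linear_combination e1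
    · linear_combination e2
    · linear_combination e3
  have e0' : r = a * x.imI ^ 2 + b * x.imJ ^ 2 - a * b * x.imK ^ 2 := by
    rw [hre] at e0
    linear_combination -e0
  rw [e0']
  simp only [map_add, map_sub, map_mul, map_pow]
  have hx' : x.imI ≠ 0 ∨ x.imJ ≠ 0 ∨ x.imK ≠ 0 := by
    by_contra hcon
    push Not at hcon
    exact hx hcon
  have t1 : 0 ≤ (-σ a) * (σ x.imI) ^ 2 := by apply mul_nonneg (by linarith) (sq_nonneg _)
  have t2 : 0 ≤ (-σ b) * (σ x.imJ) ^ 2 := by apply mul_nonneg (by linarith) (sq_nonneg _)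
  have hab := mul_pos_of_neg_of_neg h1 h2
  have t3 : 0 ≤ (σ a * σ b) * (σ x.imK) ^ 2 := mul_nonneg hab.le (sq_nonneg _)
  have sqpos : ∀ y : F, y ≠ 0 → 0 < (σ y) ^ 2 := fun y hy => by
    have : σ y ≠ 0 := (map_ne_zero σ).mpr hy
    positivity
  rcases hx' with h | h | h
  · have : 0 < (-σ a) * (σ x.imI) ^ 2 := mul_pos (by linarith) (sqpos _ h)
    linarith
  · have : 0 < (-σ b) * (σ x.imJ) ^ 2 := mul_pos (by linarith) (sqpos _ h)
    linarith
  · have : 0 < (σ a * σ b) * (σ x.imK) ^ 2 := mul_pos hab (sqpos _ h)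
    linarith

theorem ram_iso {c e : F} (f : ℍ[F,a,b] ≃ₐ[F] ℍ[F,c,e]) {σ : F →+* ℝ} (h1 : σ c < 0)
    (h2 : σ e < 0) : σ a < 0 ∧ σ b < 0 := by
  have key : ∀ x : ℍ[F,a,b], ¬ IsScal x → ∀ r : F, x * x = algebraMap F _ r → σ r < 0 := by
    intro x hx r hr
    refine ram_of_sq h1 h2 (f x) ?_ r (by rw [← map_mul, hr, AlgEquiv.commutes])
    intro hs
    obtain ⟨s, hs⟩ := (isScal_iff _).mp hs
    apply hx
    rw [isScal_iff]
    refine ⟨s, f.injective ?_⟩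
    rw [hs, AlgEquiv.commutes]
  constructor
  · apply key ⟨0, 1, 0, 0⟩ (by simp [IsScal])
    rw [QuaternionAlgebra.algebraMap_eq]; ext <;> simp
  · apply key ⟨0, 0, 1, 0⟩ (by simp [IsScal])
    rw [QuaternionAlgebra.algebraMap_eq]; ext <;> simp

theorem div_of_ram {σ : F →+* ℝ} (h1 : σ a < 0) (h2 : σ b < 0) (x : ℍ[F,a,b])
    (hx : qnorm x = 0) : x = 0 := by
  have h := congrArg σ hx
  simp only [qnorm, map_add, map_sub, map_mul, map_pow, map_zero] at h
  have hab := mul_pos_of_neg_of_neg h1 h2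
  have t0 := sq_nonneg (σ x.re)
  have t1 : 0 ≤ (-σ a) * (σ x.imI) ^ 2 := by apply mul_nonneg (by linarith) (sq_nonneg _)
  have t2 : 0 ≤ (-σ b) * (σ x.imJ) ^ 2 := by apply mul_nonneg (by linarith) (sq_nonneg _)
  have t3 : 0 ≤ (σ a * σ b) * (σ x.imK) ^ 2 := mul_nonneg hab.le (sq_nonneg _)
  have z0 : (σ x.re) ^ 2 = 0 := by linarith
  have z1 : (-σ a) * (σ x.imI) ^ 2 = 0 := by linarith
  have z2 : (-σ b) * (σ x.imJ) ^ 2 = 0 := by linarith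
  have z3 : (σ a * σ b) * (σ x.imK) ^ 2 = 0 := by linarith
  ext
  · simpa using z0
  · simpa [h1.ne] using z1
  · simpa [h2.ne] using z2
  · simpa [h1.ne, h2.ne] using z3

end QuatAlg

/-- Counting lemma for finite groups with commutative centralizers. -/
theorem ct_group_exists {G : Type*} [Group G] [Finite G]
    (hnc : ∃ x y : G, x * y ≠ y * x)
    (hct : ∀ x y z : G, x ∉ Subgroup.center G → x * y = y * x → x * z = z * x → y * z = z * y) :
    ∃ g h : G, h * g ≠ g * h ∧ (h * g * h⁻¹) * g = g * (h * g * h⁻¹) := by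
  classical
  have := Fintype.ofFinite G
  by_contra hcon
  push Not at hcon
  have star : ∀ g h : G, (h * g * h⁻¹) * g = g * (h * g * h⁻¹) → h * g = g * h := by
    intro g h e
    by_contra h1
    exact hcon g h h1 e
  let Z : Finset G := Finset.univ.filter (· ∈ Subgroup.center G)
  have hZ1 : 1 ≤ Z.card := Finset.card_pos.mpr ⟨1, by simp [Z, Subgroup.one_mem]⟩
  let C : G → Finset G := fun g => Finset.univ.filter (fun x => g * x = x * g)
  let S : G → Finset G := fun g => Finset.univ.filter
    (fun y => y ∉ Subgroup.center G ∧ ∃ h, h * y * h⁻¹ ∈ C g)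
  have memC : ∀ g x, x ∈ C g ↔ g * x = x * g := by intro g x; simp [C]
  have memS : ∀ g y, y ∈ S g ↔ y ∉ Subgroup.center G ∧ ∃ h, h * y * h⁻¹ ∈ C g := by
    intro g y; simp [S]
  have conjC : ∀ h y : G, h * y * h⁻¹ ∈ Subgroup.center G ↔ y ∈ Subgroup.center G := by
    intro h y
    constructor
    · intro hy
      have := (inferInstance : (Subgroup.center G).Normal).conj_mem _ hy h⁻¹
      simpa [mul_assoc] using this
    · intro hy
      exact (inferInstance : (Subgroup.center G).Normal).conj_mem _ hy h
  have hZC : ∀ g, Z ⊆ C g := by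
    intro g x hx
    rw [memC]
    have : x ∈ Subgroup.center G := by simpa [Z] using hx
    exact (Subgroup.mem_center_iff.mp this g)
  -- size of centralizer
  have hC2 : ∀ g, g ∉ Subgroup.center G → 2 * Z.card ≤ (C g).card := by
    intro g hg
    have hsub : Z ∪ Z.image (g * ·) ⊆ C g := by
      intro x hx
      rcases Finset.mem_union.mp hx with hx | hx
      · exact hZC g hx
      · obtain ⟨z, hz, rfl⟩ := Finset.mem_image.mp hx
        have := (memC g z).mp (hZC g hz)
        rw [memC]
        change g * (g * z) = g * z * g
        rw [mul_assoc, ← this]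
    have hdis : Disjoint Z (Z.image (g * ·)) := by
      rw [Finset.disjoint_left]
      intro x hx hx'
      obtain ⟨z, hz, rfl⟩ := Finset.mem_image.mp hx'
      apply hg
      have h1 : g * z ∈ Subgroup.center G := by simpa [Z] using hx
      have h2 : z ∈ Subgroup.center G := by simpa [Z] using hz
      have := Subgroup.mul_mem _ h1 (Subgroup.inv_mem _ h2)
      simpa [mul_assoc] using this
    have := Finset.card_le_card hsub
    rw [Finset.card_union_of_disjoint hdis, Finset.card_image_of_injective _ (mul_right_injective g)]
      at this
    omega
  -- double counting
  have count : ∀ g, g ∉ Subgroup.center G →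
      (S g).card * (C g).card = Fintype.card G * ((C g).card - Z.card) := by
    intro g hg
    let r : G → G → Prop := fun h y => h * y * h⁻¹ ∈ C g
    have h1 : ∀ y ∈ S g, (Finset.bipartiteBelow r (Finset.univ : Finset G) y).card = (C g).card := by
      intro y hy
      obtain ⟨hyZ, h0, hh0⟩ := (memS g y).mp hy
      have : Finset.bipartiteBelow r (Finset.univ : Finset G) y = (C g).image (· * h0) := by
        ext h
        simp only [Finset.mem_bipartiteBelow, Finset.mem_univ, true_and, Finset.mem_image, r]
        constructor
        · intro hh
          refine ⟨h * h0⁻¹, ?_, by simp⟩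
          rw [memC]
          set w := h0 * y * h0⁻¹ with hw
          have hwZ : w ∉ Subgroup.center G := by rw [hw, conjC]; exact hyZ
          have e1 := (memC _ _).mp hh
          have e2 := (memC _ _).mp hh0
          have e3 : (h * h0⁻¹) * w * (h * h0⁻¹)⁻¹ = h * y * h⁻¹ := by rw [hw]; group
          have e4 := star w (h * h0⁻¹) (by rw [e3]; exact hct g _ _ hg e1 e2)
          exact (hct w _ _ hwZ e4.symm e2.symm).symm
        · rintro ⟨c, hc, rfl⟩
          have e1 := (memC _ _).mp hc
          have e2 := (memC _ _).mp hh0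
          have e3 := hct g _ _ hg e1 e2
          have : c * h0 * y * (c * h0)⁻¹ = h0 * y * h0⁻¹ := by
            calc c * h0 * y * (c * h0)⁻¹ = (c * (h0 * y * h0⁻¹)) * c⁻¹ := by group
              _ = _ := by rw [e3]; group
          rw [this]; exact hh0
      rw [this, Finset.card_image_of_injective _ (mul_left_injective h0)]
    have h2 : ∀ h ∈ (Finset.univ : Finset G), (Finset.bipartiteAbove r (S g) h).card
        = (C g).card - Z.card := by
      intro h _
      rw [← Finset.card_sdiff_of_subset (hZC g)]
      apply Finset.card_bij (fun y _ => h * y * h⁻¹)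
      · intro y hy
        simp only [Finset.mem_bipartiteAbove, r] at hy
        rw [Finset.mem_sdiff]
        refine ⟨hy.2, ?_⟩
        have := ((memS g y).mp hy.1).1
        simpa only [Z, Finset.mem_filter, Finset.mem_univ, true_and, conjC] using this
      · intro y _ y' _ e
        simpa using e
      · intro x hx
        rw [Finset.mem_sdiff] at hx
        have e : h * (h⁻¹ * x * h) * h⁻¹ = x := by group
        refine ⟨h⁻¹ * x * h, ?_, e⟩
        simp only [Finset.mem_bipartiteAbove, r, e]
        refine ⟨(memS g _).mpr ⟨?_, h, by rw [e]; exact hx.1⟩, hx.1⟩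
        rw [← conjC h, e]
        simpa [Z] using hx.2
    have := Finset.sum_card_bipartiteAbove_eq_sum_card_bipartiteBelow (s := (Finset.univ : Finset G))
      (t := S g) r
    rw [Finset.sum_congr rfl h1, Finset.sum_congr rfl h2] at this
    simp only [Finset.sum_const, smul_eq_mul, Finset.card_univ] at this
    exact this.symm
  have half : ∀ g, g ∉ Subgroup.center G → Fintype.card G ≤ 2 * (S g).card := by
    intro g hg
    have h1 := count g hg
    have h2 := hC2 g hg
    have hpos : 0 < (C g).card := by omega
    by_contra hlt
    push Not at hlt
    obtain ⟨k, hk⟩ : ∃ k, (C g).card - Z.card = k := ⟨_, rfl⟩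
    have hk2 : (C g).card ≤ 2 * k := by omega
    rw [hk] at h1
    nlinarith
  obtain ⟨x0, y0, hxy⟩ := hnc
  have hx0 : x0 ∉ Subgroup.center G := by
    intro h
    exact hxy ((Subgroup.mem_center_iff.mp h y0).symm)
  have hSZ : ∀ g, Disjoint (S g) Z := by
    intro g
    rw [Finset.disjoint_left]
    intro y hy hyZ
    exact ((memS g y).mp hy).1 (by simpa [Z] using hyZ)
  by_cases hall : ∃ g1, g1 ∉ Subgroup.center G ∧ g1 ∉ S x0
  · obtain ⟨g1, hg1, hg1S⟩ := hall
    have hd : Disjoint (S x0) (S g1) := by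
      rw [Finset.disjoint_left]
      intro y hy hy'
      obtain ⟨hyZ, h0, e0⟩ := (memS _ _).mp hy
      obtain ⟨_, h1, e1⟩ := (memS _ _).mp hy'
      apply hg1S
      rw [memS]
      refine ⟨hg1, h0 * h1⁻¹, ?_⟩
      rw [memC] at e0 e1 ⊢
      -- h0 h1⁻¹ g1 h1 h0⁻¹ commutes with w = h0 y h0⁻¹
      have hw : h0 * y * h0⁻¹ ∉ Subgroup.center G := by rw [conjC]; exact hyZ
      have e2 : (h0 * y * h0⁻¹) * (h0 * h1⁻¹ * g1 * (h0 * h1⁻¹)⁻¹)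
          = (h0 * h1⁻¹ * g1 * (h0 * h1⁻¹)⁻¹) * (h0 * y * h0⁻¹) := by
        calc _ = (h0 * h1⁻¹) * ((h1 * y * h1⁻¹) * g1) * (h0 * h1⁻¹)⁻¹ := by group
          _ = (h0 * h1⁻¹) * (g1 * (h1 * y * h1⁻¹)) * (h0 * h1⁻¹)⁻¹ := by rw [e1]
          _ = _ := by group
      exact hct _ _ _ hw e0.symm e2
    have hd' : Disjoint (S x0 ∪ S g1) Z := by
      rw [Finset.disjoint_union_left]; exact ⟨hSZ _, hSZ _⟩
    have := Finset.card_le_univ ((S x0 ∪ S g1) ∪ Z)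
    rw [Finset.card_union_of_disjoint hd', Finset.card_union_of_disjoint hd] at this
    have := half x0 hx0
    have := half g1 hg1
    omega
  · push Not at hall
    have hS : S x0 = Finset.univ \ Z := by
      ext y
      simp only [Finset.mem_sdiff, Finset.mem_univ, true_and]
      constructor
      · intro hy hyZ
        exact (Finset.disjoint_left.mp (hSZ x0)) hy hyZ
      · intro hy
        exact hall y (by simpa [Z] using hy)
    have hc := count x0 hx0
    have h2 := hC2 x0 hx0
    have hle : (C x0).card ≤ Fintype.card G := Finset.card_le_univ _
    rw [hS, Finset.card_sdiff_of_subset (Finset.subset_univ _), Finset.card_univ] at hc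
    obtain ⟨k, hk⟩ : ∃ k, (C x0).card = Z.card + k := ⟨(C x0).card - Z.card, by omega⟩
    obtain ⟨l, hl⟩ : ∃ l, Fintype.card G = Z.card + l := ⟨Fintype.card G - Z.card, by omega⟩
    rw [hk, hl, Nat.add_sub_cancel_left, Nat.add_sub_cancel_left] at hc
    have hkl : k = l := by
      have h3 : l * Z.card = Z.card * k := by nlinarith
      have := Nat.eq_of_mul_eq_mul_left (by omega : 0 < Z.card) (by linarith : Z.card * k = Z.card * l)
      exact this
    have hCu : C x0 = Finset.univ := by
      rw [← Finset.card_eq_iff_eq_univ]; omega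
    have : y0 ∈ C x0 := by rw [hCu]; simp
    exact hxy ((memC _ _).mp this)

section KeyLemma

variable {F : Type*} [Field F] [CharZero F] {a b : F}

theorem star_of_conj (hdiv : ∀ x : ℍ[F,a,b], qnorm x = 0 → x = 0) (g h : (ℍ[F,a,b])ˣ)
    (hn : qnorm (g : ℍ[F,a,b]) = 1) (hne : h * g ≠ g * h)
    (hc : (h * g * h⁻¹) * g = g * (h * g * h⁻¹)) : h * g = g⁻¹ * h := by
  have := quat_nzd hdiv
  set c : (ℍ[F,a,b])ˣ := h * g * h⁻¹ with hcdef
  have hginv : ((g⁻¹ : (ℍ[F,a,b])ˣ) : ℍ[F,a,b]) = star (g : ℍ[F,a,b]) := by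
    rw [Units.inv_eq_of_mul_eq_one_right]
    rw [qmul_star, hn, map_one]
  -- g satisfies its quadratic equation, hence so does c
  have hq : (g : ℍ[F,a,b]) * g - algebraMap F _ (2 * (g : ℍ[F,a,b]).re) * g + 1 = 0 := by
    rw [← qadd_star]
    have := qstar_mul (g : ℍ[F,a,b])
    rw [hn, map_one] at this
    rw [add_mul, this]; abel
  have hqc : (c : ℍ[F,a,b]) * c - algebraMap F _ (2 * (g : ℍ[F,a,b]).re) * c + 1 = 0 := by
    have e : (c : ℍ[F,a,b]) * c - algebraMap F _ (2 * (g : ℍ[F,a,b]).re) * c + 1 =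
        h * ((g : ℍ[F,a,b]) * g - algebraMap F _ (2 * (g : ℍ[F,a,b]).re) * g + 1) * (h⁻¹ : (ℍ[F,a,b])ˣ) := by
      have e1 : (c : ℍ[F,a,b]) = h * g * (h⁻¹ : (ℍ[F,a,b])ˣ) := by simp [hcdef]
      have e2 : ((h⁻¹ : (ℍ[F,a,b])ˣ) : ℍ[F,a,b]) * h = 1 := by simp
      have e3 : (h : ℍ[F,a,b]) * ((h⁻¹ : (ℍ[F,a,b])ˣ) : ℍ[F,a,b]) = 1 := by simp
      have e4 := Algebra.commutes (2 * (g : ℍ[F,a,b]).re) (h : ℍ[F,a,b])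
      rw [e1, mul_add, add_mul, mul_sub, sub_mul, mul_one, e3]
      congr 2
      · calc (h : ℍ[F,a,b]) * g * (h⁻¹ : (ℍ[F,a,b])ˣ) * (h * g * (h⁻¹ : (ℍ[F,a,b])ˣ))
            = h * g * (((h⁻¹ : (ℍ[F,a,b])ˣ) : ℍ[F,a,b]) * h) * g * (h⁻¹ : (ℍ[F,a,b])ˣ) := by
              simp only [mul_assoc]
          _ = _ := by rw [e2]; simp only [mul_assoc, one_mul]
      · rw [← mul_assoc, ← mul_assoc, ← mul_assoc, e4]
    rw [e, hq]; simp
  have hcg : (c : ℍ[F,a,b]) * g = g * c := by exact_mod_cast hc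
  have hprod : ((c : ℍ[F,a,b]) - g) * (c - star (g : ℍ[F,a,b])) = 0 := by
    have h1 : star (g : ℍ[F,a,b]) = algebraMap F _ (2 * (g : ℍ[F,a,b]).re) - g := by
      rw [← qadd_star]; abel
    rw [h1]
    have h2 : (c : ℍ[F,a,b]) * algebraMap F _ (2 * (g : ℍ[F,a,b]).re)
      = algebraMap F _ (2 * (g : ℍ[F,a,b]).re) * c := (Algebra.commutes _ _).symm
    have h3 : (g : ℍ[F,a,b]) * algebraMap F _ (2 * (g : ℍ[F,a,b]).re)
      = algebraMap F _ (2 * (g : ℍ[F,a,b]).re) * g := (Algebra.commutes _ _).symm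
    calc ((c : ℍ[F,a,b]) - g) * (c - (algebraMap F _ (2 * (g : ℍ[F,a,b]).re) - g))
        = (c * c - c * algebraMap F _ (2 * (g : ℍ[F,a,b]).re) + 1)
          - (g * g - g * algebraMap F _ (2 * (g : ℍ[F,a,b]).re) + 1) + (c * g - g * c) := by
          noncomm_ring
      _ = 0 := by rw [h2, h3, hq, hqc, hcg]; simp
  rcases mul_eq_zero.mp hprod with h1 | h1
  · exfalso
    apply hne
    have : c = g := Units.ext (sub_eq_zero.mp h1)
    rw [hcdef] at this
    exact mul_inv_eq_iff_eq_mul.mp this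
  · have : c = g⁻¹ := Units.ext (by rw [hginv]; exact sub_eq_zero.mp h1)
    rw [hcdef] at this
    exact mul_inv_eq_iff_eq_mul.mp this

theorem key_pair (ha : a ≠ 0) (hb : b ≠ 0) (hdiv : ∀ x : ℍ[F,a,b], qnorm x = 0 → x = 0)
    (G : Subgroup (ℍ[F,a,b])ˣ) [Finite G] (hnc : ∃ x ∈ G, ∃ y ∈ G, x * y ≠ y * x) :
    ∃ g ∈ G, ∃ h ∈ G, ¬ IsScal (g : ℍ[F,a,b]) ∧ qnorm (g : ℍ[F,a,b]) = 1 ∧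
      h * g = g⁻¹ * h ∧ h * g ≠ g * h := by
  -- it is enough to find g of norm one and h with the conjugate commuting
  suffices hs : ∃ g ∈ G, ∃ h ∈ G, qnorm (g : ℍ[F,a,b]) = 1 ∧ h * g ≠ g * h ∧
      (h * g * h⁻¹) * g = g * (h * g * h⁻¹) by
    obtain ⟨g, hg, h, hh, h1, h2, h3⟩ := hs
    refine ⟨g, hg, h, hh, ?_, h1, star_of_conj hdiv g h h1 h2 h3, h2⟩
    intro hsc
    exact h2 (Units.ext (hsc.comm (h : ℍ[F,a,b])).symm)
  have cc : ∀ x y z : (ℍ[F,a,b])ˣ, ¬ IsScal (x : ℍ[F,a,b]) → x * y = y * x → x * z = z * x →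
      y * z = z * y := by
    intro x y z hx h1 h2
    apply Units.ext
    push_cast
    exact comm_of_comm ha hb hx (by exact_mod_cast h1) (by exact_mod_cast h2)
  let N : (ℍ[F,a,b])ˣ →* Fˣ := Units.map qnormHom
  have hN : ∀ x : (ℍ[F,a,b])ˣ, N x = 1 ↔ qnorm (x : ℍ[F,a,b]) = 1 := by
    intro x
    rw [Units.ext_iff]
    rfl
  by_cases hcomm : ∃ x ∈ G, ∃ y ∈ G, N x = 1 ∧ N y = 1 ∧ x * y ≠ y * x
  · obtain ⟨x, hx, y, hy, nx, ny, hxy⟩ := hcomm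
    let G1 : Subgroup (ℍ[F,a,b])ˣ := G ⊓ N.ker
    have : Finite G1 := Finite.Set.subset (G : Set (ℍ[F,a,b])ˣ) (fun z hz => hz.1)
    obtain ⟨g, h, e1, e2⟩ := ct_group_exists (G := G1)
      ⟨⟨x, hx, nx⟩, ⟨y, hy, ny⟩, fun e => hxy (congrArg Subtype.val e)⟩ (by
        intro x y z hx h1 h2
        apply Subtype.ext
        refine cc x y z ?_ (congrArg Subtype.val h1) (congrArg Subtype.val h2)
        intro hsc
        apply hx
        rw [Subgroup.mem_center_iff]
        intro w
        apply Subtype.ext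
        apply Units.ext
        exact (hsc.comm _).symm)
    refine ⟨g, g.2.1, h, h.2.1, (hN _).mp g.2.2, ?_, ?_⟩
    · intro e; apply e1; exact Subtype.ext e
    · exact congrArg Subtype.val e2
  · push Not at hcomm
    by_cases hsc : ∀ g ∈ G, N g = 1 → IsScal (g : ℍ[F,a,b])
    · exfalso
      obtain ⟨x, hx, y, hy, hxy⟩ := hnc
      let f : G →* Fˣ := N.comp G.subtype
      have : IsCyclic f.range := by
        have : Finite f.range := Set.finite_range f
        infer_instance
      have key := commutative_of_cyclic_center_quotient f.rangeRestrict (by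
        intro g hg
        have hg' : N g = 1 := congrArg Subtype.val (MonoidHom.mem_ker.mp hg)
        rw [Subgroup.mem_center_iff]
        intro w
        apply Subtype.ext
        apply Units.ext
        exact ((hsc g g.2 hg').comm _).symm) ⟨x, hx⟩ ⟨y, hy⟩
      exact hxy (congrArg Subtype.val key)
    · push Not at hsc
      obtain ⟨g, hg, ng, hgs⟩ := hsc
      have : ∃ h ∈ G, h * g ≠ g * h := by
        by_contra hcon
        push Not at hcon
        obtain ⟨x, hx, y, hy, hxy⟩ := hnc
        exact hxy (cc g x y hgs (hcon x hx).symm (hcon y hy).symm)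
      obtain ⟨h, hh, hne⟩ := this
      refine ⟨g, hg, h, hh, (hN _).mp ng, hne, ?_⟩
      apply hcomm _ (G.mul_mem (G.mul_mem hh hg) (G.inv_mem hh)) _ hg _ ng
      simp [ng]

end KeyLemma

section RootsOfUnity

open Polynomial

theorem real_place_neg {F : Type*} [Field F] (t : F) (ht : t ^ 2 - 4 ≠ 0) (n : ℕ) (hn : 0 < n)
    (hd : (X ^ 2 - C t * X + 1 : F[X]) ∣ X ^ n - 1) (σ : F →+* ℝ) : σ (t ^ 2 - 4) < 0 := by
  by_contra hcon
  push Not at hcon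
  have hne : σ (t ^ 2 - 4) ≠ 0 := (map_ne_zero σ).mpr ht
  set s := σ t with hs
  have e1 : σ (t ^ 2 - 4) = s ^ 2 - 4 := by rw [map_sub, map_pow, map_ofNat]
  rw [e1] at hcon hne
  obtain ⟨q, hq⟩ := hd
  have h2 : ∀ r : ℝ, r ^ 2 - s * r + 1 = 0 → r ^ n = 1 := by
    intro r hr
    have := congrArg (Polynomial.eval₂ σ r) hq
    simp [eval₂_mul, ← hs, hr] at this
    linarith
  have hsq := Real.sq_sqrt hcon
  set r := (s + Real.sqrt (s ^ 2 - 4)) / 2 with hr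
  have h3 : r ^ 2 - s * r + 1 = 0 := by rw [hr]; nlinarith
  have h4 := h2 r h3
  have h5 : r = 1 ∨ r = -1 := by
    have h6 : |r| ^ n = 1 := by rw [← abs_pow, h4, abs_one]
    have h7 : |r| = 1 := (pow_eq_one_iff_of_nonneg (abs_nonneg r) hn.ne').mp h6
    exact eq_or_eq_neg_of_abs_eq h7
  rcases h5 with h5 | h5
  · rw [h5] at h3; apply hne; have : s = 2 := by linarith
    rw [this]; norm_num
  · rw [h5] at h3; apply hne; have : s = -2 := by linarith
    rw [this]; norm_num

/-- The data extracted from a finite noncommutative subgroup of a division quaternion algebra. -/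
theorem key_data (K : IntermediateField ℚ ℂ) (a b : K) (ha : a ≠ 0) (hb : b ≠ 0)
    (hdiv : ∀ x : ℍ[↥K,a,b], qnorm x = 0 → x = 0)
    (G : Subgroup (ℍ[↥K,a,b])ˣ) [Finite G] (hnc : ∃ x ∈ G, ∃ y ∈ G, x * y ≠ y * x) :
    ∃ n : ℕ, 3 ≤ n ∧ ∃ η : K, (η : ℂ) = Complex.exp (2 * Real.pi * Complex.I / n) +
            (Complex.exp (2 * Real.pi * Complex.I / n))⁻¹ ∧ η ^ 2 - 4 ≠ 0 ∧
      ∃ P Q : ℍ[↥K,a,b], P * P = algebraMap K _ (η ^ 2 - 4) ∧ Q * P = -(P * Q) ∧ ¬ IsScal P ∧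
        ¬ IsScal Q ∧ Q * Q = algebraMap K _ (-qnorm Q) ∧ ∃ m : ℕ, 0 < m ∧ (qnorm Q) ^ m = 1 := by
  have := quat_nzd hdiv
  have : IsDomain ℍ[↥K,a,b] := NoZeroDivisors.to_isDomain _
  obtain ⟨g, hg, h, hh, hgs, hgn, hgh, hne⟩ := key_pair ha hb hdiv G hnc
  have hfin : ∀ x ∈ G, ∃ m : ℕ, 0 < m ∧ x ^ m = 1 := by
    intro x hx
    have := (isOfFinOrder_of_finite (⟨x, hx⟩ : G))
    obtain ⟨m, hm, e⟩ := isOfFinOrder_iff_pow_eq_one.mp this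
    exact ⟨m, hm, congrArg Subtype.val e⟩
  have hint : IsIntegral K (g : ℍ[↥K,a,b]) := Algebra.IsIntegral.isIntegral _
  have hirr := minpoly.irreducible hint
  obtain ⟨ζ, hζ⟩ : ∃ ζ : ℂ, aeval ζ (minpoly K (g : ℍ[↥K,a,b])) = 0 :=
    IsAlgClosed.exists_aeval_eq_zero ℂ _ (by
      exact (minpoly.degree_pos hint).ne')
  have hmin : minpoly K (g : ℍ[↥K,a,b]) = minpoly K ζ :=
    minpoly.eq_of_irreducible_of_monic hirr hζ (minpoly.monic hint)
  have tr : ∀ p : K[X], aeval (g : ℍ[↥K,a,b]) p = 0 ↔ aeval ζ p = 0 := by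
    intro p
    rw [← minpoly.dvd_iff, ← minpoly.dvd_iff, hmin]
  have hpow : ∀ m : ℕ, g ^ m = 1 ↔ ζ ^ m = 1 := by
    intro m
    have := tr (X ^ m - 1)
    simp only [map_sub, map_pow, aeval_X, map_one, sub_eq_zero] at this
    rw [← this, Units.ext_iff]
    simp
  obtain ⟨m0, hm0, em0⟩ := hfin g hg
  set n := orderOf g with hn
  have hnpos : 0 < n := orderOf_pos_iff.mpr (isOfFinOrder_iff_pow_eq_one.mpr ⟨m0, hm0, em0⟩)
  have hζo : orderOf ζ = n := (orderOf_eq_orderOf_iff.mpr (fun m => (hpow m).symm))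
  have : NeZero n := ⟨hnpos.ne'⟩
  have hprim : IsPrimitiveRoot ζ n := by rw [← hζo]; exact IsPrimitiveRoot.orderOf ζ
  have hg2 : g ^ 2 ≠ 1 := by
    intro e
    have e' : (g : ℍ[↥K,a,b]) * g = 1 := by rw [← Units.val_mul, ← sq, e, Units.val_one]
    apply hgs
    rw [isScal_iff]
    rcases mul_self_eq_one_iff.mp e' with h1 | h1
    · exact ⟨1, by simp [h1]⟩
    · exact ⟨-1, by simp [h1]⟩
  have hn3 : 3 ≤ n := by
    by_contra hlt
    apply hg2
    have : n = 1 ∨ n = 2 := by omega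
    rcases this with h1 | h1
    · have : g ^ n = 1 := pow_orderOf_eq_one g
      rw [h1, pow_one] at this
      rw [this, one_pow]
    · rw [← h1]; exact pow_orderOf_eq_one g
  have hexp := Complex.isPrimitiveRoot_exp n hnpos.ne'
  set ξ := Complex.exp (2 * Real.pi * Complex.I / n) with hξ
  obtain ⟨k, hk, hkξ⟩ := (hprim.eq_pow_of_pow_eq_one (ξ := ξ) hexp.pow_eq_one)
  have hξ0 : ξ ≠ 0 := Complex.exp_ne_zero _
  set γ := g ^ k with hγ
  have hγn : qnorm (γ : ℍ[↥K,a,b]) = 1 := by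
    have : qnormHom ((g : ℍ[↥K,a,b]) ^ k) = 1 := by
      rw [map_pow]
      have : qnormHom (g : ℍ[↥K,a,b]) = 1 := hgn
      rw [this, one_pow]
    rw [hγ, Units.val_pow_eq_pow_val]
    exact this
  set η : K := 2 * (γ : ℍ[↥K,a,b]).re with hη
  have hgg : (γ : ℍ[↥K,a,b]) ^ 2 - algebraMap K _ η * γ + 1 = 0 := by
    rw [hη, ← qadd_star]
    have := qstar_mul (γ : ℍ[↥K,a,b])
    rw [hγn, map_one] at this
    rw [add_mul, this, sq]; abel
  have hξq : ξ ^ 2 - (η : ℂ) * ξ + 1 = 0 := by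
    have := (tr ((X ^ k) ^ 2 - C η * X ^ k + 1)).mp (by simpa [hγ] using hgg)
    simpa [hkξ] using this
  have hηξ : (η : ℂ) = ξ + ξ⁻¹ := by
    field_simp
    linear_combination -hξq
  have hξ2 : ξ ^ 2 ≠ 1 := by
    intro e
    have := Nat.le_of_dvd (by norm_num) (hexp.dvd_of_pow_eq_one 2 e)
    omega
  have hη4 : η ^ 2 - 4 ≠ 0 := by
    intro e
    have e' : (η : ℂ) ^ 2 - 4 = 0 := by
      have := congrArg (algebraMap K ℂ) e
      rwa [map_sub, map_pow, map_ofNat, map_zero] at this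
    apply hξ2
    have : (ξ ^ 2 - 1) ^ 2 = 0 := by
      rw [hηξ] at e'
      field_simp at e'
      linear_combination e'
    have := pow_eq_zero_iff (two_ne_zero) |>.mp this
    linear_combination this
  have hhγ : h * γ = γ⁻¹ * h := by
    have : SemiconjBy h g g⁻¹ := hgh
    have := this.pow_right k
    rw [hγ, ← inv_pow]
    exact this
  have hhγ' : h * γ⁻¹ = γ * h := by
    have : SemiconjBy h γ γ⁻¹ := hhγ
    have := this.inv_right
    rw [inv_inv] at this
    exact this
  have hstar : ((γ⁻¹ : (ℍ[↥K,a,b])ˣ) : ℍ[↥K,a,b]) = star (γ : ℍ[↥K,a,b]) := by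
    rw [Units.inv_eq_of_mul_eq_one_right]
    rw [qmul_star, hγn, map_one]
  let P : ℍ[↥K,a,b] := (γ : ℍ[↥K,a,b]) - ((γ⁻¹ : (ℍ[↥K,a,b])ˣ) : ℍ[↥K,a,b])
  have hPre : P.re = 0 := by simp [P, hstar]
  have hPP : P * P = algebraMap K _ (η ^ 2 - 4) := by
    have h1 : (γ : ℍ[↥K,a,b]) * ((γ⁻¹ : (ℍ[↥K,a,b])ˣ) : ℍ[↥K,a,b]) = 1 := by simp
    have h2 : ((γ⁻¹ : (ℍ[↥K,a,b])ˣ) : ℍ[↥K,a,b]) * γ = 1 := by simp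
    have h3 : algebraMap K ℍ[↥K,a,b] η = (γ : ℍ[↥K,a,b]) + ((γ⁻¹ : (ℍ[↥K,a,b])ˣ) : ℍ[↥K,a,b]) := by
      rw [hstar, qadd_star]
    rw [map_sub, map_pow, h3]
    have h4 : algebraMap K ℍ[↥K,a,b] 4 = 1 + 1 + 1 + 1 := by rw [map_ofNat]; norm_num
    rw [h4]
    simp only [P, sq, sub_mul, mul_sub, add_mul, mul_add, h1, h2]
    abel
  have hPs : ¬ IsScal P := by
    rintro ⟨h1, h2, h3⟩
    have hP0 : P = 0 := by ext <;> simp [*]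
    rw [hP0, mul_zero] at hPP
    apply hη4
    exact ((map_eq_zero_iff _ (algebraMap K ℍ[↥K,a,b]).injective).mp hPP.symm)
  have hQP : (h : ℍ[↥K,a,b]) * P = -(P * h) := by
    have e1 : (h : ℍ[↥K,a,b]) * γ = ((γ⁻¹ : (ℍ[↥K,a,b])ˣ) : ℍ[↥K,a,b]) * h := by
      exact_mod_cast congrArg Units.val hhγ
    have e2 : (h : ℍ[↥K,a,b]) * ((γ⁻¹ : (ℍ[↥K,a,b])ˣ) : ℍ[↥K,a,b]) = γ * h := by
      exact_mod_cast congrArg Units.val hhγ'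
    simp only [P, mul_sub, sub_mul, e1, e2]
    abel
  have hQre : (h : ℍ[↥K,a,b]).re = 0 := (re_zero_of_anticomm hPs hQP).resolve_right (not_not.mpr hPre)
  refine ⟨n, hn3, η, hηξ, hη4, P, h, hPP, hQP, hPs, ?_, sq_of_re_zero hQre, ?_⟩
  · intro hs
    apply hne
    exact Units.ext (hs.comm _)
  · obtain ⟨m, hm, e⟩ := hfin h hh
    refine ⟨m, hm, ?_⟩
    have e' : (h : ℍ[↥K,a,b]) ^ m = 1 := by rw [← Units.val_pow_eq_pow_val, e, Units.val_one]
    have := congrArg qnormHom e'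
    rw [map_pow, map_one] at this
    exact this

end RootsOfUnity

section Counting

theorem emb_count (K : Type) [Field K] [NumberField K] :
    Module.finrank ℚ K = Nat.card (K →+* ℝ) + Nat.card {σ : K →+* ℂ // ∃ x : K, (σ x).im ≠ 0} ∧
      Even (Nat.card {σ : K →+* ℂ // ∃ x : K, (σ x).im ≠ 0}) ∧ Finite (K →+* ℝ) := by
  classical
  have hreal : ∀ σ : K →+* ℂ, (¬ NumberField.ComplexEmbedding.IsReal σ) ↔ ∃ x : K, (σ x).im ≠ 0 := by
    intro σ
    rw [NumberField.ComplexEmbedding.isReal_iff, not_iff_comm]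
    push Not
    constructor
    · intro h
      ext x
      rw [NumberField.ComplexEmbedding.conjugate_coe_eq]
      exact Complex.conj_eq_iff_im.mpr (h x)
    · intro h x
      have := congrArg Complex.im (RingHom.congr_fun h x)
      simp [NumberField.ComplexEmbedding.conjugate_coe_eq] at this
      linarith
  let e : (K →+* ℝ) ≃ {σ : K →+* ℂ // ¬ ∃ x : K, (σ x).im ≠ 0} :=
    { toFun := fun f => ⟨Complex.ofRealHom.comp f, by simp⟩
      invFun := fun σ => (NumberField.ComplexEmbedding.IsReal.embedding
        (φ := σ.1) (by by_contra h; exact σ.2 ((hreal _).mp h)))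
      left_inv := by
        intro f
        ext x
        apply Complex.ofReal_injective
        rw [NumberField.ComplexEmbedding.IsReal.coe_embedding_apply]
        rfl
      right_inv := by
        rintro ⟨σ, h⟩
        apply Subtype.ext
        ext x
        exact (NumberField.ComplexEmbedding.IsReal.coe_embedding_apply _ x) }
  have h1 := NumberField.Embeddings.card K ℂ
  have h2 : Nat.card (K →+* ℝ) = Fintype.card {σ : K →+* ℂ // ¬ ∃ x : K, (σ x).im ≠ 0} := by
    rw [Nat.card_congr e, Nat.card_eq_fintype_card]
  refine ⟨?_, ?_, Finite.of_equiv _ e.symm⟩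
  · rw [h2, Nat.card_eq_fintype_card, ← h1, Fintype.card_subtype_compl]
    have := Fintype.card_subtype_le (fun σ : K →+* ℂ => ∃ x : K, (σ x).im ≠ 0)
    omega
  · have := NumberField.InfinitePlace.card_complex_embeddings K
    rw [Nat.card_eq_fintype_card]
    have e2 : Fintype.card {σ : K →+* ℂ // ∃ x : K, (σ x).im ≠ 0} =
        Fintype.card {φ : K →+* ℂ // ¬ NumberField.ComplexEmbedding.IsReal φ} :=
      Fintype.card_congr (Equiv.subtypeEquivRight (fun σ => (hreal σ).symm))
    rw [e2, this]
    exact even_two_mul _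

/-- A quadratic field containing a square root of a negative integer is totally complex. -/
theorem no_real_of_sq_neg {F : Type*} [Field F] (d : ℤ) (hd : d < 0) (α : F)
    (hα : α ^ 2 = (d : F)) : IsEmpty (F →+* ℝ) := by
  refine ⟨fun σ => ?_⟩
  have := congrArg σ hα
  rw [map_pow, map_intCast] at this
  have h2 : (d : ℝ) < 0 := by exact_mod_cast hd
  nlinarith [sq_nonneg (σ α)]

/-- Totally complex quadratic fields are generated by the square root of a negative integer. -/
theorem quad_gen (K : Type) [Field K] [NumberField K] (h2 : Module.finrank ℚ K = 2)
    (hr : IsEmpty (K →+* ℝ)) : ∃ d : ℤ, Squarefree d ∧ d < 0 ∧ ∃ α : K, α ^ 2 = (d : K) ∧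
      ∀ x : K, ∃ p q : ℚ, x = (p : K) + (q : K) * α := by
  -- an element outside ℚ
  have hex : ∃ β : K, ∀ r : ℚ, β ≠ (r : K) := by
    by_contra hcon
    push Not at hcon
    have : Module.finrank ℚ K = 1 := finrank_eq_one (1 : K) one_ne_zero (by
      intro w
      obtain ⟨r, hr⟩ := hcon w
      exact ⟨r, by rw [hr, Rat.smul_one_eq_cast]⟩)
    omega
  obtain ⟨β, hβ⟩ := hex
  have hli : LinearIndependent ℚ ![(1 : K), β] := by
    rw [LinearIndependent.pair_iff]
    intro s t hst
    have ht : t = 0 := by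
      by_contra ht
      apply hβ (-s / t)
      have htK : (t : K) ≠ 0 := by exact_mod_cast ht
      rw [Rat.smul_def, Rat.smul_def] at hst
      push_cast
      field_simp
      linear_combination hst
    subst ht
    refine ⟨?_, rfl⟩
    simpa [Rat.smul_def] using hst
  have hspan : ⊤ ≤ Submodule.span ℚ (Set.range ![(1 : K), β]) := by
    rw [hli.span_eq_top_of_card_eq_finrank (by simp [h2])]
  have hrep : ∀ x : K, ∃ p q : ℚ, x = (p : K) + (q : K) * β := by
    intro x
    have hx : x ∈ Submodule.span ℚ (Set.range ![(1 : K), β]) := hspan trivial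
    simp only [Matrix.range_cons, Matrix.range_empty, Set.union_empty, Set.singleton_union] at hx
    obtain ⟨p, q, h⟩ := Submodule.mem_span_pair.mp hx
    refine ⟨p, q, ?_⟩
    rw [← h, Rat.smul_def, Rat.smul_def]; ring
  obtain ⟨p, q, hpq⟩ := hrep (β ^ 2)
  -- complete the square
  set c : ℚ := p + q ^ 2 / 4 with hc
  set γ : K := β - (q : K) / 2 with hγ
  have hγ2 : γ ^ 2 = (c : K) := by
    rw [hγ, hc]; push_cast
    linear_combination hpq
  -- c = num/den = num*den / den^2
  have hγr : ∀ r : ℚ, γ ≠ (r : K) := by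
    intro r e
    apply hβ (r + q / 2)
    push_cast
    rw [← e, hγ]; ring
  have hc0 : c ≠ 0 := by
    intro h
    apply hγr 0
    rw [h] at hγ2
    simpa using hγ2
  set N : ℤ := c.num * c.den with hN
  have hden : (c.den : ℚ) ≠ 0 := by exact_mod_cast c.den_nz
  have hNc : (N : ℚ) = c * (c.den : ℚ) ^ 2 := by
    have := Rat.mul_den_eq_num c
    rw [hN]; push_cast; rw [← this]; ring
  have hN0 : N ≠ 0 := by
    intro h
    rw [h] at hNc
    have : c * (c.den : ℚ) ^ 2 ≠ 0 := mul_ne_zero hc0 (pow_ne_zero 2 hden)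
    exact this (by rw [← hNc]; simp)
  obtain ⟨s, f, hsf, hsq⟩ := Nat.sq_mul_squarefree N.natAbs
  have hf0 : f ≠ 0 := by
    rintro rfl
    apply hN0
    have : N.natAbs = 0 := by rw [← hsf]; simp
    exact Int.natAbs_eq_zero.mp this
  set d : ℤ := N.sign * s with hd
  have hNd : N = (f : ℤ) ^ 2 * d := by
    rw [hd]
    have h1 := Int.sign_mul_natAbs N
    rw [← hsf] at h1
    push_cast at h1
    linear_combination -h1
  have hs0 : s ≠ 0 := hsq.ne_zero
  have hdsq : Squarefree d := by
    rw [← Int.squarefree_natAbs]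
    have : d.natAbs = s := by
      rw [hd, Int.natAbs_mul, Int.natAbs_sign_of_ne_zero hN0]; simp
    rw [this]; exact hsq
  have hfK : (f : K) ≠ 0 := by exact_mod_cast hf0
  have hdenK : (c.den : K) ≠ 0 := by exact_mod_cast c.den_nz
  set α : K := γ * c.den / f with hα
  have hα2 : α ^ 2 = (d : K) := by
    have h1 : (N : K) = (c : K) * (c.den : K) ^ 2 := by
      have := congrArg (fun r : ℚ => (r : K)) hNc
      simpa using this
    have h2 : (N : K) = (f : K) ^ 2 * (d : K) := by
      have := congrArg (fun r : ℤ => (r : K)) hNd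
      simpa using this
    rw [hα]
    field_simp
    rw [hγ2]
    linear_combination h2 - h1
  have hrepα : ∀ x : K, ∃ p q : ℚ, x = (p : K) + (q : K) * α := by
    intro x
    obtain ⟨p', q', h⟩ := hrep x
    refine ⟨p' + q' * q / 2, q' * f / c.den, ?_⟩
    have : β = α * f / c.den + (q : K) / 2 := by
      rw [hα]; field_simp; rw [hγ]; ring
    rw [h, this]
    push_cast
    field_simp
    ring
  refine ⟨d, hdsq, ?_, α, hα2, hrepα⟩
  by_contra hdn
  push Not at hdn
  have hdR : (0 : ℝ) ≤ (d : ℝ) := by exact_mod_cast hdn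
  have hαr : ∀ r : ℚ, α ≠ (r : K) := by
    intro r e
    apply hγr (r * f / c.den)
    push_cast
    rw [← e, hα]
    field_simp
  -- build the real embedding
  have hαint : IsIntegral ℚ α := Algebra.IsIntegral.isIntegral _
  have htop : IntermediateField.adjoin ℚ {α} = ⊤ := by
    rw [eq_top_iff]
    intro x _
    obtain ⟨p, q, h⟩ := hrepα x
    rw [h]
    have hm := IntermediateField.mem_adjoin_simple_self ℚ α
    have hpm : ∀ p : ℚ, (p : K) ∈ IntermediateField.adjoin ℚ {α} := fun p => by
      simpa using (IntermediateField.algebraMap_mem (IntermediateField.adjoin ℚ {α}) p)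
    exact add_mem (hpm p) (mul_mem (hpm q) hm)
  have hfact : (Polynomial.X ^ 2 - Polynomial.C (d : ℚ)).map (algebraMap ℚ ℝ) =
      (Polynomial.X - Polynomial.C (Real.sqrt d)) * (Polynomial.X - Polynomial.C (-Real.sqrt d)) := by
    have : (Polynomial.C (d : ℝ) : Polynomial ℝ) = Polynomial.C (Real.sqrt d) ^ 2 := by
      rw [← Polynomial.C_pow, Real.sq_sqrt hdR]
    simp only [Polynomial.map_sub, Polynomial.map_pow, Polynomial.map_X, Polynomial.map_C,
      eq_ratCast, Rat.cast_intCast, this, Polynomial.C_neg]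
    ring
  obtain ⟨φ⟩ := IntermediateField.nonempty_algHom_of_adjoin_splits (F := ℚ) (E := K) (K := ℝ)
    (S := {α}) (by
      intro s hs
      rw [Set.mem_singleton_iff] at hs
      subst hs
      refine ⟨hαint, ?_⟩
      have hdvd : minpoly ℚ α ∣ Polynomial.X ^ 2 - Polynomial.C (d : ℚ) :=
        minpoly.dvd _ _ (by simp [hα2])
      refine Polynomial.Splits.of_dvd ?_ ?_ (Polynomial.map_dvd (algebraMap ℚ ℝ) hdvd)
      · rw [hfact]
        exact (Polynomial.Splits.X_sub_C _).mul (Polynomial.Splits.X_sub_C _)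
      · rw [hfact]
        exact mul_ne_zero (Polynomial.X_sub_C_ne_zero _) (Polynomial.X_sub_C_ne_zero _)) htop
  exact hr.false φ.toRingHom

end Counting

section ImagQuad

theorem rat_trace_root (n : ℕ) (hn : 0 < n) (w : ℂ) (hw : w ^ n = 1) (r : ℚ)
    (hr : (r : ℂ) = w + w⁻¹) : r = -2 ∨ r = -1 ∨ r = 0 ∨ r = 1 ∨ r = 2 := by
  have h1 : IsIntegral ℤ w := by
    refine ⟨Polynomial.X ^ n - 1, Polynomial.monic_X_pow_sub_C 1 hn.ne', by simp [hw]⟩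
  have h1' : IsIntegral ℤ w⁻¹ := by
    refine ⟨Polynomial.X ^ n - 1, Polynomial.monic_X_pow_sub_C 1 hn.ne', by simp [hw]⟩
  have h2 : IsIntegral ℤ (algebraMap ℚ ℂ r) := by
    rw [eq_ratCast, hr]; exact h1.add h1'
  have h3 : IsIntegral ℤ r := (isIntegral_algebraMap_iff (algebraMap ℚ ℂ).injective).mp h2
  obtain ⟨z, hz⟩ := IsIntegrallyClosed.isIntegral_iff.mp h3
  have hz' : r = z := by rw [← hz]; simp
  have hnorm : ‖w‖ = 1 := Complex.norm_eq_one_of_pow_eq_one hw hn.ne'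
  have h4 : ‖(r : ℂ)‖ ≤ 2 := by
    rw [hr]
    refine (norm_add_le _ _).trans ?_
    rw [norm_inv, hnorm]; norm_num
  rw [hz'] at h4
  have h5 : |(z : ℝ)| ≤ 2 := by
    have : ‖(((z : ℚ)) : ℂ)‖ = |(z : ℝ)| := by simp
    rwa [this] at h4
  have h6 : |z| ≤ 2 := by exact_mod_cast h5
  rw [abs_le] at h6
  obtain ⟨h7, h8⟩ := h6
  rw [hz']
  interval_cases z <;> simp

theorem quad_im (K : IntermediateField ℚ ℂ) (d : ℤ) (hd : d < 0) (α : K) (hα : α ^ 2 = (d : K)) :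
    (α : ℂ).re = 0 ∧ (α : ℂ).im ≠ 0 := by
  have h : (α : ℂ) ^ 2 = (d : ℂ) := by
    have := congrArg (algebraMap K ℂ) hα
    rw [map_pow, map_intCast] at this
    exact this
  have h1 := congrArg Complex.re h
  have h2 := congrArg Complex.im h
  simp [sq] at h1 h2
  have hdR : (d : ℝ) < 0 := by exact_mod_cast hd
  have him : (α : ℂ).im ≠ 0 := by
    intro h0
    rw [h0] at h1
    nlinarith [mul_self_nonneg (α : ℂ).re]
  refine ⟨?_, him⟩
  have : (α : ℂ).re * (α : ℂ).im = 0 := by linarith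
  exact (mul_eq_zero.mp this).resolve_right him

theorem eta_cases (K : IntermediateField ℚ ℂ) (d : ℤ) (hd : d < 0) (α : K) (hα : α ^ 2 = (d : K))
    (hrep : ∀ x : K, ∃ p q : ℚ, x = (p : K) + (q : K) * α) (n : ℕ) (hn : 0 < n) (η : K)
    (hη : (η : ℂ) = Complex.exp (2 * Real.pi * Complex.I / n) +
            (Complex.exp (2 * Real.pi * Complex.I / n))⁻¹) (h4 : η ^ 2 - 4 ≠ 0) :
    η ^ 2 - 4 = -4 ∨ η ^ 2 - 4 = -3 := by
  obtain ⟨hre, him⟩ := quad_im K d hd α hα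
  have hprim := (Complex.isPrimitiveRoot_exp n hn.ne').pow_eq_one
  set ξ := Complex.exp (2 * Real.pi * Complex.I / n)
  have hnorm : ‖ξ‖ = 1 := Complex.norm_eq_one_of_pow_eq_one hprim hn.ne'
  have hinv : ξ⁻¹ = (starRingEnd ℂ) ξ := Complex.inv_eq_conj hnorm
  obtain ⟨p, q, hpq⟩ := hrep η
  have hC : (η : ℂ) = (p : ℂ) + (q : ℂ) * (α : ℂ) := by
    rw [hpq]; push_cast; rfl
  have hq : q = 0 := by
    have h1 := congrArg Complex.im hC
    rw [hη, hinv] at h1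
    simp at h1
    rcases h1 with h1 | h1
    · exact_mod_cast h1
    · exact absurd h1 him
  have hηp : (p : ℂ) = ξ + ξ⁻¹ := by
    rw [← hη, hC, hq]; simp
  have hηp' : η = (p : K) := by rw [hpq, hq]; simp
  rw [hηp'] at h4 ⊢
  rcases rat_trace_root n hn ξ hprim p hηp with h | h | h | h | h <;> subst h
  · exact absurd (by norm_num) h4
  · right; norm_num
  · left; norm_num
  · right; norm_num
  · exact absurd (by norm_num) h4

theorem unit_cases (K : IntermediateField ℚ ℂ) (d : ℤ) (hd : d < 0) (α : K) (hα : α ^ 2 = (d : K))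
    (hrep : ∀ x : K, ∃ p q : ℚ, x = (p : K) + (q : K) * α) (m : ℕ) (hm : 0 < m) (u : K)
    (hu : u ^ m = 1) :
    u = 1 ∨ u = -1 ∨ u ^ 2 = -1 ∨ u ^ 2 + u + 1 = 0 ∨ u ^ 2 - u + 1 = 0 := by
  obtain ⟨hre, him⟩ := quad_im K d hd α hα
  have huC : (u : ℂ) ^ m = 1 := by
    have := congrArg (algebraMap K ℂ) hu
    rw [map_pow, map_one] at this
    exact this
  have hnorm : ‖(u : ℂ)‖ = 1 := Complex.norm_eq_one_of_pow_eq_one huC hm.ne'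
  have hinv : (u : ℂ)⁻¹ = (starRingEnd ℂ) u := Complex.inv_eq_conj hnorm
  obtain ⟨p, q, hpq⟩ := hrep u
  have hC : (u : ℂ) = (p : ℂ) + (q : ℂ) * (α : ℂ) := by
    rw [hpq]; push_cast; rfl
  have hu0 : (u : ℂ) ≠ 0 := by intro h; rw [h] at hnorm; simp at hnorm
  have htr : ((2 * p : ℚ) : ℂ) = (u : ℂ) + (u : ℂ)⁻¹ := by
    rw [hinv, Complex.add_conj, hC]
    simp [hre]
  have heq : u ^ 2 - ((2 * p : ℚ) : K) * u + 1 = 0 := by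
    apply (algebraMap K ℂ).injective
    rw [map_add, map_sub, map_mul, map_pow, map_ratCast, map_one, map_zero]
    change (u : ℂ) ^ 2 - ((2 * p : ℚ) : ℂ) * (u : ℂ) + 1 = 0
    rw [htr]; field_simp; ring
  rcases rat_trace_root m hm (u : ℂ) huC _ htr with h | h | h | h | h <;> rw [h] at heq
  · right; left
    have : (u + 1) ^ 2 = 0 := by push_cast at heq; linear_combination heq
    have := pow_eq_zero_iff two_ne_zero |>.mp this
    linear_combination this
  · right; right; right; left
    push_cast at heq; linear_combination heq
  · right; right; left
    push_cast at heq; linear_combination heq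
  · right; right; right; right
    push_cast at heq; linear_combination heq
  · left
    have : (u - 1) ^ 2 = 0 := by push_cast at heq; linear_combination heq
    have := pow_eq_zero_iff two_ne_zero |>.mp this
    linear_combination this

end ImagQuad

section ImagQuadAlg

variable {F : Type*} [Field F] [CharZero F] {a b : F}

/-- An element whose square is the square of a scalar is a scalar. -/
theorem scal_of_sq (hdiv : ∀ x : ℍ[F,a,b], qnorm x = 0 → x = 0) (Q : ℍ[F,a,b]) (s : F)
    (h : Q * Q = algebraMap F _ (s ^ 2)) : IsScal Q := by
  have := quat_nzd hdiv
  have hc := Algebra.commutes s Q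
  have : (Q - algebraMap F _ s) * (Q + algebraMap F _ s) = 0 := by
    rw [sub_mul, mul_add, mul_add, h, hc, ← map_mul, sq]; abel
  rw [isScal_iff]
  rcases mul_eq_zero.mp this with h1 | h1
  · exact ⟨s, sub_eq_zero.mp h1⟩
  · exact ⟨-s, by rw [map_neg]; exact eq_neg_of_add_eq_zero_left h1⟩

theorem normalize_Q (hdiv : ∀ x : ℍ[F,a,b], qnorm x = 0 → x = 0) (P Q : ℍ[F,a,b]) (u c : F)
    (hP : P * P = algebraMap F _ c) (hQP : Q * P = -(P * Q)) (hPs : ¬ IsScal P)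
    (hQs : ¬ IsScal Q) (hQ : Q * Q = algebraMap F _ u) (hc : c = -4 ∨ c = -3)
    (hu : u = 1 ∨ u = -1 ∨ u ^ 2 = -1 ∨ u ^ 2 + u + 1 = 0 ∨ u ^ 2 - u + 1 = 0) :
    ∃ Q' : ℍ[F,a,b], Q' * P = -(P * Q') ∧ Q' * Q' = algebraMap F _ (-1) := by
  have := quat_nzd hdiv
  rcases hu with h | h | h | h | h
  · exact absurd (scal_of_sq hdiv Q 1 (by rw [hQ, h]; simp)) hQs
  · exact ⟨Q, hQP, by rw [hQ, h]⟩
  · exfalso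
    rcases hc with hc | hc
    · apply hPs
      exact scal_of_sq hdiv P (2 * u) (by rw [hP, hc]; congr 1; linear_combination -4 * h)
    · -- zero divisor
      have hcu : ∀ (s : F) (X : ℍ[F,a,b]), X * algebraMap F _ s = algebraMap F _ s * X :=
        fun s X => (Algebra.commutes s X).symm
      set U : ℍ[F,a,b] := algebraMap F _ u with hU
      set V : ℍ[F,a,b] := algebraMap F _ (u - 1) with hV
      have hprod : (U + V * Q - P) * (U - V * Q + P) = 0 := by
        have e1 : V * Q * U = U * (V * Q) := by rw [hU, hcu]
        have e2 : V * Q * (V * Q) = V * V * (Q * Q) := by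
          rw [mul_assoc, ← mul_assoc Q, hV, hcu]; simp only [mul_assoc]
        have e3 : V * Q * P = -(P * (V * Q)) := by
          rw [mul_assoc, hQP, ← mul_assoc P, hV, hcu, mul_neg, mul_assoc]
        have e4 : P * U = U * P := by rw [hU, hcu]
        calc (U + V * Q - P) * (U - V * Q + P)
            = U * U - U * (V * Q) + U * P + (V * Q * U - V * Q * (V * Q) + V * Q * P)
              - P * U + P * (V * Q) - P * P := by noncomm_ring
          _ = U * U - V * V * (Q * Q) - P * P := by
              rw [e1, e2, e3, e4]; abel
          _ = 0 := by
              rw [hQ, hP, hc, hU, hV, ← map_mul, ← map_mul, ← map_mul, ← map_sub, ← map_sub,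
                ← map_zero (algebraMap F ℍ[F,a,b])]
              congr 1
              linear_combination (3 - u) * h
      have hfin : ∀ s t : F, P = algebraMap F _ s + algebraMap F _ t * Q → False := by
        intro s t hst
        have hcomm : Q * P = P * Q := by
          rw [hst, mul_add, add_mul, ← mul_assoc, hcu, hcu]
        have h0 : P * Q = 0 := by
          rw [hcomm] at hQP
          have h2 : (2 : F) • (P * Q) = 0 := by
            rw [two_smul]; nth_rewrite 1 [hQP]; simp
          exact (smul_eq_zero.mp h2).resolve_left two_ne_zero
        rcases mul_eq_zero.mp h0 with h0 | h0
        · exact hPs (by rw [h0]; exact ⟨rfl, rfl, rfl⟩)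
        · exact hQs (by rw [h0]; exact ⟨rfl, rfl, rfl⟩)
      rcases mul_eq_zero.mp hprod with h1 | h1
      · exact hfin u (u - 1) (sub_eq_zero.mp h1).symm
      · apply hfin (-u) (u - 1)
        rw [map_neg, ← hU, ← hV]
        have : P = (U - V * Q + P) - U + V * Q := by abel
        rw [this, h1]; abel
  · exact absurd (scal_of_sq hdiv Q (u ^ 2) (by
      rw [hQ]; congr 1; linear_combination (-(u ^ 2 - u)) * h)) hQs
  · have hu0 : u ≠ 0 := by rintro rfl; simp at h
    refine ⟨algebraMap F _ ((u ^ 2)⁻¹) * Q, ?_, ?_⟩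
    · rw [mul_assoc, hQP, mul_neg, ← mul_assoc, ← mul_assoc, Algebra.commutes]
    · have hcm := Algebra.commutes ((u ^ 2)⁻¹) Q
      have : algebraMap F ℍ[F,a,b] ((u ^ 2)⁻¹) * Q * (algebraMap F _ ((u ^ 2)⁻¹) * Q)
          = algebraMap F _ ((u ^ 2)⁻¹) * algebraMap F _ ((u ^ 2)⁻¹) * (Q * Q) := by
        rw [mul_assoc, ← mul_assoc Q, ← hcm]; simp only [mul_assoc]
      rw [this, hQ, ← map_mul, ← map_mul]
      congr 1
      field_simp
      linear_combination (u + 1) * h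

end ImagQuadAlg

section Forward

theorem scal_of_equiv {F : Type*} [Field F] [CharZero F] {a b c e : F}
    (f : ℍ[F,a,b] ≃ₐ[F] ℍ[F,c,e]) (hdiv : ∀ x : ℍ[F,a,b], qnorm x = 0 → x = 0)
    (q : ℍ[F,c,e]) (s : F) (hq : q * q = algebraMap F _ (s ^ 2)) : IsScal q := by
  have h := scal_of_sq hdiv (f.symm q) s (by rw [← map_mul, hq, AlgEquiv.commutes])
  obtain ⟨r, hr⟩ := (isScal_iff _).mp h
  rw [isScal_iff]
  refine ⟨r, f.symm.injective ?_⟩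
  rw [hr, AlgEquiv.commutes]

theorem neg_int_cast (K : Type*) [Field K] (d : ℤ) (hd : d < 0) (x y z : ℚ) (k : ℚ)
    (h : (d.natAbs : ℚ) = x ^ 2 + k * y ^ 2 + k * z ^ 2) [CharZero K] :
    (d : K) = -((x : K) ^ 2 + k * (y : K) ^ 2 + k * (z : K) ^ 2) := by
  have h1 : (d : ℚ) = -(d.natAbs : ℚ) := by
    have : d = -(d.natAbs : ℤ) := by omega
    exact_mod_cast this
  have h2 : (d : ℚ) = -(x ^ 2 + k * y ^ 2 + k * z ^ 2) := by rw [h1, h]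
  have := congrArg (fun r : ℚ => (r : K)) h2
  push_cast at this
  exact this

theorem imag_quad_case (K : IntermediateField ℚ ℂ) [FiniteDimensional ℚ K] (a b : K)
    (ha : a ≠ 0) (hb : b ≠ 0) (h2 : Module.finrank ℚ K = 2) (hr : IsEmpty (↥K →+* ℝ))
    (hdiv : ∀ x : ℍ[↥K,a,b], qnorm x = 0 → x = 0)
    (G : Subgroup (ℍ[↥K,a,b])ˣ) [Finite G] (hnc : ∃ x ∈ G, ∃ y ∈ G, x * y ≠ y * x) :
    ((∃ d : ℤ, Squarefree d ∧ d < 0 ∧ d % 8 = 1 ∧ Module.finrank ℚ K = 2 ∧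
          ∃ α : K, α ^ 2 = (d : K)) ∧
        Nonempty (ℍ[↥K, a, b] ≃ₐ[↥K] ℍ[↥K, -1, -1])) ∨
      ((∃ d : ℤ, Squarefree d ∧ d < 0 ∧ d % 3 = 1 ∧ Module.finrank ℚ K = 2 ∧
          ∃ α : K, α ^ 2 = (d : K)) ∧
        Nonempty (ℍ[↥K, a, b] ≃ₐ[↥K] ℍ[↥K, -1, -3])) := by
  have : NumberField K := ⟨⟩
  obtain ⟨d, hsq, hd, α, hα, hrep⟩ := quad_gen K h2 hr
  obtain ⟨n, hn, η, hη, h4, P, Q, hP, hQP, hPs, hQs, hQ, m, hm, hqm⟩ :=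
    key_data K a b ha hb hdiv G hnc
  have hu : (-qnorm Q) ^ (2 * m) = 1 := by
    rw [pow_mul, neg_sq, ← pow_mul, mul_comm, pow_mul, hqm, one_pow]
  have hc := eta_cases K d hd α hα hrep n (by omega) η hη h4
  obtain ⟨R, hRP, hR⟩ := normalize_Q hdiv P Q (-qnorm Q) (η ^ 2 - 4) hP hQP hPs hQs hQ hc
    (unit_cases K d hd α hα hrep (2 * m) (by omega) _ hu)
  have hdim : Module.finrank K ℍ[↥K,a,b] = 4 := QuaternionAlgebra.finrank_eq_four _ _ _
  have hmpos : 0 < d.natAbs := by omega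
  have hmsq : Squarefree d.natAbs := Int.squarefree_natAbs.mpr hsq
  have hm0 : (d.natAbs : ℚ) ≠ 0 := by exact_mod_cast hmpos.ne'
  rcases hc with hc | hc
  · left
    rw [hc] at hP
    have hhalf := fun X : ℍ[↥K,a,b] => Algebra.commutes (2⁻¹ : K) X
    obtain ⟨e⟩ := quat_recog (c := (-1 : K)) (e := (-1 : K)) hdim (by simp) (by simp)
      (algebraMap K _ (2⁻¹ : K) * P) R (by
        rw [mul_assoc, ← mul_assoc P, ← hhalf, mul_assoc, hP, ← map_mul, ← map_mul]
        congr 1; norm_num) hR (by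
        rw [← mul_assoc, ← hhalf, mul_assoc, hRP, mul_neg, mul_assoc])
    refine ⟨⟨d, hsq, hd, ?_, h2, α, hα⟩, ⟨e⟩⟩
    by_contra hd8
    obtain ⟨x, y, z, hxyz⟩ := three_squares_rat d.natAbs hmpos hmsq (by omega)
    have hdK := neg_int_cast K d hd x y z 1 (by rw [hxyz]; ring)
    have hs := scal_of_equiv e hdiv ⟨0, x, y, z⟩ α (by
      rw [QuaternionAlgebra.algebraMap_eq, hα, hdK]
      ext <;> simp <;> ring)
    obtain ⟨h1, h2, h3⟩ := hs
    simp at h1 h2 h3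
    apply hm0
    rw [hxyz, h1, h2, h3]; norm_num
  · right
    rw [hc] at hP
    obtain ⟨e⟩ := quat_recog (c := (-1 : K)) (e := (-3 : K)) hdim (by simp) (by simp)
      R P hR hP (by rw [hRP, neg_neg])
    refine ⟨⟨d, hsq, hd, ?_, h2, α, hα⟩, ⟨e⟩⟩
    by_contra hd8
    obtain ⟨x, y, z, hxyz⟩ := one_three_three_rat d.natAbs hmpos hmsq (by omega)
    have hdK := neg_int_cast K d hd x y z 3 (by rw [hxyz])
    have hs := scal_of_equiv e hdiv ⟨0, x, y, z⟩ α (by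
      rw [QuaternionAlgebra.algebraMap_eq, hα, hdK]
      ext <;> simp <;> ring)
    obtain ⟨h1, h2, h3⟩ := hs
    simp at h1 h2 h3
    apply hm0
    rw [hxyz, h1, h2, h3]; norm_num

theorem real_case (K : IntermediateField ℚ ℂ) [FiniteDimensional ℚ K] (a b : K)
    (ha : a ≠ 0) (hb : b ≠ 0) (σ : ↥K →+* ℝ)
    (hdiv : ∀ x : ℍ[↥K,a,b], qnorm x = 0 → x = 0)
    (G : Subgroup (ℍ[↥K,a,b])ˣ) [Finite G] (hnc : ∃ x ∈ G, ∃ y ∈ G, x * y ≠ y * x) :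
    ∃ n : ℕ, 3 ≤ n ∧
        ∃ η lamSq : K,
          (η : ℂ) = Complex.exp (2 * Real.pi * Complex.I / n) +
            (Complex.exp (2 * Real.pi * Complex.I / n))⁻¹ ∧
          (lamSq : ℂ) = (Complex.exp (2 * Real.pi * Complex.I / n) -
            (Complex.exp (2 * Real.pi * Complex.I / n))⁻¹) ^ 2 ∧
          Nonempty (ℍ[↥K, a, b] ≃ₐ[↥K] ℍ[↥K, lamSq, -1]) := by
  obtain ⟨n, hn, η, hη, h4, P, Q, hP, hQP, hPs, hQs, hQ, m, hm, hqm⟩ :=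
    key_data K a b ha hb hdiv G hnc
  have hdim : Module.finrank K ℍ[↥K,a,b] = 4 := QuaternionAlgebra.finrank_eq_four _ _ _
  have hq1 : qnorm Q = 1 := by
    have h1 : (σ (qnorm Q)) ^ m = 1 := by rw [← map_pow, hqm, map_one]
    have h6 : |σ (qnorm Q)| ^ m = 1 := by rw [← abs_pow, h1, abs_one]
    have h7 : |σ (qnorm Q)| = 1 := (pow_eq_one_iff_of_nonneg (abs_nonneg _) hm.ne').mp h6
    rcases eq_or_eq_neg_of_abs_eq h7 with h | h
    · apply σ.injective; rw [h, map_one]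
    · exfalso
      have : qnorm Q = -1 := by apply σ.injective; rw [h, map_neg, map_one]
      apply hQs
      apply scal_of_sq hdiv Q 1
      rw [hQ, this]; simp
  refine ⟨n, hn, η, η ^ 2 - 4, hη, ?_, ?_⟩
  · have : ((η ^ 2 - 4 : K) : ℂ) = (η : ℂ) ^ 2 - 4 := by
      have := map_sub (algebraMap K ℂ) (η ^ 2) 4
      rw [map_pow, map_ofNat] at this
      exact this
    rw [this, hη]
    have h0 := Complex.exp_ne_zero (2 * Real.pi * Complex.I / n)
    field_simp
    ring
  · exact quat_recog hdim h4 (by simp) P Q hP (by rw [hQ, hq1]) hQP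

theorem bot_of_finrank_one (K : IntermediateField ℚ ℂ) (h : Module.finrank ℚ K = 1) : K = ⊥ :=
  IntermediateField.finrank_eq_one_iff.mp h

theorem split_case (K : IntermediateField ℚ ℂ) [FiniteDimensional ℚ K] (a b : K)
    (hx : ¬ ∀ x : ℍ[↥K,a,b], qnorm x = 0 → x = 0)
    (hcount : Nat.card {σ : ↥K →+* ℝ // ¬(σ a < 0 ∧ σ b < 0)} +
        Nat.card {σ : ↥K →+* ℂ // ∃ x : ↥K, (σ x).im ≠ 0} / 2 ≤ 1) :
    K = ⊥ ∨ (Module.finrank ℚ K = 2 ∧ IsEmpty (↥K →+* ℝ)) := by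
  have : NumberField K := ⟨⟩
  obtain ⟨h1, h2, h3⟩ := emb_count K
  have he : Nat.card {σ : ↥K →+* ℝ // ¬(σ a < 0 ∧ σ b < 0)} = Nat.card (↥K →+* ℝ) :=
    Nat.card_congr (Equiv.subtypeUnivEquiv (fun σ hσ => hx (div_of_ram hσ.1 hσ.2)))
  rw [he] at hcount
  obtain ⟨c, hc⟩ := h2
  have hpos : 0 < Module.finrank ℚ K := Module.finrank_pos
  have : Module.finrank ℚ K = 1 ∨ (Module.finrank ℚ K = 2 ∧ Nat.card (↥K →+* ℝ) = 0) := by omega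
  rcases this with h | ⟨h, h'⟩
  · exact Or.inl (bot_of_finrank_one K h)
  · refine Or.inr ⟨h, ?_⟩
    rcases Nat.card_eq_zero.mp h' with h4 | h4
    · exact h4
    · exact absurd h3 (by rwa [not_finite_iff_infinite])

theorem noncomm_of_adjoin {F : Type*} [Field F] [CharZero F] {a b : F} (G : Subgroup (ℍ[F,a,b])ˣ)
    (h : Algebra.adjoin F (Units.val '' (G : Set (ℍ[F,a,b])ˣ)) = ⊤) :
    ∃ x ∈ G, ∃ y ∈ G, x * y ≠ y * x := by
  by_contra hcon
  push Not at hcon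
  have hc : ∀ x ∈ Units.val '' (G : Set (ℍ[F,a,b])ˣ), ∀ y ∈ Units.val '' (G : Set (ℍ[F,a,b])ˣ),
      x * y = y * x := by
    rintro _ ⟨x, hx, rfl⟩ _ ⟨y, hy, rfl⟩
    exact_mod_cast congrArg Units.val (hcon x hx y hy)
  have h1 : ∀ x y : ℍ[F,a,b], x * y = y * x := by
    intro x y
    let _ := Algebra.adjoinCommRingOfComm F hc
    have hx : x ∈ Algebra.adjoin F (Units.val '' (G : Set (ℍ[F,a,b])ˣ)) := by rw [h]; trivial
    have hy : y ∈ Algebra.adjoin F (Units.val '' (G : Set (ℍ[F,a,b])ˣ)) := by rw [h]; trivial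
    exact congrArg Subtype.val (mul_comm (⟨x, hx⟩ :
      Algebra.adjoin F (Units.val '' (G : Set (ℍ[F,a,b])ˣ))) ⟨y, hy⟩)
  have h2 := congrArg QuaternionAlgebra.imK (h1 ⟨0, 1, 0, 0⟩ ⟨0, 0, 1, 0⟩)
  simp at h2
  have : (2 : F) = 0 := by linear_combination h2
  exact two_ne_zero this

end Forward

section Backward

open Polynomial

/-- The Schur property: generated by a finite subgroup of units. -/
def IsSchur (F A : Type*) [Field F] [Ring A] [Algebra F A] : Prop :=
  ∃ G : Subgroup Aˣ, Finite G ∧ Algebra.adjoin F (Units.val '' (G : Set Aˣ)) = ⊤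

theorem schur_equiv {F A B : Type*} [Field F] [Ring A] [Algebra F A] [Ring B] [Algebra F B]
    (e : A ≃ₐ[F] B) (h : IsSchur F B) : IsSchur F A := by
  obtain ⟨G, hG, hadj⟩ := h
  let f : Bˣ →* Aˣ := Units.map (e.symm : B →* A)
  refine ⟨G.map f, ?_, ?_⟩
  · exact Set.Finite.image f (Set.toFinite (G : Set Bˣ))
  · have : Units.val '' ((G.map f : Subgroup Aˣ) : Set Aˣ)
        = e.symm.toAlgHom '' (Units.val '' (G : Set Bˣ)) := by
      rw [Subgroup.coe_map, Set.image_image, Set.image_image]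
      rfl
    rw [this, Algebra.adjoin_image, hadj, Algebra.map_top, AlgHom.range_eq_top]
    exact e.symm.surjective

theorem schur_of_gens {F A : Type*} [Field F] [Ring A] [Algebra F A] (g h : A) (n : ℕ) (hn : 0 < n)
    (hg : g ^ n = 1) (hh : h ^ 4 = 1) (hgh : g * h * g = h) (hadj : Algebra.adjoin F {g, h} = ⊤) :
    IsSchur F A := by
  let u : Aˣ := Units.ofPowEqOne g n hg hn.ne'
  let v : Aˣ := Units.ofPowEqOne h 4 hh (by norm_num)
  have hu : u ^ n = 1 := Units.pow_ofPowEqOne hg hn.ne'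
  have hv : v ^ 4 = 1 := Units.pow_ofPowEqOne hh (by norm_num)
  have huv : u * v * u = v := Units.ext hgh
  have hconj : v * u * v⁻¹ = u⁻¹ := by
    have : v * u = u⁻¹ * v := by
      rw [eq_inv_mul_iff_mul_eq, ← mul_assoc]; exact huv
    rw [this, mul_assoc, mul_inv_cancel, mul_one]
  let N := Subgroup.zpowers u
  let H := Subgroup.zpowers v
  have hfN : (N : Set Aˣ).Finite := by
    have : IsOfFinOrder u := isOfFinOrder_iff_pow_eq_one.mpr ⟨n, hn, hu⟩
    exact this.finite_zpowers
  have hfH : (H : Set Aˣ).Finite := by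
    have : IsOfFinOrder v := isOfFinOrder_iff_pow_eq_one.mpr ⟨4, by norm_num, hv⟩
    exact this.finite_zpowers
  have hle : H ≤ Subgroup.normalizer (N : Set Aˣ) := by
    rw [Subgroup.zpowers_le, Subgroup.mem_normalizer_iff]
    have hpow : ∀ k : ℤ, v * u ^ k * v⁻¹ = (u ^ k)⁻¹ := by
      intro k
      rw [← conj_zpow, hconj, inv_zpow]
    intro x
    constructor
    · intro hx
      obtain ⟨k, rfl⟩ := Subgroup.mem_zpowers_iff.mp hx
      change v * u ^ k * v⁻¹ ∈ N
      rw [hpow]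
      exact N.inv_mem hx
    · intro hx
      obtain ⟨k, hk⟩ := Subgroup.mem_zpowers_iff.mp hx
      have : x = (u ^ k)⁻¹ := by
        have h1 := hpow (-k)
        rw [zpow_neg, inv_inv] at h1
        rw [hk] at h1
        have h2 : v * (u ^ k)⁻¹ * v⁻¹ = v * x * v⁻¹ := by rw [hk, h1]
        simpa using h2.symm
      rw [this]
      exact N.inv_mem (Subgroup.zpow_mem_zpowers u k)
  have hcoe := Subgroup.coe_mul_of_left_le_normalizer_right H N hle
  refine ⟨H ⊔ N, ?_, ?_⟩
  · have : ((H ⊔ N : Subgroup Aˣ) : Set Aˣ).Finite := by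
      rw [hcoe]; exact hfH.mul hfN
    exact this
  · rw [eq_top_iff, ← hadj]
    apply Algebra.adjoin_mono
    rintro x (rfl | hx)
    · exact ⟨u, (le_sup_right : N ≤ H ⊔ N) (Subgroup.mem_zpowers u), rfl⟩
    · rw [Set.mem_singleton_iff] at hx
      subst hx
      exact ⟨v, (le_sup_left : H ≤ H ⊔ N) (Subgroup.mem_zpowers v), rfl⟩

variable {F : Type*} [Field F] [CharZero F] {c e : F}

theorem quat_top (S : Subalgebra F ℍ[F,c,e]) (hi : (⟨0, 1, 0, 0⟩ : ℍ[F,c,e]) ∈ S)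
    (hj : (⟨0, 0, 1, 0⟩ : ℍ[F,c,e]) ∈ S) : S = ⊤ := by
  rw [eq_top_iff]
  intro q _
  have hk := S.mul_mem hi hj
  have : q = q.re • (1 : ℍ[F,c,e]) + q.imI • (⟨0, 1, 0, 0⟩ : ℍ[F,c,e])
      + q.imJ • (⟨0, 0, 1, 0⟩ : ℍ[F,c,e])
      + q.imK • ((⟨0, 1, 0, 0⟩ : ℍ[F,c,e]) * (⟨0, 0, 1, 0⟩ : ℍ[F,c,e])) := by
    ext <;> simp
  rw [this]
  exact S.add_mem (S.add_mem (S.add_mem (S.smul_mem S.one_mem _) (S.smul_mem hi _))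
    (S.smul_mem hj _)) (S.smul_mem hk _)

theorem pow_four_quat (x : ℍ[F,c,e]) (s : F) (hs : s ^ 2 = 1) (hx : x * x = algebraMap F _ s) :
    x ^ 4 = 1 := by
  have : x ^ 4 = (x * x) * (x * x) := by noncomm_ring
  rw [this, hx, ← map_mul, ← sq, hs, map_one]

theorem schur_neg_one (e : F) (he : e ^ 2 = 1) : IsSchur F ℍ[F,-1,e] := by
  apply schur_of_gens (⟨0, 1, 0, 0⟩ : ℍ[F,-1,e]) ⟨0, 0, 1, 0⟩ 4 (by norm_num)
  · apply pow_four_quat _ (-1) (by norm_num)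
    rw [QuaternionAlgebra.algebraMap_eq]; ext <;> simp
  · apply pow_four_quat _ e he
    rw [QuaternionAlgebra.algebraMap_eq]; ext <;> simp
  · ext <;> simp
  · apply quat_top
    · exact Algebra.subset_adjoin (by simp)
    · exact Algebra.subset_adjoin (by simp)

theorem schur_matrix : IsSchur F (Matrix (Fin 2) (Fin 2) F) := by
  obtain ⟨f⟩ := quat_recog (F := F) (c := -1) (e := 1) (B := Matrix (Fin 2) (Fin 2) F)
    (by rw [Module.finrank_matrix]; simp) (by simp) (by simp)
    !![0, -1; 1, 0] !![1, 0; 0, -1]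
    (by rw [Matrix.algebraMap_eq_diagonal]; ext i j; fin_cases i <;> fin_cases j <;> simp [Matrix.mul_fin_two])
    (by rw [Matrix.algebraMap_eq_diagonal]; ext i j; fin_cases i <;> fin_cases j <;> simp [Matrix.mul_fin_two])
    (by ext i j; fin_cases i <;> fin_cases j <;> simp [Matrix.mul_fin_two])
  exact schur_equiv f (schur_neg_one 1 (by norm_num))

theorem schur_neg_three : IsSchur F ℍ[F,-1,-3] := by
  let g : ℍ[F,-1,-3] := ⟨1 / 2, 0, 1 / 2, 0⟩
  let h : ℍ[F,-1,-3] := ⟨0, 1, 0, 0⟩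
  have hg2 : g * g = g - 1 := by ext <;> simp [g] <;> norm_num
  have hg3 : g * g * g = -1 := by rw [hg2, sub_mul, hg2]; simp
  apply schur_of_gens g h 6 (by norm_num)
  · have : g ^ 6 = (g * g * g) * (g * g * g) := by noncomm_ring
    rw [this, hg3]; simp
  · apply pow_four_quat _ (-1) (by norm_num)
    rw [QuaternionAlgebra.algebraMap_eq]; ext <;> simp [h]
  · ext <;> simp [g, h] <;> norm_num
  · apply quat_top
    · exact Algebra.subset_adjoin (by simp [h])
    · have hgm : g ∈ Algebra.adjoin F {g, h} := Algebra.subset_adjoin (by simp)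
      have : (⟨0, 0, 1, 0⟩ : ℍ[F,-1,-3]) = (2 : F) • g - 1 := by ext <;> simp [g]
      rw [this]
      exact Subalgebra.sub_mem _ (Subalgebra.smul_mem _ hgm _) (Subalgebra.one_mem _)

theorem schur_cyclo (η l : F) (hl : l = η ^ 2 - 4) (n : ℕ) (hn : 0 < n)
    (hd : (X ^ 2 - C η * X + 1 : F[X]) ∣ X ^ n - 1) : IsSchur F ℍ[F,l,-1] := by
  let g : ℍ[F,l,-1] := ⟨η / 2, 1 / 2, 0, 0⟩
  let h : ℍ[F,l,-1] := ⟨0, 0, 1, 0⟩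
  have hgq : g ^ 2 - algebraMap F _ η * g + 1 = 0 := by
    rw [QuaternionAlgebra.algebraMap_eq, sq]
    ext <;> simp [g, hl] <;> ring
  apply schur_of_gens g h n hn
  · obtain ⟨q, hq⟩ := hd
    have := congrArg (aeval g) hq
    rw [map_mul] at this
    have e1 : aeval g (X ^ 2 - C η * X + 1 : F[X]) = 0 := by simpa using hgq
    rw [e1, zero_mul] at this
    simpa [sub_eq_zero] using this
  · apply pow_four_quat _ (-1) (by norm_num)
    rw [QuaternionAlgebra.algebraMap_eq]; ext <;> simp [h]
  · ext <;> simp [g, h, hl] <;> ring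
  · apply quat_top
    · have hgm : g ∈ Algebra.adjoin F {g, h} := Algebra.subset_adjoin (by simp)
      have : (⟨0, 1, 0, 0⟩ : ℍ[F,l,-1]) = (2 : F) • g - algebraMap F _ η := by
        rw [QuaternionAlgebra.algebraMap_eq]
        ext <;> simp [g] <;> ring
      rw [this]
      exact Subalgebra.sub_mem _ (Subalgebra.smul_mem _ hgm _) (Subalgebra.algebraMap_mem _ _)
    · exact Algebra.subset_adjoin (by simp [h])

theorem cyclo_dvd (K : IntermediateField ℚ ℂ) (n : ℕ) (hn : 3 ≤ n) (η : K)
    (hη : (η : ℂ) = Complex.exp (2 * Real.pi * Complex.I / n) +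
            (Complex.exp (2 * Real.pi * Complex.I / n))⁻¹) :
    (X ^ 2 - C η * X + 1 : (↥K)[X]) ∣ X ^ n - 1 ∧ η ^ 2 - 4 ≠ 0 := by
  have hexp := Complex.isPrimitiveRoot_exp n (by omega)
  have hξ0 := Complex.exp_ne_zero (2 * Real.pi * Complex.I / n)
  set ξ := Complex.exp (2 * Real.pi * Complex.I / n)
  have hξ2 : ξ ^ 2 ≠ 1 := by
    intro e
    have := Nat.le_of_dvd (by norm_num) (hexp.dvd_of_pow_eq_one 2 e)
    omega
  have hne : ξ ≠ ξ⁻¹ := by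
    intro h
    apply hξ2
    rw [sq]; nth_rewrite 2 [h]; exact mul_inv_cancel₀ hξ0
  constructor
  · rw [← Polynomial.map_dvd_map' (algebraMap K ℂ)]
    have e1 : (X ^ 2 - C η * X + 1 : (↥K)[X]).map (algebraMap K ℂ) = (X - C ξ) * (X - C ξ⁻¹) := by
      have e2 : algebraMap K ℂ η = ξ + ξ⁻¹ := hη
      have e3 : (C ξ * C ξ⁻¹ : ℂ[X]) = 1 := by rw [← C_mul, mul_inv_cancel₀ hξ0, C_1]
      simp only [Polynomial.map_add, Polynomial.map_sub, Polynomial.map_mul, Polynomial.map_pow,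
        Polynomial.map_X, Polynomial.map_C, Polynomial.map_one, e2, C_add]
      linear_combination -e3
    rw [e1]
    apply IsCoprime.mul_dvd
    · exact isCoprime_X_sub_C_of_isUnit_sub (sub_ne_zero.mpr hne).isUnit
    · rw [dvd_iff_isRoot]; simp [hexp.pow_eq_one]
    · rw [dvd_iff_isRoot]; simp [hexp.pow_eq_one]
  · intro e
    have e' : (η : ℂ) ^ 2 - 4 = 0 := by
      have := congrArg (algebraMap K ℂ) e
      rwa [map_sub, map_pow, map_ofNat, map_zero] at this
    apply hξ2
    have : (ξ ^ 2 - 1) ^ 2 = 0 := by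
      rw [hη] at e'
      field_simp at e'
      linear_combination e'
    have := pow_eq_zero_iff (two_ne_zero) |>.mp this
    linear_combination this

theorem count_no_real (K : IntermediateField ℚ ℂ) [FiniteDimensional ℚ K] (a b : K)
    (h2 : Module.finrank ℚ K = 2) (hr : IsEmpty (↥K →+* ℝ)) :
    Nat.card {σ : ↥K →+* ℝ // ¬(σ a < 0 ∧ σ b < 0)} +
        Nat.card {σ : ↥K →+* ℂ // ∃ x : ↥K, (σ x).im ≠ 0} / 2 ≤ 1 := by
  have : NumberField K := ⟨⟩
  obtain ⟨h1, -, -⟩ := emb_count K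
  have e1 : Nat.card (↥K →+* ℝ) = 0 := Nat.card_of_isEmpty
  have e2 : Nat.card {σ : ↥K →+* ℝ // ¬(σ a < 0 ∧ σ b < 0)} = 0 := Nat.card_of_isEmpty
  omega

theorem count_bot (K : IntermediateField ℚ ℂ) [FiniteDimensional ℚ K] (a b : K)
    (hK : K = ⊥) :
    Nat.card {σ : ↥K →+* ℝ // ¬(σ a < 0 ∧ σ b < 0)} +
        Nat.card {σ : ↥K →+* ℂ // ∃ x : ↥K, (σ x).im ≠ 0} / 2 ≤ 1 := by
  have : NumberField K := ⟨⟩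
  obtain ⟨h1, -, h3⟩ := emb_count K
  have hf : Module.finrank ℚ K = 1 := IntermediateField.finrank_eq_one_iff.mpr hK
  have e2 : Nat.card {σ : ↥K →+* ℝ // ¬(σ a < 0 ∧ σ b < 0)} ≤ Nat.card (↥K →+* ℝ) :=
    Nat.card_le_card_of_injective _ Subtype.val_injective
  omega

end Backward

/-- Classification of the noncommutative Schur algebras of
Kleinian type: for a number field `K ⊆ ℂ` and a quaternion algebra
`A = (a,b/K)`, the conditions (i) `A` is a Schur algebra (generated over `K` by a
finite subgroup of `Aˣ`) and (ii) `A` ramifies at all but at most one infinite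
place of `K`, hold simultaneously iff `A` is `K`-isomorphic to one of:
(1) `M₂(K)` with `K = ℚ` or imaginary quadratic; (2) `(−1,−1/K)` with
`K = ℚ(√d)`, `d` squarefree negative, `d ≡ 1 (mod 8)`; (3) `(−1,−3/K)` with
`K = ℚ(√d)`, `d` squarefree negative, `d ≡ 1 (mod 3)`; (4) `(λ_n²,−1/K)` with
`n ≥ 3`, `η_n ∈ K`, and `K` having at least one real embedding and at most one
pair of conjugate non-real embeddings. -/
theorem schur_algebras_of_kleinian_type_classification
    (K : IntermediateField ℚ ℂ) [FiniteDimensional ℚ K]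
    (a b : K) (ha : a ≠ 0) (hb : b ≠ 0) :
    ((∃ G : Subgroup (ℍ[↥K, a, b])ˣ, Finite G ∧
        Algebra.adjoin ↥K (Units.val '' (G : Set (ℍ[↥K, a, b])ˣ)) = ⊤) ∧
      Nat.card {σ : ↥K →+* ℝ // ¬(σ a < 0 ∧ σ b < 0)} +
        Nat.card {σ : ↥K →+* ℂ // ∃ x : ↥K, (σ x).im ≠ 0} / 2 ≤ 1) ↔
    (((K = ⊥ ∨ (Module.finrank ℚ K = 2 ∧ IsEmpty (↥K →+* ℝ))) ∧
        Nonempty (ℍ[↥K, a, b] ≃ₐ[↥K] Matrix (Fin 2) (Fin 2) ↥K)) ∨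
      ((∃ d : ℤ, Squarefree d ∧ d < 0 ∧ d % 8 = 1 ∧ Module.finrank ℚ K = 2 ∧
          ∃ α : K, α ^ 2 = (d : K)) ∧
        Nonempty (ℍ[↥K, a, b] ≃ₐ[↥K] ℍ[↥K, -1, -1])) ∨
      ((∃ d : ℤ, Squarefree d ∧ d < 0 ∧ d % 3 = 1 ∧ Module.finrank ℚ K = 2 ∧
          ∃ α : K, α ^ 2 = (d : K)) ∧
        Nonempty (ℍ[↥K, a, b] ≃ₐ[↥K] ℍ[↥K, -1, -3])) ∨
      (∃ n : ℕ, 3 ≤ n ∧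
        ∃ η lamSq : K,
          (η : ℂ) = Complex.exp (2 * Real.pi * Complex.I / n) +
            (Complex.exp (2 * Real.pi * Complex.I / n))⁻¹ ∧
          (lamSq : ℂ) = (Complex.exp (2 * Real.pi * Complex.I / n) -
            (Complex.exp (2 * Real.pi * Complex.I / n))⁻¹) ^ 2 ∧
          Nonempty (↥K →+* ℝ) ∧
          Nat.card {σ : ↥K →+* ℂ // ∃ x : ↥K, (σ x).im ≠ 0} / 2 ≤ 1 ∧
          Nonempty (ℍ[↥K, a, b] ≃ₐ[↥K] ℍ[↥K, lamSq, -1]))) := by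
  have : NumberField K := ⟨⟩
  constructor
  · rintro ⟨⟨G, hG, hadj⟩, hcount⟩
    have hnc := noncomm_of_adjoin G hadj
    by_cases hdiv : ∀ x : ℍ[↥K,a,b], qnorm x = 0 → x = 0
    · by_cases hr : Nonempty (↥K →+* ℝ)
      · obtain ⟨σ⟩ := hr
        obtain ⟨n, hn, η, l, h1, h2, h3⟩ := real_case K a b ha hb σ hdiv G hnc
        exact Or.inr (Or.inr (Or.inr ⟨n, hn, η, l, h1, h2, ⟨σ⟩, by omega, h3⟩))
      · rw [not_nonempty_iff] at hr
        have h2 : Module.finrank ℚ K = 2 := by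
          obtain ⟨h1, ⟨c, hc⟩, -⟩ := emb_count K
          have e1 : Nat.card (↥K →+* ℝ) = 0 := Nat.card_of_isEmpty
          have hpos : 0 < Module.finrank ℚ K := Module.finrank_pos
          omega
        rcases imag_quad_case K a b ha hb h2 hr hdiv G hnc with h | h
        · exact Or.inr (Or.inl h)
        · exact Or.inr (Or.inr (Or.inl h))
    · left
      exact ⟨split_case K a b hdiv hcount, (quat_dichotomy ha hb).resolve_right hdiv⟩
  · rintro (⟨hK, ⟨e⟩⟩ | ⟨⟨d, _, hd, _, h2, α, hα⟩, ⟨e⟩⟩ | ⟨⟨d, _, hd, _, h2, α, hα⟩, ⟨e⟩⟩ |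
      ⟨n, hn, η, l, hη, hl, ⟨σ0⟩, hc, ⟨e⟩⟩)
    · refine ⟨schur_equiv e schur_matrix, ?_⟩
      rcases hK with hK | ⟨h2, hr⟩
      · exact count_bot K a b hK
      · exact count_no_real K a b h2 hr
    · exact ⟨schur_equiv e (schur_neg_one (-1) (by norm_num)),
        count_no_real K a b h2 (no_real_of_sq_neg d hd α hα)⟩
    · exact ⟨schur_equiv e schur_neg_three,
        count_no_real K a b h2 (no_real_of_sq_neg d hd α hα)⟩
    · obtain ⟨hdvd, h4⟩ := cyclo_dvd K n hn η hη
      have hl' : l = η ^ 2 - 4 := by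
        apply (algebraMap K ℂ).injective
        rw [map_sub, map_pow, map_ofNat]
        change (l : ℂ) = (η : ℂ) ^ 2 - 4
        rw [hl, hη]
        have h0 := Complex.exp_ne_zero (2 * Real.pi * Complex.I / n)
        field_simp
        ring
      refine ⟨schur_equiv e (schur_cyclo η l hl' n (by omega) hdvd), ?_⟩
      have hem : IsEmpty {σ : ↥K →+* ℝ // ¬(σ a < 0 ∧ σ b < 0)} := by
        refine ⟨fun σ => σ.2 ?_⟩
        apply ram_iso e
        · rw [hl']; exact real_place_neg η h4 n (by omega) hdvd σ.1
        · simp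
      have e2 : Nat.card {σ : ↥K →+* ℝ // ¬(σ a < 0 ∧ σ b < 0)} = 0 := Nat.card_of_isEmpty
      omega
end

section
/- Let d be a squarefree negative integer with d ≢ 1 (mod 8), K = ℚ(√d), and R an order in K. Assume that the group SL₂(ℤ[√d]) is virtually free-by-free. Let G = Q8 × A with A a finite elementary abelian 2-group. Then the group of units RG* of the group ring RG is virtually a direct product of finitely many free-by-free groups. -/
/-- An order in a finite-dimensional `ℚ`-algebra `A`: a subring that is finitely
generated as a `ℤ`-module and whose `ℚ`-span is all of `A`. -/
def IsOrderIn {A : Type} [Ring A] [Algebra ℚ A] (S : Subring A) : Prop :=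
  S.toAddSubgroup.FG ∧ Submodule.span ℚ (S : Set A) = ⊤

/-- A group is free-by-free if it has a (normal) subgroup which is free, namely the
kernel of a surjection onto a free group, with free quotient. -/
def IsFreeByFree (Γ : Type) [Group Γ] : Prop :=
  ∃ (Y : Type) (φ : Γ →* FreeGroup Y), Function.Surjective φ ∧
    ∃ X : Type, Nonempty (↥φ.ker ≃* FreeGroup X)

/-- A group is virtually free-by-free if it has a finite-index subgroup that is
free-by-free. -/
def IsVirtuallyFreeByFree (Γ : Type) [Group Γ] : Prop :=
  ∃ H : Subgroup Γ, H.FiniteIndex ∧ IsFreeByFree ↥H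

/-- A group is virtually a direct product of finitely many free-by-free groups if
it has a finite-index subgroup isomorphic to a finite direct product of
free-by-free groups. -/
def IsVirtuallyDirectProductOfFreeByFree (Γ : Type) [Group Γ] : Prop :=
  ∃ H : Subgroup Γ, H.FiniteIndex ∧
    ∃ (m : ℕ) (P : Fin m → Type) (inst : ∀ i, Group (P i)),
      haveI := inst
      (∀ i, IsFreeByFree (P i)) ∧ Nonempty (↥H ≃* ∀ i, P i)


theorem freeGroup_of_injective {G : Type} [Group G] {X : Type} (f : G →* FreeGroup X)
    (hf : Function.Injective f) : ∃ Y : Type, Nonempty (G ≃* FreeGroup Y) :=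
  ⟨_, ⟨(MonoidHom.ofInjective hf).trans (IsFreeGroup.toFreeGroup f.range)⟩⟩

theorem IsFreeByFree.of_injective {G Γ : Type} [Group G] [Group Γ] (h : IsFreeByFree Γ)
    (f : G →* Γ) (hf : Function.Injective f) : IsFreeByFree G := by
  obtain ⟨Y, φ, hφ, X, ⟨e⟩⟩ := h
  let ψ : G →* FreeGroup Y := φ.comp f
  let e' := IsFreeGroup.toFreeGroup ψ.range
  refine ⟨_, e'.toMonoidHom.comp ψ.rangeRestrict, ?_, ?_⟩
  · exact e'.surjective.comp ψ.rangeRestrict_surjective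
  · have hk : ∀ g ∈ (e'.toMonoidHom.comp ψ.rangeRestrict).ker, f g ∈ φ.ker := by
      intro g hg
      rw [MonoidHom.mem_ker] at hg ⊢
      have h1 : ψ.rangeRestrict g = 1 := by
        apply e'.injective
        simpa using hg
      exact congrArg Subtype.val h1
    let k : (e'.toMonoidHom.comp ψ.rangeRestrict).ker →* φ.ker :=
      (f.comp (Subgroup.subtype _)).codRestrict φ.ker (fun g => hk g g.2)
    apply freeGroup_of_injective (e.toMonoidHom.comp k)
    apply e.injective.comp
    intro a b hab
    apply Subtype.ext
    apply hf
    exact congrArg Subtype.val hab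

theorem isFreeByFree_of_subsingleton (G : Type) [Group G] [Subsingleton G] : IsFreeByFree G := by
  refine ⟨Empty, 1, fun y => ⟨1, Subsingleton.elim _ _⟩, Empty, ?_⟩
  exact ⟨{ toFun := fun _ => 1, invFun := fun _ => 1, left_inv := fun _ => Subsingleton.elim _ _,
           right_inv := fun _ => Subsingleton.elim _ _, map_mul' := fun _ _ => by simp }⟩

theorem finiteIndex_comap {G Γ : Type} [Group G] [Group Γ] (f : G →* Γ) (H : Subgroup Γ)
    [H.FiniteIndex] : (H.comap f).FiniteIndex := by
  constructor
  rw [Subgroup.index_comap]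
  exact (Subgroup.isFiniteRelIndex_of_finiteIndex (H := H) (K := f.range)).relIndex_ne_zero

theorem IsVirtuallyFreeByFree.of_injective {G Γ : Type} [Group G] [Group Γ]
    (h : IsVirtuallyFreeByFree Γ) (f : G →* Γ) (hf : Function.Injective f) :
    IsVirtuallyFreeByFree G := by
  obtain ⟨H, hH, hfr⟩ := h
  refine ⟨H.comap f, finiteIndex_comap f H, hfr.of_injective
    ((f.comp (Subgroup.subtype _)).codRestrict H (fun g => g.2)) ?_⟩
  intro a b hab
  apply Subtype.ext
  apply hf
  exact congrArg Subtype.val hab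

theorem IsVirtuallyFreeByFree.of_finiteIndex {G : Type} [Group G] (H : Subgroup G)
    (hH : H.FiniteIndex) (h : IsVirtuallyFreeByFree H) : IsVirtuallyFreeByFree G := by
  obtain ⟨L, hL, hfr⟩ := h
  refine ⟨L.map H.subtype, ?_, hfr.of_injective
    (L.equivMapOfInjective H.subtype H.subtype_injective).symm.toMonoidHom
    (MulEquiv.injective _)⟩
  constructor
  rw [Subgroup.index_map_subtype]
  exact mul_ne_zero hL.index_ne_zero hH.index_ne_zero

theorem IsVirtuallyFreeByFree.finite_prod {F V : Type} [Group F] [Group V] [Finite F]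
    (h : IsVirtuallyFreeByFree V) : IsVirtuallyFreeByFree (F × V) := by
  have hfi : (MonoidHom.fst F V).ker.FiniteIndex := inferInstance
  refine IsVirtuallyFreeByFree.of_finiteIndex _ hfi
    (h.of_injective ((MonoidHom.snd F V).comp (Subgroup.subtype _)) ?_)
  intro a b hab
  apply Subtype.ext
  apply Prod.ext
  · exact (a.2 : (a : F × V).1 = 1).trans (b.2 : (b : F × V).1 = 1).symm
  · exact hab

theorem virtually_product {G V ι : Type} [Group G] [Group V] [Finite ι]
    (hV : IsVirtuallyFreeByFree V) (f : G →* (ι → V)) (hf : Function.Injective f)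
    (hfi : f.range.FiniteIndex) : IsVirtuallyDirectProductOfFreeByFree G := by
  classical
  obtain ⟨n, ⟨e⟩⟩ := Finite.exists_equiv_fin ι
  obtain ⟨H, hH, hfr⟩ := hV
  let N : ι → Subgroup V := fun i => H ⊓ f.range.comap (MonoidHom.mulSingle (fun _ => V) i)
  have hN : ∀ i, (N i).FiniteIndex := fun i => by
    have := finiteIndex_comap (MonoidHom.mulSingle (fun _ : ι => V) i) f.range
    exact inferInstanceAs (Subgroup.FiniteIndex (_ ⊓ _))
  let L : Subgroup (ι → V) := ⨅ i, (N i).comap (Pi.evalMonoidHom (fun _ => V) i)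
  have hL : L.FiniteIndex := Subgroup.finiteIndex_iInf (fun i => by
    have := hN i
    exact finiteIndex_comap _ _)
  have memL : ∀ x : ι → V, x ∈ L ↔ ∀ i, x i ∈ N i := fun x => by
    simp [L, Subgroup.mem_iInf]
  have hLr : ∀ x ∈ L, x ∈ f.range := by
    intro x hx
    apply Subgroup.pi_mem_of_mulSingle_mem
    intro i
    exact ((memL x).1 hx i).2
  refine ⟨L.comap f, finiteIndex_comap f L, n, fun j => N (e.symm j), fun j => inferInstance,
    fun j => hfr.of_injective (Subgroup.inclusion inf_le_left) (Subgroup.inclusion_injective _), ?_⟩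
  let F : L.comap f →* ∀ j : Fin n, N (e.symm j) :=
    { toFun := fun g j => ⟨f g (e.symm j), (memL _).1 g.2 _⟩
      map_one' := by
        funext j; apply Subtype.ext; simp
      map_mul' := fun a b => by
        funext j; apply Subtype.ext; simp }
  refine ⟨MulEquiv.ofBijective F ⟨?_, ?_⟩⟩
  · intro a b hab
    apply Subtype.ext
    apply hf
    funext i
    have := congrArg Subtype.val (congrFun hab (e i))
    simpa [F] using this
  · intro y
    let x : ι → V := fun i => y (e i)
    have hx : x ∈ L := (memL x).2 (fun i => by
      have := (y (e i)).2
      simpa using this)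
    obtain ⟨g, hg⟩ := hLr x hx
    refine ⟨⟨g, by rw [Subgroup.mem_comap, hg]; exact hx⟩, ?_⟩
    funext j
    apply Subtype.ext
    simp only [F, MonoidHom.coe_mk, OneHom.coe_mk, hg, x]
    rw [e.apply_symm_apply]

/-- A principal congruence condition defines a finite index subgroup of the unit group. -/
theorem units_finiteIndex {T : Type} [Ring T] [Module.Finite ℤ T] (N : ℕ) (hN : N ≠ 0)
    (H : Subgroup Tˣ) (hH : ∀ w : Tˣ, (∃ t : T, (w : T) = 1 + N • t) → w ∈ H) :
    H.FiniteIndex := by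
  let W : Submodule ℤ T := LinearMap.range (LinearMap.lsmul ℤ T (N : ℤ))
  have hfin : Finite (T ⧸ W) := by
    apply Module.finite_of_fg_torsion
    intro x
    refine ⟨⟨(N : ℤ), by simp [hN]⟩, ?_⟩
    obtain ⟨x, rfl⟩ := Submodule.Quotient.mk_surjective _ x
    change (N : ℤ) • (Submodule.Quotient.mk x : T ⧸ W) = 0
    rw [← Submodule.Quotient.mk_smul, Submodule.Quotient.mk_eq_zero]
    exact ⟨x, rfl⟩
  rw [Subgroup.finiteIndex_iff_finite_quotient]
  let g : Tˣ ⧸ H → T ⧸ W := fun x => Submodule.Quotient.mk (((Quotient.out x)⁻¹ : Tˣ) : T)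
  apply Finite.of_injective g
  intro x y hxy
  have h1 := (Submodule.Quotient.eq W).1 hxy
  obtain ⟨t, ht⟩ := h1
  rw [← Quotient.out_eq x, ← Quotient.out_eq y]
  apply QuotientGroup.eq.2
  generalize Quotient.out x = u at *
  generalize Quotient.out y = v at *
  apply hH
  refine ⟨t * v, ?_⟩
  have h2 : ((u⁻¹ : Tˣ) : T) = ((v⁻¹ : Tˣ) : T) + N • t := by
    have h3 : (N : ℤ) • t = ((u⁻¹ : Tˣ) : T) - ((v⁻¹ : Tˣ) : T) := ht
    rw [← natCast_zsmul, h3]; abel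
  rw [Units.val_mul, h2, add_mul, Units.inv_mul, smul_mul_assoc]

theorem units_embed {S T E : Type} [Ring S] [Ring T] [Ring E] [Module.Finite ℤ S]
    (ρ : S →+* E) (hρ : Function.Injective ρ) (ψ : T →+* E) (hψ : Function.Injective ψ)
    (hden : ∀ s : S, ∃ n : ℕ, n ≠ 0 ∧ n • ρ s ∈ ψ.range) :
    ∃ H : Subgroup Sˣ, H.FiniteIndex ∧ ∃ f : H →* Tˣ, Function.Injective f := by
  obtain ⟨N, hN, hNs⟩ : ∃ N : ℕ, N ≠ 0 ∧ ∀ s : S, N • ρ s ∈ ψ.range := by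
    let W : Submodule ℤ S := (AddSubgroup.toIntSubmodule
      (ψ.range.toAddSubgroup.comap ρ.toAddMonoidHom))
    have memW : ∀ s, s ∈ W ↔ ρ s ∈ ψ.range := fun s => Iff.rfl
    have hfin : Finite (S ⧸ W) := by
      apply Module.finite_of_fg_torsion
      intro x
      obtain ⟨x, rfl⟩ := Submodule.Quotient.mk_surjective _ x
      obtain ⟨n, hn, hx⟩ := hden x
      refine ⟨⟨(n : ℤ), by simp [hn]⟩, ?_⟩
      change (n : ℤ) • (Submodule.Quotient.mk x : S ⧸ W) = 0
      rw [← Submodule.Quotient.mk_smul, Submodule.Quotient.mk_eq_zero, memW, natCast_zsmul,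
        map_nsmul]
      exact hx
    refine ⟨Nat.card (S ⧸ W), Nat.card_pos.ne', fun s => ?_⟩
    rw [← map_nsmul, ← memW, ← Submodule.Quotient.mk_eq_zero, Submodule.Quotient.mk_smul]
    exact card_nsmul_eq_zero'
  let U : Subgroup Eˣ := (Units.map ψ.toMonoidHom).range
  have hinj : Function.Injective (Units.map ψ.toMonoidHom) := Units.map_injective hψ
  have hinjρ : Function.Injective (Units.map ρ.toMonoidHom) := Units.map_injective hρ
  let H : Subgroup Sˣ := U.comap (Units.map ρ.toMonoidHom)
  refine ⟨H, ?_, (MonoidHom.ofInjective hinj).symm.toMonoidHom.comp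
    (((Units.map ρ.toMonoidHom).comp H.subtype).codRestrict U (fun g => g.2)), ?_⟩
  · apply units_finiteIndex N hN
    rintro w ⟨t, ht⟩
    have h1 : ρ w ∈ ψ.range := by
      rw [ht, map_add, map_one, map_nsmul]
      exact add_mem (one_mem _) (hNs t)
    have h2 : ρ ((w⁻¹ : Sˣ) : S) ∈ ψ.range := by
      have : ((w⁻¹ : Sˣ) : S) = 1 - N • (((w⁻¹ : Sˣ) : S) * t) := by
        have h3 : ((w⁻¹ : Sˣ) : S) * w = 1 := Units.inv_mul w
        rw [ht, mul_add, mul_one, mul_smul_comm] at h3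
        rw [← h3]; abel
      rw [this, map_sub, map_one, map_nsmul]
      exact sub_mem (one_mem _) (hNs _)
    obtain ⟨a, ha⟩ := h1
    obtain ⟨b, hb⟩ := h2
    refine ⟨⟨a, b, ?_, ?_⟩, ?_⟩
    · apply hψ
      rw [map_mul, ha, hb, ← map_mul, Units.mul_inv, map_one, map_one]
    · apply hψ
      rw [map_mul, ha, hb, ← map_mul, Units.inv_mul, map_one, map_one]
    · ext
      exact ha
  · refine (MonoidHom.ofInjective hinj).symm.injective.comp ?_
    intro a b hab
    apply Subtype.ext
    apply hinjρ
    exact congrArg Subtype.val hab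

/-- pigeonhole part -/
theorem legendre_pigeonhole (D q : ℤ) (hD : 0 < D) (hq : 0 < q) (hcop : IsCoprime D q)
    (hqs : ∀ w : ℤ, w ^ 2 ≠ q) (r s : ℤ) (hr : D ∣ r ^ 2 + q) (hs : q ∣ s ^ 2 - D) :
    ∃ z t w : ℤ, w ≠ 0 ∧ z ^ 2 + q * t ^ 2 = D * w ^ 2 := by
  obtain ⟨D, rfl⟩ := Int.eq_ofNat_of_zero_le hD.le
  obtain ⟨q, rfl⟩ := Int.eq_ofNat_of_zero_le hq.le
  have : NeZero D := ⟨by rintro rfl; simp at hD⟩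
  have : NeZero q := ⟨by rintro rfl; simp at hq⟩
  let f : ℕ × ℕ × ℕ → ZMod D × ZMod q := fun p =>
    (((p.1 : ℤ) - r * p.2.1 : ℤ), ((p.1 : ℤ) - s * p.2.2 : ℤ))
  let B := Finset.range (Nat.sqrt (D * q) + 1) ×ˢ Finset.range (Nat.sqrt D + 1) ×ˢ
    Finset.range (Nat.sqrt q + 1)
  have hcard : (Finset.univ : Finset (ZMod D × ZMod q)).card < B.card := by
    simp only [B, Finset.card_product, Finset.card_range, Finset.card_univ, Fintype.card_prod,
      ZMod.card]
    have h1 := Nat.lt_succ_sqrt (D * q)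
    have h2 := Nat.lt_succ_sqrt D
    have h3 := Nat.lt_succ_sqrt q
    simp only [Nat.succ_eq_add_one] at h1 h2 h3
    set a := Nat.sqrt (D * q) + 1
    set b := Nat.sqrt D + 1
    set c := Nat.sqrt q + 1
    have h4 : D * q < (b * b) * (c * c) := Nat.mul_lt_mul'' h2 h3
    have h5 : (D * q) * (D * q) < (a * a) * ((b * b) * (c * c)) := Nat.mul_lt_mul'' h1 h4
    by_contra hcon
    push Not at hcon
    have := Nat.mul_le_mul hcon hcon
    nlinarith
  obtain ⟨x, hx, y, hy, hxy, hf⟩ := Finset.exists_ne_map_eq_of_card_lt_of_maps_to hcard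
    (f := f) (fun _ _ => Finset.mem_univ _)
  obtain ⟨z1, t1, w1⟩ := x
  obtain ⟨z2, t2, w2⟩ := y
  simp only [B, Finset.mem_product, Finset.mem_range, Nat.lt_succ_iff] at hx hy
  obtain ⟨hx1, hx2, hx3⟩ := hx
  obtain ⟨hy1, hy2, hy3⟩ := hy
  simp only [f, Prod.mk.injEq] at hf
  obtain ⟨hf1, hf2⟩ := hf
  rw [ZMod.intCast_eq_intCast_iff_dvd_sub] at hf1 hf2
  have bd : ∀ n a b : ℕ, a ≤ Nat.sqrt n → b ≤ Nat.sqrt n → ((a : ℤ) - b) ^ 2 ≤ n := by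
    intro n a b ha hb
    have h1 : ((Nat.sqrt n : ℤ)) * (Nat.sqrt n) ≤ n := by exact_mod_cast Nat.sqrt_le n
    have ha' : (a : ℤ) ≤ Nat.sqrt n := by exact_mod_cast ha
    have hb' : (b : ℤ) ≤ Nat.sqrt n := by exact_mod_cast hb
    have : ((a : ℤ) - b) ^ 2 ≤ (Nat.sqrt n : ℤ) ^ 2 := by
      apply sq_le_sq'
      · have : (0:ℤ) ≤ a := by positivity
        linarith
      · have : (0:ℤ) ≤ b := by positivity
        linarith
    linarith [sq (Nat.sqrt n : ℤ)]
  have bz := bd _ _ _ hx1 hy1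
  have bt := bd _ _ _ hx2 hy2
  have bw := bd _ _ _ hx3 hy3
  obtain ⟨z, hz⟩ : ∃ z : ℤ, z = (z1 : ℤ) - z2 := ⟨_, rfl⟩
  obtain ⟨t, ht⟩ : ∃ z : ℤ, z = (t1 : ℤ) - t2 := ⟨_, rfl⟩
  obtain ⟨w, hw⟩ : ∃ z : ℤ, z = (w1 : ℤ) - w2 := ⟨_, rfl⟩
  have hne : ¬ (z = 0 ∧ t = 0 ∧ w = 0) := by
    rintro ⟨h1, h2, h3⟩
    apply hxy
    simp only [Prod.mk.injEq]
    omega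
  have d1 : (D : ℤ) ∣ z - r * t := by
    rw [← dvd_neg]
    have : -(z - r * t) = z2 - r * t2 - (z1 - r * t1) := by rw [hz, ht]; ring
    rwa [this]
  have d2 : (q : ℤ) ∣ z - s * w := by
    rw [← dvd_neg]
    have : -(z - s * w) = z2 - s * w2 - (z1 - s * w1) := by rw [hz, hw]; ring
    rwa [this]
  rw [← hz] at bz
  rw [← ht] at bt
  rw [← hw] at bw
  clear hz ht hw hf1 hf2 hxy
  have e1 : (D : ℤ) ∣ z ^ 2 + q * t ^ 2 - D * w ^ 2 := by
    have : z ^ 2 + q * t ^ 2 - D * w ^ 2 = (z - r * t) * (z + r * t) + (r ^ 2 + q) * t ^ 2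
      - D * w ^ 2 := by ring
    rw [this]
    exact ((d1.mul_right _).add (hr.mul_right _)).sub (dvd_mul_right _ _)
  have e2 : (q : ℤ) ∣ z ^ 2 + q * t ^ 2 - D * w ^ 2 := by
    have : z ^ 2 + q * t ^ 2 - D * w ^ 2 = (z - s * w) * (z + s * w) + (s ^ 2 - D) * w ^ 2
      + q * t ^ 2 := by ring
    rw [this]
    exact ((d2.mul_right _).add (hs.mul_right _)).add (dvd_mul_right _ _)
  obtain ⟨k, hk⟩ := hcop.mul_dvd e1 e2
  push_cast at bz
  generalize (D : ℤ) = D at *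
  generalize (q : ℤ) = q at *
  have hDq : 0 < D * q := mul_pos hD hq
  have k1 : -1 < k := by
    by_contra hcon
    have hk1 : k ≤ -1 := by omega
    have : w ^ 2 < q := lt_of_le_of_ne bw (hqs w)
    nlinarith [sq_nonneg z, sq_nonneg t]
  have k2 : k ≤ 2 := by
    by_contra hcon
    have hk1 : 3 ≤ k := by omega
    nlinarith [sq_nonneg w]
  have hcases : k = 0 ∨ k = 1 ∨ k = 2 := by omega
  rcases hcases with rfl | rfl | rfl
  · refine ⟨z, t, w, ?_, by linarith⟩
    rintro rfl
    apply hne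
    have h1 : z ^ 2 + q * t ^ 2 = 0 := by linarith
    have h2 : z ^ 2 = 0 := by nlinarith [sq_nonneg z, mul_nonneg hq.le (sq_nonneg t)]
    have h3 : q * t ^ 2 = 0 := by linarith
    refine ⟨by simpa using h2, ?_, rfl⟩
    rcases mul_eq_zero.1 h3 with h | h
    · omega
    · simpa using h
  · refine ⟨z * w - q * t, z + t * w, w ^ 2 + q, by nlinarith [sq_nonneg w], ?_⟩
    have h1 : z ^ 2 + q * t ^ 2 = D * (w ^ 2 + q) := by linarith
    calc _ = (z ^ 2 + q * t ^ 2) * (w ^ 2 + q) := by ring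
      _ = _ := by rw [h1]; ring
  · have : t ^ 2 = D := by
      have h1 : q * t ^ 2 ≥ q * D := by nlinarith [sq_nonneg w]
      exact le_antisymm bt (le_of_mul_le_mul_left h1 hq)
    exact ⟨t, 0, 1, one_ne_zero, by rw [this]; ring⟩

theorem three_squares_aux (D q : ℕ) (hD : 0 < D) (hq : q.Prime) (e : ℕ) (he : e = 1 ∨ e = 2)
    (hDe : Nat.Coprime D e) (hq4 : q % 4 = 1) (hr : (D : ℤ) ∣ 1 + (e * q : ℕ))
    (hJ : jacobiSym D q = 1) :
    ∃ a b c w : ℤ, w ≠ 0 ∧ a ^ 2 + b ^ 2 + c ^ 2 = D * w ^ 2 := by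
  have : Fact q.Prime := ⟨hq⟩
  have hcopq : Nat.Coprime D q := by
    rw [Nat.coprime_comm, Nat.Prime.coprime_iff_not_dvd hq]
    intro h
    have h2 : (q : ℤ) ∣ 1 + (e * q : ℕ) := (Int.natCast_dvd_natCast.2 h).trans hr
    push_cast at h2
    have h3 : (q : ℤ) ∣ 1 := (dvd_add_left (dvd_mul_left _ _)).1 h2
    have h4 := Int.natCast_dvd_natCast.1 (by exact_mod_cast h3 : (q : ℤ) ∣ ((1 : ℕ) : ℤ))
    exact hq.one_lt.ne' (Nat.dvd_one.1 h4)
  have hsq : IsSquare ((D : ℤ) : ZMod q) := by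
    rw [← jacobiSym.legendreSym.to_jacobiSym] at hJ
    rw [Int.cast_natCast]
    exact ((legendreSym.eq_one_iff' q (by
      intro h
      rw [ZMod.natCast_eq_zero_iff] at h
      exact (Nat.Prime.coprime_iff_not_dvd hq).1 hcopq.symm h)).1 hJ)
  obtain ⟨y, hy⟩ := hsq
  obtain ⟨s0, rfl⟩ := ZMod.intCast_surjective y
  have hs0 : (q : ℤ) ∣ s0 ^ 2 - D := by
    rw [← Int.cast_mul, ZMod.intCast_eq_intCast_iff_dvd_sub] at hy
    rwa [sq]
  obtain ⟨s, hs⟩ : ∃ s : ℤ, ((e * q : ℕ) : ℤ) ∣ s ^ 2 - D := by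
    rcases he with rfl | rfl
    · exact ⟨s0, by simpa using hs0⟩
    · have hDodd : D % 2 = 1 := Nat.odd_iff.1 ((Nat.coprime_two_right).1 hDe)
      have h2q : IsCoprime (2 : ℤ) q := by
        rw [show (2 : ℤ) = ((2 : ℕ) : ℤ) by rfl, Nat.isCoprime_iff_coprime, Nat.coprime_two_left,
          Nat.odd_iff]
        omega
      have key : ∀ s : ℤ, s % 2 = 1 → (q : ℤ) ∣ s ^ 2 - D → ((2 * q : ℕ) : ℤ) ∣ s ^ 2 - D := by
        intro s h1 h2
        push_cast
        apply h2q.mul_dvd _ h2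
        have : (s ^ 2) % 2 = 1 := by
          rw [sq, Int.mul_emod, h1]; rfl
        omega
      rcases Int.emod_two_eq_zero_or_one s0 with h | h
      · refine ⟨s0 + q, key _ (by omega) ?_⟩
        have : (s0 + q) ^ 2 - (D : ℤ) = (s0 ^ 2 - D) + q * (2 * s0 + q) := by ring
        rw [this]
        exact hs0.add (dvd_mul_right _ _)
      · exact ⟨s0, key _ h hs0⟩
  obtain ⟨u0, v0, huv⟩ := Nat.Prime.sq_add_sq (p := q) (by omega)
  obtain ⟨u, v, huv⟩ : ∃ u v : ℤ, u ^ 2 + v ^ 2 = (e * q : ℕ) := by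
    rcases he with rfl | rfl
    · exact ⟨u0, v0, by rw [← huv]; push_cast; ring⟩
    · exact ⟨u0 + v0, u0 - v0, by rw [← huv]; push_cast; ring⟩
  have hnsq : ∀ w : ℤ, w ^ 2 ≠ ((e * q : ℕ) : ℤ) := by
    intro w hw
    have h1 : (q : ℤ) ∣ w ^ 2 := by rw [hw]; push_cast; exact dvd_mul_left _ _
    have h2 : (q : ℤ) ∣ w := (Nat.prime_iff_prime_int.1 hq).dvd_of_dvd_pow h1
    obtain ⟨k, rfl⟩ := h2
    push_cast at hw
    have hq0 : (q : ℤ) ≠ 0 := by exact_mod_cast hq.ne_zero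
    have h3 : (q : ℤ) * k ^ 2 = e := by
      apply mul_right_cancel₀ hq0
      rw [← hw]; ring
    have h4 : (q : ℤ) ∣ e := ⟨_, h3.symm⟩
    have h5 := Nat.le_of_dvd (by omega) (Int.natCast_dvd_natCast.1 h4)
    have := hq.two_le
    omega
  obtain ⟨z, t, w, hw, h⟩ := legendre_pigeonhole D (e * q : ℕ) (by exact_mod_cast hD)
    (by have := hq.pos; rcases he with rfl | rfl <;> (push_cast; omega))
    (by rw [Nat.isCoprime_iff_coprime]; exact Nat.Coprime.mul_right hDe hcopq)
    hnsq 1 s (by simpa using hr) hs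
  exact ⟨z, u * t, v * t, w, hw, by rw [← h, ← huv]; ring⟩

theorem three_squares (D : ℕ) (hD : D % 4 ≠ 0) (hD7 : D % 8 ≠ 7) :
    ∃ a b c w : ℤ, w ≠ 0 ∧ a ^ 2 + b ^ 2 + c ^ 2 = D * w ^ 2 := by
  have hpos : 0 < D := by omega
  have dir : ∀ m n a b : ℕ, m ≠ 0 → n ≠ 0 → m.Coprime n → a.Coprime m → b.Coprime n →
      ∃ q : ℕ, q.Prime ∧ q % m = a % m ∧ q % n = b % n := by
    intro m n a b hm hn hmn ha hb
    obtain ⟨k, hk1, hk2⟩ := Nat.chineseRemainder hmn a b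
    have : NeZero (m * n) := ⟨by positivity⟩
    have hk : IsUnit ((k : ℕ) : ZMod (m * n)) := by
      rw [ZMod.isUnit_iff_coprime]
      apply Nat.Coprime.mul_right
      · rw [Nat.Coprime, hk1.gcd_eq]; exact ha
      · rw [Nat.Coprime, hk2.gcd_eq]; exact hb
    obtain ⟨q, -, hq, hqk⟩ := Nat.forall_exists_prime_gt_and_eq_mod hk 0
    rw [ZMod.natCast_eq_natCast_iff] at hqk
    exact ⟨q, hq, (hqk.of_mul_right n).trans hk1, (hqk.of_mul_left m).trans hk2⟩
  have Jneg : ∀ E q : ℕ, 0 < E → q % E = (E - 1) % E → jacobiSym q E = jacobiSym (-1) E := by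
    intro E q hE h
    apply jacobiSym.mod_left'
    have h1 : ((q % E : ℕ) : ℤ) = (((E - 1) % E : ℕ) : ℤ) := by rw [h]
    rw [Int.natCast_mod, Int.natCast_mod, Nat.cast_sub (by omega), Nat.cast_one] at h1
    rw [h1, Int.emod_emod_of_dvd _ dvd_rfl |>.symm]
    rw [Int.emod_eq_emod_iff_emod_sub_eq_zero]
    simp
  have dvdneg : ∀ E q : ℕ, 0 < E → q % E = (E - 1) % E → E ∣ 1 + q := by
    intro E q hE h
    have h2 : (q + 1) ≡ (E - 1 + 1) [MOD E] := Nat.ModEq.add_right 1 h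
    rw [Nat.sub_add_cancel hE] at h2
    rw [add_comm]
    exact (Nat.modEq_zero_iff_dvd.1 (h2.trans (by simp [Nat.ModEq])))
  have cop1 : ∀ E : ℕ, 0 < E → (E - 1).Coprime E := by
    intro E hE
    have := Nat.coprime_self_sub_left (m := 1) (n := E) (by omega)
    rw [this]; simp
  by_cases h2 : D % 2 = 1
  · have hodd : Odd D := Nat.odd_iff.2 h2
    have hc4 : D.Coprime 4 := by
      rw [show 4 = 2 ^ 2 by rfl]
      exact Nat.Coprime.pow_right 2 (Nat.coprime_two_right.2 hodd)
    by_cases h4 : D % 4 = 1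
    · obtain ⟨q, hq, hqD, hq4⟩ := dir D 4 (D - 1) 1 hpos.ne' (by norm_num) hc4 (cop1 D hpos)
        (by norm_num)
      refine three_squares_aux D q hpos hq 1 (Or.inl rfl) (by simp) (by omega) ?_ ?_
      · rw [one_mul]; exact_mod_cast dvdneg D q hpos hqD
      · rw [jacobiSym.quadratic_reciprocity_one_mod_four' hodd (by omega), Jneg D q hpos hqD,
          jacobiSym.at_neg_one hodd, ZMod.χ₄_nat_one_mod_four h4]
    · have h8 : D % 8 = 3 := by omega
      have hhalf : 2 * ((D - 1) / 2) = D - 1 := by omega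
      have hcp : ((D - 1) / 2).Coprime D := by
        have := cop1 D hpos
        rw [← hhalf] at this
        exact Nat.Coprime.coprime_mul_left this
      obtain ⟨q, hq, hqD, hq4⟩ := dir D 4 ((D - 1) / 2) 1 hpos.ne' (by norm_num) hc4 hcp
        (by norm_num)
      have hq2 : (2 * q) % D = (D - 1) % D := by
        rw [← hhalf]
        exact Nat.ModEq.mul_left 2 hqD
      refine three_squares_aux D q hpos hq 2 (Or.inr rfl) (Nat.coprime_two_right.2 hodd)
        (by omega) ?_ ?_
      · exact_mod_cast dvdneg D (2 * q) hpos hq2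
      · rw [jacobiSym.quadratic_reciprocity_one_mod_four' hodd (by omega)]
        have e1 := Jneg D (2 * q) hpos hq2
        have e2 : jacobiSym (-2) D = 1 := by
          rw [jacobiSym.at_neg_two hodd, ZMod.χ₈'_nat_eq_if_mod_eight]
          simp [h8, h2]
        have e3 : jacobiSym (-1) D = -1 := by
          rw [jacobiSym.at_neg_one hodd, ZMod.χ₄_nat_three_mod_four (by omega)]
        have e4 : jacobiSym 2 D = -1 := by
          have : (-2 : ℤ) = -1 * 2 := by norm_num
          rw [this, jacobiSym.mul_left, e3] at e2
          linarith
        push_cast at e1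
        rw [jacobiSym.mul_left, e4, e3] at e1
        linarith
  · obtain ⟨E, rfl⟩ : ∃ E, D = 2 * E := ⟨D / 2, by omega⟩
    have hE2 : E % 2 = 1 := by omega
    have hE : 0 < E := by omega
    have hodd : Odd E := Nat.odd_iff.2 hE2
    have hc8 : E.Coprime 8 := by
      rw [show 8 = 2 ^ 3 by rfl]
      exact Nat.Coprime.pow_right 3 (Nat.coprime_two_right.2 hodd)
    obtain ⟨c, hc, hcE⟩ : ∃ c : ℕ, (c = 1 ∨ c = 5) ∧ (c = 1 ↔ E % 4 = 1) := by
      by_cases h : E % 4 = 1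
      · exact ⟨1, by simp [h]⟩
      · exact ⟨5, by simp [h]⟩
    obtain ⟨q, hq, hqE, hq8⟩ := dir E 8 (E - 1) c hE.ne' (by norm_num) hc8 (cop1 E hE)
      (by rcases hc with rfl | rfl <;> norm_num)
    have hq4 : q % 4 = 1 := by omega
    have hqodd : Odd q := Nat.odd_iff.2 (by omega)
    refine three_squares_aux (2 * E) q hpos hq 1 (Or.inl rfl) (by simp) hq4 ?_ ?_
    · rw [one_mul]
      have d1 := dvdneg E q hE hqE
      have d2 : 2 ∣ 1 + q := by omega
      have := (Nat.coprime_two_left.2 hodd).mul_dvd_of_dvd_of_dvd d2 d1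
      exact_mod_cast this
    · push_cast
      rw [jacobiSym.mul_left, jacobiSym.quadratic_reciprocity_one_mod_four' hodd hq4,
        Jneg E q hE hqE, jacobiSym.at_neg_one hodd, jacobiSym.at_two hqodd,
        ZMod.χ₈_nat_eq_if_mod_eight]
      rcases hc with rfl | rfl
      · rw [ZMod.χ₄_nat_one_mod_four (by simpa using hcE)]
        have : q % 8 = 1 := by omega
        have h2 : q % 2 = 1 := by omega
        simp [this, h2]
      · rw [ZMod.χ₄_nat_three_mod_four (by omega)]
        have : q % 8 = 5 := by omega
        have h2 : q % 2 = 1 := by omega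
        simp [this, h2]

/-- `-1` is a sum of two squares in `K`. -/
theorem neg_one_sum_sq (d : ℤ) (hd : Squarefree d) (hdneg : d < 0) (hd8 : ¬d % 8 = 1)
    (K : Type) [Field K] [CharZero K] (α : K) (hα : α ^ 2 = (d : K)) :
    ∃ x y : K, x ^ 2 + y ^ 2 = -1 := by
  obtain ⟨D, hD⟩ := Int.eq_ofNat_of_zero_le (a := -d) (by omega)
  have h4 : D % 4 ≠ 0 := by
    intro h
    have : (2 * 2 : ℤ) ∣ d := by omega
    have := hd 2 this
    rw [Int.isUnit_iff] at this
    omega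
  obtain ⟨a, b, c, w, hw, h⟩ := three_squares D h4 (by omega)
  have hK : (a : K) ^ 2 + b ^ 2 + c ^ 2 + (α * w) ^ 2 = 0 := by
    rw [mul_pow, hα]
    have : (a : ℤ) ^ 2 + b ^ 2 + c ^ 2 + d * w ^ 2 = 0 := by
      rw [h, show d = -(D : ℤ) by omega]; ring
    exact_mod_cast this
  have hw' : (w : K) ≠ 0 := by exact_mod_cast hw
  have hα0 : α ≠ 0 := by
    rintro rfl
    have : (d : K) = 0 := by rw [← hα]; ring
    have : d = 0 := by exact_mod_cast this
    omega
  have hβ : α * w ≠ 0 := mul_ne_zero hα0 hw'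
  generalize α * w = β at hK hβ
  by_cases hz : (c : K) ^ 2 + β ^ 2 = 0
  · have hc : (c : K) ≠ 0 := by
      intro hc
      rw [hc] at hz
      apply hβ
      simpa using hz
    refine ⟨β / c, 0, ?_⟩
    field_simp
    linear_combination hz
  · refine ⟨(a * c - b * β) / (c ^ 2 + β ^ 2), (a * β + b * c) / (c ^ 2 + β ^ 2), ?_⟩
    field_simp
    linear_combination ((c : K) ^ 2 + β ^ 2) * hK

theorem zsqrtd_units_finite (d : ℤ) (hd : d < 0) : Finite (Zsqrtd d)ˣ := by
  let f : (Zsqrtd d)ˣ → Set.Icc (-1 : ℤ) 1 × Set.Icc (-1 : ℤ) 1 := fun u =>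
    have h := (Zsqrtd.norm_eq_one_iff' hd.le (u : Zsqrtd d)).2 u.isUnit
    have h' : (u : Zsqrtd d).re * (u : Zsqrtd d).re - d * (u : Zsqrtd d).im * (u : Zsqrtd d).im = 1 :=
      h
    have h2 : (u : Zsqrtd d).re ^ 2 + (u : Zsqrtd d).im ^ 2 ≤ 1 := by
      nlinarith [mul_nonneg (show 0 ≤ -d - 1 by omega) (sq_nonneg (u : Zsqrtd d).im)]
    (⟨(u : Zsqrtd d).re, by constructor <;> nlinarith [sq_nonneg (u : Zsqrtd d).im]⟩,
      ⟨(u : Zsqrtd d).im, by constructor <;> nlinarith [sq_nonneg (u : Zsqrtd d).re]⟩)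
  apply Finite.of_injective f
  intro u v huv
  ext
  · exact congrArg (fun p => (p.1 : ℤ)) huv
  · exact congrArg (fun p => (p.2 : ℤ)) huv

theorem gl_virtually (d : ℤ) (hd : d < 0)
    (hSL : IsVirtuallyFreeByFree (Matrix.SpecialLinearGroup (Fin 2) (Zsqrtd d))) :
    IsVirtuallyFreeByFree (Matrix (Fin 2) (Fin 2) (Zsqrtd d))ˣ := by
  have := zsqrtd_units_finite d hd
  let det : (Matrix (Fin 2) (Fin 2) (Zsqrtd d))ˣ →* (Zsqrtd d)ˣ := Units.map Matrix.detMonoidHom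
  have hfi : det.ker.FiniteIndex := inferInstance
  have hdet : ∀ g : det.ker, ((g : (Matrix (Fin 2) (Fin 2) (Zsqrtd d))ˣ) :
      Matrix (Fin 2) (Fin 2) (Zsqrtd d)).det = 1 := fun g => congrArg Units.val g.2
  refine IsVirtuallyFreeByFree.of_finiteIndex _ hfi (hSL.of_injective
    { toFun := fun g => ⟨_, hdet g⟩
      map_one' := Subtype.ext rfl
      map_mul' := fun _ _ => Subtype.ext rfl } ?_)
  intro a b hab
  apply Subtype.ext
  apply Units.ext
  exact congrArg Subtype.val hab

section field

variable (d : ℤ) (hdneg : d < 0) (K : Type) [Field K] [Algebra ℚ K]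
    (hrank : Module.finrank ℚ K = 2) (α : K) (hα : α ^ 2 = (d : K))

theorem exists_emb (hdneg : d < 0) (hrank : Module.finrank ℚ K = 2) (hα : α ^ 2 = (d : K)) :
    ∃ ψ : Zsqrtd d →+* K, Function.Injective ψ ∧
      ∀ x : K, ∃ n : ℕ, n ≠ 0 ∧ n • x ∈ ψ.range := by
  have : CharZero K := algebraRat.charZero K
  refine ⟨Zsqrtd.lift ⟨α, by rw [← sq, hα]⟩, Zsqrtd.lift_injective _ (fun n h => by nlinarith), ?_⟩
  have hfd : Module.Finite ℚ K := Module.finite_of_finrank_pos (by omega)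
  have hli : LinearIndependent ℚ ![(1 : K), α] := by
    rw [LinearIndependent.pair_iff]
    intro s t hst
    have h1 : (s : K) + t * α = 0 := by
      simpa [Algebra.smul_def] using hst
    have h2 : (s : K) ^ 2 = t ^ 2 * d := by
      rw [← hα]
      linear_combination (s - t * α) * h1
    have h3 : s ^ 2 = t ^ 2 * d := by exact_mod_cast h2
    have hd' : (d : ℚ) < 0 := by exact_mod_cast hdneg
    have ht : t ^ 2 = 0 := by nlinarith [sq_nonneg s, sq_nonneg t]
    have hs : s ^ 2 = 0 := by rw [h3, ht]; ring
    exact ⟨by simpa using hs, by simpa using ht⟩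
  have hspan := hli.span_eq_top_of_card_eq_finrank (by simp [hrank])
  intro x
  have hx : x ∈ Submodule.span ℚ (Set.range ![(1 : K), α]) := by rw [hspan]; trivial
  rw [Matrix.range_cons, Matrix.range_cons, Matrix.range_empty, Set.union_empty,
    Set.singleton_union, Submodule.mem_span_pair] at hx
  obtain ⟨p, q, rfl⟩ := hx
  refine ⟨p.den * q.den, mul_ne_zero p.den_nz q.den_nz, ⟨p.num * q.den, q.num * p.den⟩, ?_⟩
  have hp : (p : K) * p.den = p.num := by exact_mod_cast Rat.mul_den_eq_num p
  have hq : (q : K) * q.den = q.num := by exact_mod_cast Rat.mul_den_eq_num q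
  rw [Zsqrtd.lift_apply_apply]
  rw [nsmul_eq_mul]
  simp only [Algebra.smul_def, eq_ratCast]
  push_cast
  rw [← hp, ← hq]
  ring

theorem order_finite (R : Subring K) (hR : IsOrderIn R) : Module.Finite ℤ R := by
  rw [Module.Finite.iff_addGroup_fg]
  exact (AddGroup.fg_iff_addSubgroup_fg _).2 hR.1

theorem order_units_finite (hdneg : d < 0) (hrank : Module.finrank ℚ K = 2)
    (hα : α ^ 2 = (d : K)) (R : Subring K) (hR : IsOrderIn R) : Finite Rˣ := by
  have := order_finite K R hR
  obtain ⟨ψ, hψ, hden⟩ := exists_emb d K α hdneg hrank hα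
  obtain ⟨H, hH, f, hf⟩ := units_embed R.subtype R.subtype_injective ψ hψ (fun s => hden s)
  have := zsqrtd_units_finite d hdneg
  have : Finite H := Finite.of_injective f hf
  exact (Subgroup.finite_iff_finite_and_finiteIndex H).2 ⟨this, hH⟩

theorem quat_emb (R : Subring K) (x y : K) (hxy : x ^ 2 + y ^ 2 = -1) [CharZero K] :
    ∃ ρ : (QuaternionAlgebra R (-1) 0 (-1)) →+* Matrix (Fin 2) (Fin 2) K, Function.Injective ρ := by
  let B : QuaternionAlgebra.Basis (R := R) (Matrix (Fin 2) (Fin 2) K) (-1) 0 (-1) :=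
    { i := !![0, -1; 1, 0]
      j := !![x, y; y, -x]
      k := !![-y, x; x, y]
      i_mul_i := by
        ext a b; fin_cases a <;> fin_cases b <;> simp [Matrix.mul_apply, Fin.sum_univ_two]
      j_mul_j := by
        ext a b; fin_cases a <;> fin_cases b <;>
          simp [Matrix.mul_apply, Fin.sum_univ_two] <;>
          first | ring1 | linear_combination hxy
      i_mul_j := by
        ext a b; fin_cases a <;> fin_cases b <;> simp [Matrix.mul_apply, Fin.sum_univ_two]
      j_mul_i := by
        ext a b; fin_cases a <;> fin_cases b <;> simp [Matrix.mul_apply, Fin.sum_univ_two] }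
  refine ⟨B.liftHom.toRingHom, ?_⟩
  rw [injective_iff_map_eq_zero]
  intro q hq
  have h : B.lift q = 0 := hq
  rw [QuaternionAlgebra.Basis.lift] at h
  have h00 := congrFun (congrFun h 0) 0
  have h01 := congrFun (congrFun h 0) 1
  have h10 := congrFun (congrFun h 1) 0
  have h11 := congrFun (congrFun h 1) 1
  simp [B, Matrix.algebraMap_matrix_apply, Subring.smul_def] at h00 h01 h10 h11
  have hre : algebraMap R K q.re = (q.re : K) := rfl
  rw [hre] at h00 h11
  have e0 : (q.re : K) = 0 := by
    have : 2 * (q.re : K) = 0 := by linear_combination h00 + h11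
    simpa using this
  have e1 : (q.imI : K) = 0 := by
    have : 2 * (q.imI : K) = 0 := by linear_combination h10 - h01
    simpa using this
  have e2 : (q.imJ : K) = 0 := by
    rw [e0] at h00
    rw [e1] at h10
    linear_combination (-x) * h00 - y * h10 + (q.imJ : K) * hxy
  have e3 : (q.imK : K) = 0 := by
    rw [e0] at h00
    rw [e1] at h10
    linear_combination (y) * h00 - x * h10 + (q.imK : K) * hxy
  ext
  · exact_mod_cast e0
  · exact_mod_cast e1
  · exact_mod_cast e2
  · exact_mod_cast e3

theorem quat_virtually (hd : Squarefree d) (hd8 : ¬d % 8 = 1)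
    (hdneg : d < 0) (hrank : Module.finrank ℚ K = 2)
    (hα : α ^ 2 = (d : K)) (R : Subring K) (hR : IsOrderIn R)
    (hSL : IsVirtuallyFreeByFree (Matrix.SpecialLinearGroup (Fin 2) (Zsqrtd d))) :
    IsVirtuallyFreeByFree (QuaternionAlgebra R (-1) 0 (-1))ˣ := by
  have : CharZero K := algebraRat.charZero K
  obtain ⟨x, y, hxy⟩ := neg_one_sum_sq d hd hdneg hd8 K α hα
  obtain ⟨ρ, hρ⟩ := quat_emb K R x y hxy
  obtain ⟨ψ, hψ, hden⟩ := exists_emb d K α hdneg hrank hα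
  have := order_finite K R hR
  have hfin : Module.Finite ℤ (QuaternionAlgebra R (-1) 0 (-1)) := Module.Finite.trans R (QuaternionAlgebra R (-1) 0 (-1))
  have hden2 : ∀ M : Matrix (Fin 2) (Fin 2) K, ∃ n : ℕ, n ≠ 0 ∧ n • M ∈
      (ψ.mapMatrix (m := Fin 2)).range := by
    intro M
    choose n hn a ha using fun i j => hden (M i j)
    refine ⟨∏ i, ∏ j, n i j, ?_, ?_⟩
    · exact Finset.prod_ne_zero_iff.2 fun i _ => Finset.prod_ne_zero_iff.2 fun j _ => hn i j
    · have : ∀ i j, (∏ i, ∏ j, n i j) • M i j ∈ ψ.range := by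
        intro i j
        have hdvd : n i j ∣ ∏ i, ∏ j, n i j :=
          (Finset.dvd_prod_of_mem (fun j => n i j) (Finset.mem_univ j)).trans
            (Finset.dvd_prod_of_mem (fun i => ∏ j, n i j) (Finset.mem_univ i))
        obtain ⟨k, hk⟩ := hdvd
        rw [hk, mul_comm, mul_smul]
        exact nsmul_mem (ψ.mem_range.2 ⟨_, ha i j⟩) k
      choose b hb using this
      refine ⟨Matrix.of b, ?_⟩
      ext i j
      exact hb i j
  obtain ⟨H, hH, f, hf⟩ := units_embed ρ hρ (ψ.mapMatrix (m := Fin 2))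
    (Matrix.map_injective hψ) (fun s => hden2 _)
  exact IsVirtuallyFreeByFree.of_finiteIndex H hH ((gl_virtually d hdneg hSL).of_injective f hf)

end field

section groupalgebra

open QuaternionGroup

theorem q8_sum {M : Type} [AddCommMonoid M] (F : QuaternionGroup 2 → M) :
    ∑ g, F g = F (a 0) + (F (a 1) + (F (a 2) + (F (a 3) + (F (xa 0) + (F (xa 1) +
      (F (xa 2) + F (xa 3))))))) := by
  have h : (Finset.univ : Finset (QuaternionGroup 2)) =
      {a 0, a 1, a 2, a 3, xa 0, xa 1, xa 2, xa 3} := by decide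
  rw [h]
  rw [Finset.sum_insert (by decide), Finset.sum_insert (by decide), Finset.sum_insert (by decide),
    Finset.sum_insert (by decide), Finset.sum_insert (by decide), Finset.sum_insert (by decide),
    Finset.sum_insert (by decide), Finset.sum_singleton]

/-- The four linear characters of `Q₈`. -/
def q8chi (s t : ℤˣ) : QuaternionGroup 2 →* ℤˣ where
  toFun g := match g with
    | a k => s ^ k.val
    | xa k => t * s ^ k.val
  map_one' := by
    change s ^ (0 : ZMod (2 * 2)).val = 1
    simp
  map_mul' := by revert s t; decide

/-- Coordinates of the quaternion representation of `Q₈`. -/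
def q8c (n : Fin 4) (g : QuaternionGroup 2) : ℤ := match g with
  | a k => (![![1, 0, -1, 0], ![0, 1, 0, -1], ![0, 0, 0, 0], ![0, 0, 0, 0]] : Fin 4 → Fin 4 → ℤ) n k
  | xa k => (![![0, 0, 0, 0], ![0, 0, 0, 0], ![1, 0, -1, 0], ![0, -1, 0, 1]] :
      Fin 4 → Fin 4 → ℤ) n k

theorem q8c_mul : ∀ g h : QuaternionGroup 2,
    q8c 0 (g * h) = q8c 0 g * q8c 0 h - q8c 1 g * q8c 1 h - q8c 2 g * q8c 2 h - q8c 3 g * q8c 3 h ∧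
    q8c 1 (g * h) = q8c 0 g * q8c 1 h + q8c 1 g * q8c 0 h + q8c 2 g * q8c 3 h - q8c 3 g * q8c 2 h ∧
    q8c 2 (g * h) = q8c 0 g * q8c 2 h - q8c 1 g * q8c 3 h + q8c 2 g * q8c 0 h + q8c 3 g * q8c 1 h ∧
    q8c 3 (g * h) = q8c 0 g * q8c 3 h + q8c 1 g * q8c 2 h - q8c 2 g * q8c 1 h + q8c 3 g * q8c 0 h :=
  by decide

theorem q8c_vals :
    q8c 0 (a 0) = 1 ∧ q8c 0 (a 1) = 0 ∧ q8c 0 (a 2) = -1 ∧ q8c 0 (a 3) = 0 ∧ q8c 0 (xa 0) = 0 ∧ q8c 0 (xa 1) = 0 ∧ q8c 0 (xa 2) = 0 ∧ q8c 0 (xa 3) = 0 ∧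
    q8c 1 (a 0) = 0 ∧ q8c 1 (a 1) = 1 ∧ q8c 1 (a 2) = 0 ∧ q8c 1 (a 3) = -1 ∧ q8c 1 (xa 0) = 0 ∧ q8c 1 (xa 1) = 0 ∧ q8c 1 (xa 2) = 0 ∧ q8c 1 (xa 3) = 0 ∧
    q8c 2 (a 0) = 0 ∧ q8c 2 (a 1) = 0 ∧ q8c 2 (a 2) = 0 ∧ q8c 2 (a 3) = 0 ∧ q8c 2 (xa 0) = 1 ∧ q8c 2 (xa 1) = 0 ∧ q8c 2 (xa 2) = -1 ∧ q8c 2 (xa 3) = 0 ∧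
    q8c 3 (a 0) = 0 ∧ q8c 3 (a 1) = 0 ∧ q8c 3 (a 2) = 0 ∧ q8c 3 (a 3) = 0 ∧ q8c 3 (xa 0) = 0 ∧ q8c 3 (xa 1) = -1 ∧ q8c 3 (xa 2) = 0 ∧ q8c 3 (xa 3) = 1 := by
  decide

theorem q8chi_vals (s t : ℤˣ) :
    q8chi s t (a 0) = 1 ∧ q8chi s t (a 1) = s ∧ q8chi s t (a 2) = 1 ∧ q8chi s t (a 3) = s ∧ q8chi s t (xa 0) = t ∧ q8chi s t (xa 1) = t * s ∧ q8chi s t (xa 2) = t ∧ q8chi s t (xa 3) = t * s := by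
  revert s t
  decide

variable (R : Type) [CommRing R]

/-- The quaternion representation of `Q₈`. -/
def q8rho : QuaternionGroup 2 →* QuaternionAlgebra R (-1) 0 (-1) where
  toFun g := ⟨q8c 0 g, q8c 1 g, q8c 2 g, q8c 3 g⟩
  map_one' := by
    have h : q8c 0 1 = 1 ∧ q8c 1 1 = 0 ∧ q8c 2 1 = 0 ∧ q8c 3 1 = 0 := by decide
    ext <;> simp [h]
  map_mul' g h := by
    obtain ⟨h0, h1, h2, h3⟩ := q8c_mul g h
    ext
    · simp [h0] <;> ring
    · simp [h1] <;> ring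
    · simp [h2] <;> ring
    · simp [h3] <;> ring

/-- The embedding of `R Q₈` into `R⁴ × ℍ(R)`. -/
noncomputable def q8emb : MonoidAlgebra R (QuaternionGroup 2) →+*
    ((ℤˣ × ℤˣ) → R) × QuaternionAlgebra R (-1) 0 (-1) :=
  RingHom.prod
    (RingHom.pi fun p => (MonoidAlgebra.lift R R (QuaternionGroup 2)
      (((Int.castRingHom R).toMonoidHom.comp (Units.coeHom ℤ)).comp (q8chi p.1 p.2))).toRingHom)
    (MonoidAlgebra.lift R _ (QuaternionGroup 2) (q8rho R)).toRingHom

theorem q8emb_injective [IsDomain R] [CharZero R] : Function.Injective (q8emb R) := by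
  rw [injective_iff_map_eq_zero]
  intro f hf
  have h1 : ∀ s t : ℤˣ, ∑ g, f.coeff g * ((q8chi s t g : ℤ) : R) = 0 := by
    intro s t
    have h := congrFun (congrArg Prod.fst hf) (s, t)
    have h' : MonoidAlgebra.lift R R (QuaternionGroup 2)
      (((Int.castRingHom R).toMonoidHom.comp (Units.coeHom ℤ)).comp (q8chi s t)) f = 0 := h
    rw [MonoidAlgebra.lift_apply, Finsupp.sum_fintype _ _ (by simp)] at h'
    simpa using h'
  have h2 : ∑ g, f.coeff g • q8rho R g = 0 := by
    have h : MonoidAlgebra.lift R _ (QuaternionGroup 2) (q8rho R) f = 0 := congrArg Prod.snd hf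
    rwa [MonoidAlgebra.lift_apply, Finsupp.sum_fintype _ _ (by simp)] at h
  rw [q8_sum] at h2
  have hpp := h1 1 1
  have hpm := h1 1 (-1)
  have hmp := h1 (-1) 1
  have hmm := h1 (-1) (-1)
  rw [q8_sum] at hpp hpm hmp hmm
  simp only [q8chi_vals] at hpp hpm hmp hmm
  push_cast at hpp hpm hmp hmm
  have r0 := congrArg QuaternionAlgebra.re h2
  have r1 := congrArg QuaternionAlgebra.imI h2
  have r2 := congrArg QuaternionAlgebra.imJ h2
  have r3 := congrArg QuaternionAlgebra.imK h2
  simp only [q8rho, MonoidHom.coe_mk, OneHom.coe_mk, q8c_vals, QuaternionAlgebra.re_add,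
    QuaternionAlgebra.imI_add, QuaternionAlgebra.imJ_add, QuaternionAlgebra.imK_add,
    QuaternionAlgebra.re_smul, QuaternionAlgebra.imI_smul, QuaternionAlgebra.imJ_smul,
    QuaternionAlgebra.imK_smul, QuaternionAlgebra.re_zero, QuaternionAlgebra.imI_zero,
    QuaternionAlgebra.imJ_zero, QuaternionAlgebra.imK_zero, smul_eq_mul] at r0 r1 r2 r3
  push_cast at r0 r1 r2 r3
  have key : ∀ x : R, 8 * x = 0 → x = 0 := by
    intro x hx
    rcases mul_eq_zero.1 hx with h | h
    · norm_num at h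
    · exact h
  have c0 : f.coeff (a 0) = 0 := key _ (by linear_combination hpp + hpm + hmp + hmm + 4 * r0)
  have c2 : f.coeff (a 2) = 0 := key _ (by linear_combination hpp + hpm + hmp + hmm - 4 * r0)
  have c1 : f.coeff (a 1) = 0 := key _ (by linear_combination hpp + hpm - hmp - hmm + 4 * r1)
  have c3 : f.coeff (a 3) = 0 := key _ (by linear_combination hpp + hpm - hmp - hmm - 4 * r1)
  have x0 : f.coeff (xa 0) = 0 := key _ (by linear_combination hpp - hpm + hmp - hmm + 4 * r2)
  have x2 : f.coeff (xa 2) = 0 := key _ (by linear_combination hpp - hpm + hmp - hmm - 4 * r2)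
  have x1 : f.coeff (xa 1) = 0 := key _ (by linear_combination hpp - hpm - hmp + hmm - 4 * r3)
  have x3 : f.coeff (xa 3) = 0 := key _ (by linear_combination hpp - hpm - hmp + hmm + 4 * r3)
  have hall : ∀ g : QuaternionGroup 2, g = a 0 ∨ g = a 1 ∨ g = a 2 ∨ g = a 3 ∨ g = xa 0 ∨
      g = xa 1 ∨ g = xa 2 ∨ g = xa 3 := by decide
  ext g
  change f.coeff g = 0
  rcases hall g with h | h | h | h | h | h | h | h <;> rw [h] <;> assumption

end groupalgebra

section elementary

variable {A : Type} [CommGroup A] [Finite A]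

instance dual_finite : Finite (A →* ℤˣ) := DFunLike.finite _

theorem exists_char (hA : ∀ a : A, a ^ 2 = 1) (a : A) (ha : a ≠ 1) : ∃ χ : A →* ℤˣ, χ a ≠ 1 := by
  letI : Module (ZMod 2) (Additive A) := AddCommGroup.zmodModule (n := 2) (fun x => hA x.toMul)
  have h := (Module.forall_dual_apply_eq_zero_iff (ZMod 2) (Additive.ofMul a)).not.2 ha
  push Not at h
  obtain ⟨f, hf⟩ := h
  have key : ∀ x y : ZMod 2, (if x + y = 0 then (1 : ℤˣ) else -1) =
      (if x = 0 then 1 else -1) * (if y = 0 then 1 else -1) := by decide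
  refine ⟨{ toFun := fun b => if f (Additive.ofMul b) = 0 then 1 else -1
            map_one' := by simp
            map_mul' := fun b c => ?_ }, ?_⟩
  · rw [ofMul_mul, map_add]
    exact key _ _
  · change (if f (Additive.ofMul a) = 0 then (1 : ℤˣ) else -1) ≠ 1
    rw [if_neg hf]
    decide

/-- Integer-valued version of a sign character. -/
def sgnHom {B : Type} [Group B] (χ : B →* ℤˣ) : B →* ℤ := (Units.coeHom ℤ).comp χ

theorem sum_sgn {B : Type} [Group B] [Fintype B] (χ : B →* ℤˣ) (h : χ ≠ 1) :
    ∑ b, ((χ b : ℤˣ) : ℤ) = 0 := by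
  refine sum_hom_units_eq_zero (sgnHom χ) ?_
  intro h'
  apply h
  ext b
  exact DFunLike.congr_fun h' b

theorem unit_mul_eq_one {u v : ℤˣ} (h : u * v = 1) : u = v := by
  revert u v; decide

theorem orth_one [Fintype A] [DecidableEq (A →* ℤˣ)] (χ ψ : A →* ℤˣ) :
    ∑ a, ((χ a : ℤˣ) : ℤ) * ((ψ a : ℤˣ) : ℤ) = if χ = ψ then (Fintype.card A : ℤ) else 0 := by
  split_ifs with h
  · subst h
    simp [← Units.val_mul]
  · rw [← sum_sgn (χ * ψ) (fun h' => h ?_)]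
    · simp
    · ext a
      exact congrArg _ (unit_mul_eq_one (DFunLike.congr_fun h' a))

theorem orth_two (hA : ∀ a : A, a ^ 2 = 1) [Fintype (A →* ℤˣ)] [DecidableEq A] (a b : A) :
    ∑ χ : A →* ℤˣ, ((χ a : ℤˣ) : ℤ) * ((χ b : ℤˣ) : ℤ) =
      if a = b then (Fintype.card (A →* ℤˣ) : ℤ) else 0 := by
  split_ifs with h
  · subst h
    simp [← Units.val_mul]
  · have hab : a * b ≠ 1 := by
      intro h'
      apply h
      rw [mul_eq_one_iff_eq_inv] at h'
      rw [h', inv_eq_iff_mul_eq_one, ← sq, hA]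
    obtain ⟨χ, hχ⟩ := exists_char hA _ hab
    have := sum_sgn (MonoidHom.eval (M := A) (N := ℤˣ) (a * b)) (fun h' => hχ (DFunLike.congr_fun h' χ))
    rw [← this]
    simp

variable (R : Type) [CommRing R] (Q : Type) [Group Q] [Finite Q]

/-- The twisted projection of `Q × A` to `R Q` attached to a sign character of `A`. -/
noncomputable def twist (χ : A →* ℤˣ) : Q × A →* MonoidAlgebra R Q where
  toFun p := MonoidAlgebra.single p.1 (((χ p.2 : ℤˣ) : ℤ) : R)
  map_one' := by simp [MonoidAlgebra.one_def]
  map_mul' p q := by simp [MonoidAlgebra.single_mul_single]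

/-- The decomposition of `R[Q × A]`. -/
noncomputable def decomp : MonoidAlgebra R (Q × A) →+* ((A →* ℤˣ) → MonoidAlgebra R Q) :=
  RingHom.pi fun χ => (MonoidAlgebra.lift R (MonoidAlgebra R Q) (Q × A) (twist R Q χ)).toRingHom

theorem decomp_coeff [Fintype A] (f : MonoidAlgebra R (Q × A)) (χ : A →* ℤˣ) (g : Q) :
    (decomp R Q f χ).coeff g = ∑ a, f.coeff (g, a) * (((χ a : ℤˣ) : ℤ) : R) := by
  classical
  have := Fintype.ofFinite Q
  have h : decomp R Q f χ = MonoidAlgebra.lift R (MonoidAlgebra R Q) (Q × A) (twist R Q χ) f := rfl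
  rw [h, MonoidAlgebra.lift_apply, Finsupp.sum_fintype _ _ (by simp), MonoidAlgebra.coeff_sum,
    Finsupp.finset_sum_apply, Fintype.sum_prod_type_right]
  refine Finset.sum_congr rfl fun a _ => ?_
  rw [Finset.sum_eq_single g]
  · simp [twist]
  · intro b _ hb
    simp [twist, hb]
  · simp

theorem decomp_injective (hA : ∀ a : A, a ^ 2 = 1) [IsDomain R] [CharZero R] :
    Function.Injective (decomp (A := A) R Q) := by
  classical
  have := Fintype.ofFinite A
  have := Fintype.ofFinite (A →* ℤˣ)
  rw [injective_iff_map_eq_zero]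
  intro f hf
  have h1 : ∀ (χ : A →* ℤˣ) g, ∑ a, f.coeff (g, a) * (((χ a : ℤˣ) : ℤ) : R) = 0 := by
    intro χ g
    rw [← decomp_coeff, hf]
    rfl
  ext ⟨g, b⟩
  change f.coeff (g, b) = 0
  have h2 : ∑ χ : A →* ℤˣ, (∑ a, f.coeff (g, a) * (((χ a : ℤˣ) : ℤ) : R)) * (((χ b : ℤˣ) : ℤ) : R)
      = 0 := by simp [h1]
  simp only [Finset.sum_mul] at h2
  rw [Finset.sum_comm] at h2
  have h3 : ∀ a, ∑ χ : A →* ℤˣ, f.coeff (g, a) * (((χ a : ℤˣ) : ℤ) : R) * (((χ b : ℤˣ) : ℤ) : R) =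
      if a = b then f.coeff (g, a) * (Fintype.card (A →* ℤˣ) : R) else 0 := by
    intro a
    have := congrArg (Int.cast : ℤ → R) (orth_two hA a b)
    push_cast at this
    simp only [mul_assoc, ← Finset.mul_sum]
    rw [this]
    split_ifs <;> simp
  simp only [h3, Finset.sum_ite_eq', Finset.mem_univ, if_true] at h2
  rcases mul_eq_zero.1 h2 with h | h
  · exact h
  · exact absurd h (Nat.cast_ne_zero.2 Fintype.card_ne_zero)

theorem decomp_range (t : (A →* ℤˣ) → MonoidAlgebra R Q) :
    Nat.card A • t ∈ (decomp (A := A) R Q).range := by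
  classical
  have := Fintype.ofFinite A
  have := Fintype.ofFinite (A →* ℤˣ)
  refine ⟨MonoidAlgebra.ofCoeff (Finsupp.equivFunOnFinite.symm fun p : Q × A =>
    ∑ χ : A →* ℤˣ, (t χ).coeff p.1 * (((χ p.2 : ℤˣ) : ℤ) : R)), ?_⟩
  funext ψ
  ext g
  change (decomp R Q _ ψ).coeff g = _
  rw [decomp_coeff]
  change ∑ a, (∑ χ : A →* ℤˣ, (t χ).coeff g * (((χ a : ℤˣ) : ℤ) : R)) * (((ψ a : ℤˣ) : ℤ) : R) =
    Nat.card A • (t ψ).coeff g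
  simp only [Finset.sum_mul]
  rw [Finset.sum_comm]
  have h3 : ∀ χ : A →* ℤˣ, ∑ a, (t χ).coeff g * (((χ a : ℤˣ) : ℤ) : R) * (((ψ a : ℤˣ) : ℤ) : R) =
      if χ = ψ then (t χ).coeff g * (Fintype.card A : R) else 0 := by
    intro χ
    have := congrArg (Int.cast : ℤ → R) (orth_one χ ψ)
    push_cast at this
    simp only [mul_assoc, ← Finset.mul_sum]
    rw [this]
    split_ifs <;> simp
  simp only [h3, Finset.sum_ite_eq', Finset.mem_univ, if_true]
  simp [mul_comm]

theorem monoidAlgebra_finite [Module.Finite ℤ R] : Module.Finite ℤ (MonoidAlgebra R Q) :=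
  Module.Finite.equiv (MonoidAlgebra.coeffAddEquiv (R := R) (M := Q)).toIntLinearEquiv.symm

theorem product_step (hA : ∀ a : A, a ^ 2 = 1) [IsDomain R] [CharZero R] [Module.Finite ℤ R]
    (hV : IsVirtuallyFreeByFree (MonoidAlgebra R Q)ˣ) :
    IsVirtuallyDirectProductOfFreeByFree (MonoidAlgebra R (Q × A))ˣ := by
  have hfin := monoidAlgebra_finite R Q
  have hinj := decomp_injective (A := A) R Q hA
  let F := decomp (A := A) R Q
  let φ : (MonoidAlgebra R (Q × A))ˣ →* ((A →* ℤˣ) → MonoidAlgebra R Q)ˣ := Units.map F.toMonoidHom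
  have hφ : Function.Injective φ := Units.map_injective hinj
  let e := MulEquiv.piUnits (ι := A →* ℤˣ) (M := fun _ => MonoidAlgebra R Q)
  have hfi : φ.range.FiniteIndex := by
    apply units_finiteIndex (Nat.card A) Nat.card_pos.ne'
    rintro w ⟨t, ht⟩
    have h1 : (w : (A →* ℤˣ) → MonoidAlgebra R Q) ∈ F.range := by
      rw [ht]
      exact add_mem (one_mem _) (decomp_range R Q t)
    have h2 : ((w⁻¹ : ((A →* ℤˣ) → MonoidAlgebra R Q)ˣ) : (A →* ℤˣ) → MonoidAlgebra R Q) ∈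
        F.range := by
      have h4 : ((w⁻¹ : ((A →* ℤˣ) → MonoidAlgebra R Q)ˣ) : (A →* ℤˣ) → MonoidAlgebra R Q) =
          1 - Nat.card A • (((w⁻¹ : ((A →* ℤˣ) → MonoidAlgebra R Q)ˣ) :
            (A →* ℤˣ) → MonoidAlgebra R Q) * t) := by
        have h3 := Units.inv_mul w
        rw [ht, mul_add, mul_one, mul_smul_comm] at h3
        rw [← h3]; abel
      rw [h4]
      exact sub_mem (one_mem _) (decomp_range R Q _)
    obtain ⟨a, ha⟩ := h1
    obtain ⟨b, hb⟩ := h2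
    refine ⟨⟨a, b, ?_, ?_⟩, ?_⟩
    · apply hinj
      change F (a * b) = F 1
      rw [map_mul, ha, hb, Units.mul_inv, map_one]
    · apply hinj
      change F (b * a) = F 1
      rw [map_mul, ha, hb, Units.inv_mul, map_one]
    · exact Units.ext ha
  refine virtually_product hV (e.toMonoidHom.comp φ) (e.injective.comp hφ) ?_
  have h5 : (e.toMonoidHom.comp φ).range = φ.range.comap e.symm.toMonoidHom := by
    ext x
    constructor
    · rintro ⟨y, rfl⟩
      exact ⟨y, (e.symm_apply_apply _).symm⟩
    · rintro ⟨y, hy⟩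
      refine ⟨y, ?_⟩
      change e (φ y) = x
      rw [hy]
      exact e.apply_symm_apply x
  rw [h5]
  exact finiteIndex_comap _ _

end elementary

theorem q8_step (R : Type) [CommRing R] [IsDomain R] [CharZero R] [Finite Rˣ]
    (hV : IsVirtuallyFreeByFree (QuaternionAlgebra R (-1) 0 (-1))ˣ) :
    IsVirtuallyFreeByFree (MonoidAlgebra R (QuaternionGroup 2))ˣ := by
  have : Finite ((ℤˣ × ℤˣ) → R)ˣ :=
    Finite.of_equiv _ (MulEquiv.piUnits (ι := ℤˣ × ℤˣ) (M := fun _ => R)).symm.toEquiv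
  let e := MulEquiv.prodUnits (M := (ℤˣ × ℤˣ) → R) (N := QuaternionAlgebra R (-1) 0 (-1))
  refine IsVirtuallyFreeByFree.of_injective (IsVirtuallyFreeByFree.finite_prod (F := ((ℤˣ × ℤˣ) → R)ˣ) hV)
    (e.toMonoidHom.comp (Units.map (q8emb R).toMonoidHom)) ?_
  exact e.injective.comp (Units.map_injective (q8emb_injective R))

/-- Let `d` be a squarefree negative integer with
`d ≢ 1 (mod 8)`, `K = ℚ(√d)` and `R` an order in `K`. Assume `SL₂(ℤ[√d])` is
virtually free-by-free. Let `G = Q₈ × A` with `A` a finite elementary abelian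
2-group. Then `(RG)ˣ` is virtually a direct product of finitely many
free-by-free groups. -/
theorem group_ring_units_virtually_product_of_free_by_free
    (d : ℤ) (hd : Squarefree d) (hdneg : d < 0) (hd8 : ¬d % 8 = 1)
    (K : Type) [Field K] [Algebra ℚ K]
    (hrank : Module.finrank ℚ K = 2) (α : K) (hα : α ^ 2 = (d : K))
    (R : Subring K) (hR : IsOrderIn R)
    (hSL : IsVirtuallyFreeByFree (Matrix.SpecialLinearGroup (Fin 2) (Zsqrtd d)))
    (A : Type) [CommGroup A] [Finite A] (hA : ∀ a : A, a ^ 2 = 1) :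
    IsVirtuallyDirectProductOfFreeByFree
      (MonoidAlgebra ↥R (QuaternionGroup 2 × A))ˣ := by
  have : CharZero K := algebraRat.charZero K
  have := order_finite K R hR
  have := order_units_finite d K α hdneg hrank hα R hR
  exact product_step R (QuaternionGroup 2) hA
    (q8_step R (quat_virtually d K α hd hd8 hdneg hrank hα R hR hSL))
end
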